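/- Let σ = σ_t be the standard Frobenius and let M be an F-crystal over Γ_con. Then M is semistable (i.e., isogenous over Γ_con to M₀ ⊗_Ω Γ_con for some F-crystal M₀ over Ω) if and only if the F-crystal M ⊗_{Γ_con} Γ_an,con is constant. -/

import Mathlib

open scoped Classical

/-- The analytic setting.  `F = O[1/p]` is the fraction field of a complete discrete
valuation ring `O` which is a finite totally ramified extension of the Witt vectors of an
algebraically closed field `k` of characteristic `p` (encoded via the absolute value `abv`
with `abv p = 1/p`, discreteness, completeness, and algebraically closed residue field),
equipped with a Frobenius lift `σF`.  `Γac = Γ_{an,con}` is the ring of series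
`∑_{n ∈ ℤ} cₙ tⁿ` with `cₙ ∈ F` such that `limsup_{n→+∞} |cₙ|^{1/n} ≤ 1` and
`|cₙ| ≤ p^{cn+d}` for all `n < 0`, for some constants `c, d > 0`; it is encoded by its
coefficient functionals `coeff`, and carries the standard Frobenius `frob = σ_t`
(acting by `σ` on coefficients and sending `t` to `t^p`). -/
structure AnSetting (p : ℕ) [Fact p.Prime] where
  F : Type
  [fieldF : Field F]
  abv : F → ℝ
  abv_nonneg : ∀ x, 0 ≤ abv x
  abv_eq_zero : ∀ x, abv x = 0 ↔ x = 0
  abv_mul : ∀ x y, abv (x * y) = abv x * abv y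
  abv_add_le : ∀ x y, abv (x + y) ≤ max (abv x) (abv y)
  abv_p : abv (p : F) = (p : ℝ)⁻¹
  m : ℕ
  m_pos : 0 < m
  abv_discrete : ∀ x : F, x ≠ 0 → ∃ n : ℤ, abv x = (p : ℝ) ^ ((n : ℝ) / (m : ℝ))
  complete : ∀ f : ℕ → F,
    (∀ ε : ℝ, 0 < ε → ∃ N, ∀ a ≥ N, ∀ b ≥ N, abv (f a - f b) < ε) →
    ∃ x : F, ∀ ε : ℝ, 0 < ε → ∃ N, ∀ a ≥ N, abv (f a - x) < ε
  residue_algClosed : ∀ f : Polynomial F, f.Monic → (∀ i, abv (f.coeff i) ≤ 1) →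
    0 < f.natDegree → ∃ x : F, abv x ≤ 1 ∧ abv (Polynomial.eval x f) < 1
  σF : F ≃+* F
  abv_σF : ∀ x, abv (σF x) = abv x
  σF_frob : ∀ x : F, abv x ≤ 1 → abv (σF x - x ^ p) < 1
  Γac : Type
  [commΓac : CommRing Γac]
  coeff : Γac → ℤ → F
  coeff_injective : Function.Injective coeff
  coeff_add : ∀ x y i, coeff (x + y) i = coeff x i + coeff y i
  coeff_growth : ∀ (x : Γac) (ε : ℝ), 0 < ε → ∃ N : ℤ, 0 ≤ N ∧
    ∀ n : ℤ, N ≤ n → abv (coeff x n) ≤ (1 + ε) ^ n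
  coeff_decay : ∀ x : Γac, ∃ c d : ℝ, 0 < c ∧ 0 < d ∧
    ∀ n : ℤ, n < 0 → abv (coeff x n) ≤ (p : ℝ) ^ (c * (n : ℝ) + d)
  coeff_surjective : ∀ f : ℤ → F,
    (∀ ε : ℝ, 0 < ε → ∃ N : ℤ, 0 ≤ N ∧ ∀ n : ℤ, N ≤ n → abv (f n) ≤ (1 + ε) ^ n) →
    (∃ c d : ℝ, 0 < c ∧ 0 < d ∧ ∀ n : ℤ, n < 0 → abv (f n) ≤ (p : ℝ) ^ (c * (n : ℝ) + d)) →
    ∃ x, coeff x = f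
  coeff_one : ∀ i, coeff 1 i = if i = 0 then 1 else 0
  t : Γac
  coeff_t : ∀ i, coeff t i = if i = 1 then 1 else 0
  const : F →+* Γac
  coeff_const : ∀ a i, coeff (const a) i = if i = 0 then a else 0
  coeff_mul : ∀ (x y : Γac) (n : ℤ) (ε : ℝ), 0 < ε →
    ∃ S : Finset ℤ, ∀ T : Finset ℤ, S ⊆ T →
      abv (coeff (x * y) n - ∑ i ∈ T, coeff x i * coeff y (n - i)) < ε
  frob : Γac →+* Γac
  coeff_frob : ∀ x n, coeff (frob x) n =
    if (p : ℤ) ∣ n then σF (coeff x (n / (p : ℤ))) else 0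

attribute [instance] AnSetting.fieldF AnSetting.commΓac

namespace AnSetting

variable {p : ℕ} [Fact p.Prime] (S : AnSetting p)

/-- The subring `Ω_an ⊆ Γ_{an,con}` of rigid analytic functions on the open unit disc
(series with no negative-index coefficients), as a set. -/
def omegaAnSet : Set S.Γac := {x | ∀ i : ℤ, i < 0 → S.coeff x i = 0}

/-- The subring `Γ_con[1/p] ⊆ Γ_{an,con}`: the elements whose coefficients are bounded
above, as a set. -/
def conPSet : Set S.Γac := {x | ∃ C : ℝ, ∀ i : ℤ, S.abv (S.coeff x i) ≤ C}

/-- The subring `Γ_con ⊆ Γ_{an,con}`: the elements with integral coefficients, as a set. -/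
def conSet : Set S.Γac := {x | ∀ i : ℤ, S.abv (S.coeff x i) ≤ 1}

/-- The subring `Ω = O[[t]] ⊆ Γ_{an,con}`, as a set. -/
def omegaSet : Set S.Γac := {x | (∀ i : ℤ, S.abv (S.coeff x i) ≤ 1) ∧ ∀ i : ℤ, i < 0 → S.coeff x i = 0}

end AnSetting

namespace AnSetting

variable {p : ℕ} [Fact p.Prime] (S : AnSetting p)

/-- An `F`-crystal over the subring of `Γ_{an,con}` cut out by the set `R`, presented by
the matrix of `F` on a basis: the matrix has entries in `R`, and the linearization of `F`
has kernel and cokernel killed by a power of `p`. -/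
def IsCrystal (R : Set S.Γac) {r : ℕ} (A : Matrix (Fin r) (Fin r) S.Γac) : Prop :=
  (∀ i j, A i j ∈ R) ∧
  ∃ (B : Matrix (Fin r) (Fin r) S.Γac) (ℓ : ℕ), (∀ i j, B i j ∈ R) ∧
    A * B = ((p : S.Γac) ^ ℓ) • (1 : Matrix (Fin r) (Fin r) S.Γac) ∧
    B * A = ((p : S.Γac) ^ ℓ) • (1 : Matrix (Fin r) (Fin r) S.Γac)

/-- Two `F`-crystals (with respect to the Frobenius `φ`) presented by matrices `A`, `A'`
are isogenous over the subring cut out by `R`: there are morphisms in both directions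
whose composites both equal multiplication by one common nonzero scalar. -/
def Isogenous (φ : S.Γac →+* S.Γac) (R : Set S.Γac) {r : ℕ}
    (A A' : Matrix (Fin r) (Fin r) S.Γac) : Prop :=
  ∃ (H H' : Matrix (Fin r) (Fin r) S.Γac) (c : S.F), c ≠ 0 ∧ S.abv c ≤ 1 ∧
    (∀ i j, H i j ∈ R ∧ H' i j ∈ R) ∧
    H * A = A' * H.map φ ∧ H' * A' = A * H'.map φ ∧
    H' * H = (S.const c) • (1 : Matrix (Fin r) (Fin r) S.Γac) ∧
    H * H' = (S.const c) • (1 : Matrix (Fin r) (Fin r) S.Γac)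

end AnSetting

/-- A finite totally ramified extension of the coefficient ring `O` to which `σ` extends,
together with the corresponding extension of the analytic setting. -/
structure AnExt (p : ℕ) [Fact p.Prime] (S : AnSetting p) where
  T : AnSetting p
  ι : S.F →+* T.F
  abv_ι : ∀ x, T.abv (ι x) = S.abv x
  σ_ι : ∀ x, T.σF (ι x) = ι (S.σF x)
  finite : ∃ (n : ℕ) (b : Fin n → T.F), ∀ y : T.F, ∃ a : Fin n → S.F,
    y = ∑ i, ι (a i) * b i
  totallyRamified : ∀ y : T.F, T.abv y ≤ 1 →
    ∃ x : S.F, S.abv x ≤ 1 ∧ T.abv (y - ι x) < 1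
  j : S.Γac →+* T.Γac
  coeff_j : ∀ x n, T.coeff (j x) n = ι (S.coeff x n)
  frob_j : ∀ x, T.frob (j x) = j (S.frob x)


namespace AnSetting

section basics
variable {p : ℕ} [hp : Fact p.Prime] (S : AnSetting p)

lemma one_lt_p : (1 : ℝ) < p := by exact_mod_cast hp.out.one_lt
lemma p_pos : (0 : ℝ) < p := lt_trans one_pos one_lt_p

lemma abv_zero : S.abv 0 = 0 := (S.abv_eq_zero 0).2 rfl
lemma abv_pos {x : S.F} (hx : x ≠ 0) : 0 < S.abv x :=
  lt_of_le_of_ne (S.abv_nonneg x) (fun h => hx ((S.abv_eq_zero x).1 h.symm))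
lemma abv_one : S.abv 1 = 1 := by
  have h := S.abv_mul 1 1
  rw [mul_one] at h
  have h1 := S.abv_pos (one_ne_zero)
  nlinarith [mul_self_eq_zero.1 (show (S.abv 1 * (S.abv 1 - 1)) * (S.abv 1 * (S.abv 1 - 1)) = 0 by
    have : S.abv 1 * (S.abv 1 - 1) = 0 := by linarith
    rw [this]; ring)]
lemma abv_neg (x : S.F) : S.abv (-x) = S.abv x := by
  have h : S.abv (-1) * S.abv (-1) = 1 := by rw [← S.abv_mul]; simp [S.abv_one]
  have h0 := S.abv_nonneg (-1)
  have h1 : S.abv (-1) = 1 := by nlinarith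
  rw [← neg_one_mul, S.abv_mul, h1, one_mul]
lemma abv_sub_le (x y : S.F) : S.abv (x - y) ≤ max (S.abv x) (S.abv y) := by
  rw [sub_eq_add_neg, ← S.abv_neg y]; exact S.abv_add_le _ _
lemma abv_sub_comm (x y : S.F) : S.abv (x - y) = S.abv (y - x) := by
  rw [← S.abv_neg, neg_sub]
lemma abv_add_le' {x y : S.F} {C : ℝ} (hx : S.abv x ≤ C) (hy : S.abv y ≤ C) : S.abv (x + y) ≤ C :=
  (S.abv_add_le x y).trans (max_le hx hy)
lemma abv_sub_le' {x y : S.F} {C : ℝ} (hx : S.abv x ≤ C) (hy : S.abv y ≤ C) : S.abv (x - y) ≤ C :=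
  (S.abv_sub_le x y).trans (max_le hx hy)
lemma abv_add_lt {x y : S.F} {C : ℝ} (hx : S.abv x < C) (hy : S.abv y < C) : S.abv (x + y) < C :=
  (S.abv_add_le x y).trans_lt (max_lt hx hy)
lemma abv_sub_lt {x y : S.F} {C : ℝ} (hx : S.abv x < C) (hy : S.abv y < C) : S.abv (x - y) < C :=
  (S.abv_sub_le x y).trans_lt (max_lt hx hy)
lemma abv_sum_le {α : Type*} (s : Finset α) (f : α → S.F) {C : ℝ} (hC : 0 ≤ C)
    (h : ∀ i ∈ s, S.abv (f i) ≤ C) : S.abv (∑ i ∈ s, f i) ≤ C := by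
  induction s using Finset.induction_on with
  | empty => simpa [S.abv_zero] using hC
  | insert a s ha ih =>
    rw [Finset.sum_insert ha]
    exact S.abv_add_le' (h _ (Finset.mem_insert_self _ _))
      (ih fun i hi => h i (Finset.mem_insert_of_mem hi))
lemma abv_sum_lt {α : Type*} (s : Finset α) (f : α → S.F) {C : ℝ} (hC : 0 < C)
    (h : ∀ i ∈ s, S.abv (f i) < C) : S.abv (∑ i ∈ s, f i) < C := by
  induction s using Finset.induction_on with
  | empty => simpa [S.abv_zero] using hC
  | insert a s ha ih =>
    rw [Finset.sum_insert ha]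
    exact S.abv_add_lt (h _ (Finset.mem_insert_self _ _))
      (ih fun i hi => h i (Finset.mem_insert_of_mem hi))
lemma abv_eq_of_sub_lt {x y : S.F} (h : S.abv (x - y) < S.abv y) : S.abv x = S.abv y := by
  apply le_antisymm
  · have : x = (x - y) + y := by ring
    rw [this]; exact S.abv_add_le' h.le le_rfl
  · by_contra hc
    push Not at hc
    have : y = x - (x - y) := by ring
    have h2 := S.abv_sub_lt hc h
    rw [← this] at h2
    exact lt_irrefl _ h2

/-- the absolute value as a monoid with zero hom -/
noncomputable def abvHom : S.F →*₀ ℝ where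
  toFun := S.abv
  map_zero' := S.abv_zero
  map_one' := S.abv_one
  map_mul' := S.abv_mul
lemma abv_pow (x : S.F) (n : ℕ) : S.abv (x ^ n) = S.abv x ^ n := map_pow S.abvHom x n
lemma abv_zpow (x : S.F) (n : ℤ) : S.abv (x ^ n) = S.abv x ^ n := map_zpow₀ S.abvHom x n
lemma abv_inv (x : S.F) : S.abv x⁻¹ = (S.abv x)⁻¹ := map_inv₀ S.abvHom x
lemma abv_div (x y : S.F) : S.abv (x / y) = S.abv x / S.abv y := map_div₀ S.abvHom x y

lemma eq_zero_of_forall_le {x : S.F} (h : ∀ ε : ℝ, 0 < ε → S.abv x ≤ ε) : x = 0 := by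
  by_contra hx
  have h1 := S.abv_pos hx
  have := h (S.abv x / 2) (by linarith)
  linarith
lemma eq_zero_of_pow_le {x : S.F} {C q : ℝ} (hq0 : 0 ≤ q) (hq : q < 1)
    (h : ∀ k : ℕ, S.abv x ≤ C * q ^ k) : x = 0 := by
  have ht : Filter.Tendsto (fun k : ℕ => C * q ^ k) Filter.atTop (nhds (C * 0)) :=
    (tendsto_pow_atTop_nhds_zero_of_lt_one hq0 hq).const_mul C
  have : S.abv x ≤ C * 0 := ge_of_tendsto' ht h
  exact (S.abv_eq_zero x).1 (le_antisymm (by simpa using this) (S.abv_nonneg x))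

lemma p_ne_zero : (p : S.F) ≠ 0 := by
  intro h
  have := S.abv_p
  rw [h, S.abv_zero] at this
  have h2 := inv_pos.2 (p_pos (p := p))
  linarith

/-- some power of `p` has small absolute value -/
lemma exists_p_pow (C : ℝ) : ∃ k : ℕ, S.abv ((p : S.F) ^ k) * C ≤ 1 := by
  have ht : Filter.Tendsto (fun k : ℕ => ((p : ℝ)⁻¹) ^ k * C) Filter.atTop (nhds (0 * C)) :=
    (tendsto_pow_atTop_nhds_zero_of_lt_one (inv_nonneg.2 p_pos.le)
      (inv_lt_one_of_one_lt₀ one_lt_p)).mul_const C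
  rw [zero_mul] at ht
  obtain ⟨k, hk⟩ := (ht.eventually (gt_mem_nhds one_pos)).exists
  exact ⟨k, by rw [S.abv_pow, S.abv_p]; exact hk.le⟩

/-- uniformizers -/
def IsUnif (w : S.F) : Prop := w ≠ 0 ∧ S.abv w < 1 ∧
  ∀ x : S.F, x ≠ 0 → ∃ n : ℤ, S.abv x = S.abv w ^ n

lemma exists_unif : ∃ w, S.IsUnif w := by
  -- the set of exponents
  let e : ℕ → Prop := fun n => 0 < n ∧ ∃ x : S.F, x ≠ 0 ∧ S.abv x = (p : ℝ) ^ (-(n : ℝ) / (S.m : ℝ))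
  have hm : (0 : ℝ) < S.m := by exact_mod_cast S.m_pos
  have hex : ∃ n, e n := ⟨S.m, S.m_pos, p, S.p_ne_zero, by
    rw [S.abv_p, neg_div, div_self hm.ne', Real.rpow_neg_one]⟩
  obtain ⟨h0, w, hw, hwa⟩ := Nat.find_spec hex
  set g := Nat.find hex with hg
  have hgR : (0 : ℝ) < g := by exact_mod_cast h0
  have hw1 : S.abv w < 1 := by
    rw [hwa]
    apply Real.rpow_lt_one_of_one_lt_of_neg one_lt_p
    exact div_neg_of_neg_of_pos (by linarith) hm
  refine ⟨w, hw, hw1, fun x hx => ?_⟩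
  obtain ⟨n, hn⟩ := S.abv_discrete x hx
  -- divide
  have hdm := Int.emod_add_mul_ediv (-n) g
  have hnn := Int.emod_nonneg (-n) (show (g : ℤ) ≠ 0 by omega)
  have hlt := Int.emod_lt_of_pos (-n) (show (0 : ℤ) < g by omega)
  set s := (-n) % g
  set k := (-n) / g
  have habs : S.abv (x * w ^ (-k)) = (p : ℝ) ^ (-(s.toNat : ℝ) / (S.m : ℝ)) := by
    rw [S.abv_mul, S.abv_zpow, hn, hwa, ← Real.rpow_intCast, ← Real.rpow_mul p_pos.le,
      ← Real.rpow_add p_pos]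
    congr 1
    have h2 : ((s.toNat : ℕ) : ℝ) = ((s : ℤ) : ℝ) := by
      exact_mod_cast congrArg (Int.cast (R := ℝ)) (Int.toNat_of_nonneg hnn)
    have h1 : (n : ℝ) = -((s : ℝ) + g * k) := by
      have : n = -(s + g * k) := by omega
      exact_mod_cast this
    rw [h2, h1]; push_cast; field_simp; ring
  have hs : s = 0 := by
    by_contra hs
    have : e s.toNat := ⟨by omega, x * w ^ (-k), mul_ne_zero hx (zpow_ne_zero _ hw), habs⟩
    have := Nat.find_min' hex this
    omega
  refine ⟨k, ?_⟩
  rw [hs] at habs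
  simp only [Int.toNat_zero, Nat.cast_zero, neg_zero, zero_div, Real.rpow_zero] at habs
  rw [S.abv_mul, zpow_neg, S.abv_inv, S.abv_zpow] at habs
  have := zpow_pos (S.abv_pos hw) k
  field_simp at habs
  exact habs

lemma IsUnif.le {w : S.F} (hw : S.IsUnif w) {x : S.F} (hx : S.abv x < 1) : S.abv x ≤ S.abv w := by
  by_cases h0 : x = 0
  · rw [h0, S.abv_zero]; exact S.abv_nonneg _
  obtain ⟨n, hn⟩ := hw.2.2 x h0
  have hp := S.abv_pos hw.1
  rw [hn] at hx ⊢
  have : 1 ≤ n := by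
    by_contra hc
    have : 1 ≤ S.abv w ^ n := one_le_zpow_of_nonpos₀ hp hw.2.1.le (by omega)
    linarith
  calc S.abv w ^ n ≤ S.abv w ^ (1 : ℤ) := zpow_le_zpow_right_of_le_one₀ hp hw.2.1.le this
    _ = _ := zpow_one _

/-- summation in the coefficient field -/
lemma exists_sum (a : ℕ → S.F) {C q : ℝ} (hq0 : 0 ≤ q) (hq : q < 1)
    (h : ∀ k, S.abv (a k) ≤ C * q ^ k) :
    ∃ s, ∀ K, S.abv (s - ∑ k ∈ Finset.range K, a k) ≤ C * q ^ K := by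
  have hC : 0 ≤ C := by have := (S.abv_nonneg _).trans (h 0); simpa using this
  have hd : ∀ K d, S.abv (∑ k ∈ Finset.range (K + d), a k - ∑ k ∈ Finset.range K, a k)
      ≤ C * q ^ K := by
    intro K d
    rw [Finset.sum_range_add, add_sub_cancel_left]
    refine S.abv_sum_le _ _ (by positivity) fun i _ => (h _).trans ?_
    exact mul_le_mul_of_nonneg_left (pow_le_pow_of_le_one hq0 hq.le (by omega)) hC
  have hd' : ∀ K L, K ≤ L → S.abv (∑ k ∈ Finset.range L, a k - ∑ k ∈ Finset.range K, a k)
      ≤ C * q ^ K := fun K L hKL => by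
    obtain ⟨d, rfl⟩ := Nat.exists_eq_add_of_le hKL
    exact hd K d
  obtain ⟨s, hs⟩ := S.complete (fun K => ∑ k ∈ Finset.range K, a k) (fun ε hε => by
    have ht : Filter.Tendsto (fun k : ℕ => C * q ^ k) Filter.atTop (nhds (C * 0)) :=
      (tendsto_pow_atTop_nhds_zero_of_lt_one hq0 hq).const_mul C
    rw [mul_zero] at ht
    obtain ⟨K, hK⟩ := (ht.eventually (gt_mem_nhds hε)).exists
    refine ⟨K, fun x hx y hy => ?_⟩
    have h1 := hd' K x hx
    have h2 := hd' K y hy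
    have : (∑ k ∈ Finset.range x, a k - ∑ k ∈ Finset.range y, a k) =
      (∑ k ∈ Finset.range x, a k - ∑ k ∈ Finset.range K, a k) -
      (∑ k ∈ Finset.range y, a k - ∑ k ∈ Finset.range K, a k) := by ring
    rw [this]
    exact (S.abv_sub_le' h1 h2).trans_lt hK)
  refine ⟨s, fun K => le_of_forall_pos_le_add fun ε hε => ?_⟩
  obtain ⟨N, hN⟩ := hs ε hε
  have h1 := hN (max N K) (le_max_left _ _)
  have h2 := hd' K (max N K) (le_max_right _ _)
  have : s - ∑ k ∈ Finset.range K, a k = (∑ k ∈ Finset.range (max N K), a k -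
    ∑ k ∈ Finset.range K, a k) - (∑ k ∈ Finset.range (max N K), a k - s) := by ring
  rw [this]
  have : 0 ≤ C * q ^ K := by positivity
  exact S.abv_sub_le' (by linarith) (by linarith)

/-! ### coefficients -/

/-- coefficient as additive hom -/
noncomputable def coeffHom (n : ℤ) : S.Γac →+ S.F :=
  AddMonoidHom.mk' (fun x => S.coeff x n) (fun x y => S.coeff_add x y n)
lemma coeff_zero (n : ℤ) : S.coeff 0 n = 0 := map_zero (S.coeffHom n)
lemma coeff_neg (x : S.Γac) (n : ℤ) : S.coeff (-x) n = -S.coeff x n := map_neg (S.coeffHom n) x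
lemma coeff_sub (x y : S.Γac) (n : ℤ) : S.coeff (x - y) n = S.coeff x n - S.coeff y n :=
  map_sub (S.coeffHom n) x y
lemma coeff_sum {α : Type*} (s : Finset α) (f : α → S.Γac) (n : ℤ) :
    S.coeff (∑ i ∈ s, f i) n = ∑ i ∈ s, S.coeff (f i) n := map_sum (S.coeffHom n) f s
lemma ext {x y : S.Γac} (h : ∀ n, S.coeff x n = S.coeff y n) : x = y :=
  S.coeff_injective (funext h)

lemma coeff_mul_le {x y : S.Γac} {n : ℤ} {C : ℝ} (hC : 0 ≤ C)
    (h : ∀ i, S.abv (S.coeff x i) * S.abv (S.coeff y (n - i)) ≤ C) :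
    S.abv (S.coeff (x * y) n) ≤ C := by
  apply le_of_forall_pos_le_add
  intro ε hε
  obtain ⟨T, hT⟩ := S.coeff_mul x y n ε hε
  have h1 := hT T subset_rfl
  have h2 : S.abv (∑ i ∈ T, S.coeff x i * S.coeff y (n - i)) ≤ C :=
    S.abv_sum_le _ _ hC fun i _ => by rw [S.abv_mul]; exact h i
  have : S.coeff (x * y) n = (S.coeff (x * y) n - ∑ i ∈ T, S.coeff x i * S.coeff y (n - i)) +
    ∑ i ∈ T, S.coeff x i * S.coeff y (n - i) := by ring
  rw [this]
  exact S.abv_add_le' (by linarith) (by linarith)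

lemma coeff_mul_eq {x y : S.Γac} {n : ℤ} (T : Finset ℤ)
    (h : ∀ i ∉ T, S.coeff x i * S.coeff y (n - i) = 0) :
    S.coeff (x * y) n = ∑ i ∈ T, S.coeff x i * S.coeff y (n - i) := by
  rw [← sub_eq_zero]
  apply S.eq_zero_of_forall_le
  intro ε hε
  obtain ⟨U, hU⟩ := S.coeff_mul x y n ε hε
  have h1 := hU (U ∪ T) Finset.subset_union_left
  have h2 : ∑ i ∈ U ∪ T, S.coeff x i * S.coeff y (n - i) = ∑ i ∈ T, S.coeff x i * S.coeff y (n - i) :=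
    (Finset.sum_subset Finset.subset_union_right fun i _ hi => h i hi).symm
  rw [h2] at h1
  exact h1.le

lemma coeff_const_mul (a : S.F) (x : S.Γac) (n : ℤ) :
    S.coeff (S.const a * x) n = a * S.coeff x n := by
  rw [S.coeff_mul_eq {0}]
  · simp [S.coeff_const]
  · intro i hi
    simp only [Finset.mem_singleton] at hi
    simp [S.coeff_const, hi]

lemma const_injective : Function.Injective S.const := by
  intro a b h
  have := congrArg (fun x => S.coeff x 0) h
  simpa [S.coeff_const] using this

lemma frob_const (a : S.F) : S.frob (S.const a) = S.const (S.σF a) := by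
  apply S.ext
  intro n
  have hp0 : (p : ℤ) ≠ 0 := by exact_mod_cast hp.out.ne_zero
  rw [S.coeff_frob, S.coeff_const, S.coeff_const]
  by_cases h : (p : ℤ) ∣ n
  · obtain ⟨k, rfl⟩ := h
    rw [Int.mul_ediv_cancel_left _ hp0]
    by_cases hk : k = 0 <;> simp [hk, hp.out.ne_zero]
  · have : n ≠ 0 := by rintro rfl; exact h (dvd_zero _)
    simp [h, this]

lemma natCast_eq_const (n : ℕ) : (n : S.Γac) = S.const (n : S.F) := by simp

instance : Nontrivial S.Γac := ⟨1, 0, fun h => by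
  have := congrArg (fun x => S.coeff x 0) h
  simp [S.coeff_one, S.coeff_zero] at this⟩

/-! ### decay conditions in terms of `ρ` -/

lemma coeff_decay' (x : S.Γac) : ∃ ρ C : ℝ, 0 < ρ ∧ ρ < 1 ∧ 0 < C ∧
    ∀ n : ℤ, n < 0 → S.abv (S.coeff x n) ≤ C * ρ ^ (-n) := by
  obtain ⟨c, d, hc, hd, h⟩ := S.coeff_decay x
  refine ⟨(p : ℝ) ^ (-c), (p : ℝ) ^ d, Real.rpow_pos_of_pos p_pos _,
    Real.rpow_lt_one_of_one_lt_of_neg one_lt_p (by linarith), Real.rpow_pos_of_pos p_pos _, ?_⟩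
  intro n hn
  refine (h n hn).trans_eq ?_
  rw [← Real.rpow_intCast, ← Real.rpow_mul p_pos.le, ← Real.rpow_add p_pos]
  congr 1
  push_cast; ring

lemma mk_of_decay (f : ℤ → S.F)
    (h1 : ∀ ε : ℝ, 0 < ε → ∃ N : ℤ, 0 ≤ N ∧ ∀ n : ℤ, N ≤ n → S.abv (f n) ≤ (1 + ε) ^ n)
    (h2 : ∃ ρ C : ℝ, 0 < ρ ∧ ρ < 1 ∧ ∀ n : ℤ, n < 0 → S.abv (f n) ≤ C * ρ ^ (-n)) :
    ∃ x, S.coeff x = f := by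
  obtain ⟨ρ, C, hρ0, hρ1, h⟩ := h2
  apply S.coeff_surjective f h1
  have hlp : 0 < Real.log p := Real.log_pos one_lt_p
  set C' := max C p
  have hC' : 0 < C' := lt_of_lt_of_le p_pos (le_max_right _ _)
  refine ⟨-Real.log ρ / Real.log p, Real.log C' / Real.log p,
    div_pos (neg_pos.2 (Real.log_neg hρ0 hρ1)) hlp,
    div_pos (Real.log_pos (lt_of_lt_of_le one_lt_p (le_max_right _ _))) hlp, fun n hn => ?_⟩
  refine (h n hn).trans ?_
  have e1 : (p : ℝ) ^ (-Real.log ρ / Real.log p * n + Real.log C' / Real.log p) = C' * ρ ^ (-n) := by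
    rw [Real.rpow_def_of_pos p_pos]
    have : Real.log p * (-Real.log ρ / Real.log p * n + Real.log C' / Real.log p) =
      Real.log C' + Real.log ρ * ((-n : ℤ) : ℝ) := by
      push_cast; field_simp; ring
    rw [this, Real.exp_add, Real.exp_log hC', ← Real.rpow_def_of_pos hρ0, Real.rpow_intCast]
  rw [e1]
  exact mul_le_mul_of_nonneg_right (le_max_left _ _) (zpow_nonneg hρ0.le _)

lemma growth_of_le_mul {C : ℝ} {ε : ℝ} (hε : 0 < ε) :
    ∃ N : ℤ, 0 ≤ N ∧ ∀ n : ℤ, N ≤ n → C ≤ (1 + ε) ^ n := by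
  obtain ⟨N, hN⟩ := pow_unbounded_of_one_lt C (show 1 < 1 + ε by linarith)
  refine ⟨N, by omega, fun n hn => hN.le.trans ?_⟩
  rw [← zpow_natCast]
  exact zpow_le_zpow_right₀ (by linarith) hn

/-- bounded series with decay -/
lemma mk_of_bdd (f : ℤ → S.F) (D : ℝ) (h1 : ∀ n : ℤ, 0 ≤ n → S.abv (f n) ≤ D)
    (h2 : ∃ ρ C : ℝ, 0 < ρ ∧ ρ < 1 ∧ ∀ n : ℤ, n < 0 → S.abv (f n) ≤ C * ρ ^ (-n)) :
    ∃ x, S.coeff x = f := by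
  apply S.mk_of_decay f _ h2
  intro ε hε
  obtain ⟨N, hN0, hN⟩ := growth_of_le_mul (C := D) hε
  exact ⟨N, hN0, fun n hn => (h1 n (hN0.trans hn)).trans (hN n hn)⟩

lemma decay_mono {x : S.Γac} {ρ ρ' C : ℝ} (h0 : 0 < ρ) (h : ρ ≤ ρ') (hC : 0 ≤ C)
    (hx : ∀ n : ℤ, n < 0 → S.abv (S.coeff x n) ≤ C * ρ ^ (-n)) :
    ∀ n : ℤ, n < 0 → S.abv (S.coeff x n) ≤ C * ρ' ^ (-n) := fun n hn =>
  (hx n hn).trans (mul_le_mul_of_nonneg_left (zpow_le_zpow_left₀ (by omega) h0.le h) hC)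

/-! ### the Gauss-norm bound predicate -/

/-- `|x|_ρ ≤ C` -/
def Bd (ρ C : ℝ) (x : S.Γac) : Prop := ∀ n : ℤ, S.abv (S.coeff x n) ≤ C * ρ ^ (-n)

variable {S}
lemma Bd.nonneg {ρ C : ℝ} {x : S.Γac} (h : S.Bd ρ C x) : 0 ≤ C := by
  have := (S.abv_nonneg _).trans (h 0); simpa using this
lemma Bd.mono {ρ C D : ℝ} {x : S.Γac} (hρ : 0 < ρ) (h : S.Bd ρ C x) (hCD : C ≤ D) :
    S.Bd ρ D x := fun n => (h n).trans (mul_le_mul_of_nonneg_right hCD (zpow_nonneg hρ.le _))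
lemma Bd.add {ρ C : ℝ} {x y : S.Γac} (hx : S.Bd ρ C x) (hy : S.Bd ρ C y) : S.Bd ρ C (x + y) :=
  fun n => by rw [S.coeff_add]; exact S.abv_add_le' (hx n) (hy n)
lemma Bd.sub {ρ C : ℝ} {x y : S.Γac} (hx : S.Bd ρ C x) (hy : S.Bd ρ C y) : S.Bd ρ C (x - y) :=
  fun n => by rw [S.coeff_sub]; exact S.abv_sub_le' (hx n) (hy n)
lemma Bd.neg {ρ C : ℝ} {x : S.Γac} (hx : S.Bd ρ C x) : S.Bd ρ C (-x) :=
  fun n => by rw [S.coeff_neg, S.abv_neg]; exact hx n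
lemma Bd.zero {ρ C : ℝ} (hρ : 0 < ρ) (hC : 0 ≤ C) : S.Bd ρ C 0 := fun n => by
  rw [S.coeff_zero, S.abv_zero]; exact mul_nonneg hC (zpow_nonneg hρ.le _)
lemma Bd.one {ρ : ℝ} (hρ : 0 < ρ) : S.Bd ρ 1 1 := fun n => by
  rw [S.coeff_one]
  split_ifs with h
  · simp [h, S.abv_one]
  · rw [S.abv_zero]; exact mul_nonneg zero_le_one (zpow_nonneg hρ.le _)
lemma Bd.mul {ρ C D : ℝ} {x y : S.Γac} (hρ : 0 < ρ) (hx : S.Bd ρ C x) (hy : S.Bd ρ D y) :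
    S.Bd ρ (C * D) (x * y) := fun n => by
  refine S.coeff_mul_le (mul_nonneg (mul_nonneg hx.nonneg hy.nonneg) (zpow_nonneg hρ.le _)) ?_
  intro i
  calc _ ≤ (C * ρ ^ (-i)) * (D * ρ ^ (-(n - i))) :=
        mul_le_mul (hx i) (hy _) (S.abv_nonneg _) (mul_nonneg hx.nonneg (zpow_nonneg hρ.le _))
    _ = C * D * ρ ^ (-n) := by
        rw [show -n = -i + -(n - i) by ring, zpow_add₀ hρ.ne']; ring
lemma Bd.sum {ρ C : ℝ} (hρ : 0 < ρ) (hC : 0 ≤ C) {α : Type*} (s : Finset α) (f : α → S.Γac)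
    (h : ∀ i ∈ s, S.Bd ρ C (f i)) : S.Bd ρ C (∑ i ∈ s, f i) := fun n => by
  rw [S.coeff_sum]
  exact S.abv_sum_le _ _ (mul_nonneg hC (zpow_nonneg hρ.le _)) fun i hi => h i hi n
lemma Bd.pow {ρ C : ℝ} {x : S.Γac} (hρ : 0 < ρ) (hx : S.Bd ρ C x) (k : ℕ) :
    S.Bd ρ (C ^ k) (x ^ k) := by
  induction k with
  | zero => simpa using Bd.one hρ
  | succ k ih => rw [pow_succ, pow_succ]; exact ih.mul hρ hx
lemma Bd.eq_zero {ρ C q : ℝ} (hq0 : 0 ≤ q) (hq : q < 1) {x : S.Γac} (hρ : 0 < ρ)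
    (h : ∀ k : ℕ, S.Bd ρ (C * q ^ k) x) : x = 0 := by
  apply S.ext
  intro n
  rw [S.coeff_zero]
  exact S.eq_zero_of_pow_le (C := C * ρ ^ (-n)) hq0 hq fun k => (h k n).trans_eq (by ring)
variable (S)

lemma exists_sum_series (z : ℕ → S.Γac) {ρ C q D : ℝ} (hρ0 : 0 < ρ) (hρ : ρ < 1)
    (hq0 : 0 ≤ q) (hq : q < 1) (h : ∀ k, S.Bd ρ (C * q ^ k) (z k))
    (hD : ∀ k, ∀ n : ℤ, 0 ≤ n → S.abv (S.coeff (z k) n) ≤ D) :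
    ∃ s, (∀ K, S.Bd ρ (C * q ^ K) (s - ∑ k ∈ Finset.range K, z k)) ∧
      ∀ n B, (∀ k, S.abv (S.coeff (z k) n) ≤ B) → S.abv (S.coeff s n) ≤ B := by
  have h1 : ∀ n : ℤ, ∃ s, ∀ K, S.abv (s - ∑ k ∈ Finset.range K, S.coeff (z k) n) ≤
      (C * ρ ^ (-n)) * q ^ K := fun n =>
    S.exists_sum _ hq0 hq fun k => (h k n).trans_eq (by ring)
  choose f hf using h1
  have hC : 0 ≤ C := by simpa using (h 0).nonneg
  have hB : ∀ n B, (∀ k, S.abv (S.coeff (z k) n) ≤ B) → S.abv (f n) ≤ B := by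
    intro n B hB
    have hB0 : 0 ≤ B := (S.abv_nonneg _).trans (hB 0)
    apply le_of_forall_pos_le_add
    intro ε hε
    have ht : Filter.Tendsto (fun k : ℕ => (C * ρ ^ (-n)) * q ^ k) Filter.atTop
        (nhds ((C * ρ ^ (-n)) * 0)) :=
      (tendsto_pow_atTop_nhds_zero_of_lt_one hq0 hq).const_mul _
    rw [mul_zero] at ht
    obtain ⟨K, hK⟩ := (ht.eventually (gt_mem_nhds hε)).exists
    have e : f n = (f n - ∑ k ∈ Finset.range K, S.coeff (z k) n) +
      ∑ k ∈ Finset.range K, S.coeff (z k) n := by ring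
    rw [e]
    refine S.abv_add_le' ((hf n K).trans (by linarith)) ?_
    exact (S.abv_sum_le _ _ hB0 fun i _ => hB i).trans (by linarith)
  obtain ⟨s, hs⟩ := S.mk_of_bdd f D (fun n hn => hB n D fun k => hD k n hn)
    ⟨ρ, C, hρ0, hρ, fun n _ => by have := hf n 0; simpa using this⟩
  refine ⟨s, fun K n => ?_, fun n B hh => ?_⟩
  · rw [S.coeff_sub, S.coeff_sum, hs]; exact (hf n K).trans_eq (by ring)
  · rw [hs]; exact hB n B hh

end basics
end AnSetting


namespace AnSetting

section inversion
variable {p : ℕ} [hp : Fact p.Prime] (S : AnSetting p)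

/-- the bounded elements as a subring -/
noncomputable def bdR : Subring S.Γac where
  carrier := S.conPSet
  zero_mem' := ⟨0, fun n => by rw [S.coeff_zero, S.abv_zero]⟩
  one_mem' := ⟨1, fun n => by simpa using Bd.one (S := S) one_pos n⟩
  add_mem' := by
    rintro x y ⟨C, hC⟩ ⟨D, hD⟩
    exact ⟨max C D, fun n => by
      rw [S.coeff_add]
      exact S.abv_add_le' ((hC n).trans (le_max_left _ _)) ((hD n).trans (le_max_right _ _))⟩
  neg_mem' := by
    rintro x ⟨C, hC⟩
    exact ⟨C, fun n => by rw [S.coeff_neg, S.abv_neg]; exact hC n⟩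
  mul_mem' := by
    rintro x y ⟨C, hC⟩ ⟨D, hD⟩
    have h1 : S.Bd 1 C x := fun n => by simpa using hC n
    have h2 : S.Bd 1 D y := fun n => by simpa using hD n
    exact ⟨C * D, fun n => by simpa using (h1.mul one_pos h2) n⟩

/-- `Γ_con` as a subring -/
noncomputable def conR : Subring S.Γac where
  carrier := S.conSet
  zero_mem' := fun n => by rw [S.coeff_zero, S.abv_zero]; exact zero_le_one
  one_mem' := fun n => by simpa using Bd.one (S := S) one_pos n
  add_mem' := by
    intro x y hC hD n
    rw [S.coeff_add]
    exact S.abv_add_le' (hC n) (hD n)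
  neg_mem' := by
    intro x hC n
    rw [S.coeff_neg, S.abv_neg]; exact hC n
  mul_mem' := by
    intro x y hC hD n
    have h1 : S.Bd 1 1 x := fun n => by simpa using hC n
    have h2 : S.Bd 1 1 y := fun n => by simpa using hD n
    simpa using (h1.mul one_pos h2) n

/-- `Ω_an` as a subring -/
noncomputable def oanR : Subring S.Γac where
  carrier := S.omegaAnSet
  zero_mem' := fun n _ => S.coeff_zero n
  one_mem' := fun n hn => by rw [S.coeff_one, if_neg (by omega)]
  add_mem' := by
    intro x y hC hD n hn
    rw [S.coeff_add, hC n hn, hD n hn, add_zero]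
  neg_mem' := by
    intro x hC n hn
    rw [S.coeff_neg, hC n hn, neg_zero]
  mul_mem' := by
    intro x y hx hy n hn
    rw [S.coeff_mul_eq ∅]
    · simp
    · intro i _
      by_cases hi : i < 0
      · rw [hx i hi, zero_mul]
      · rw [hy (n - i) (by omega), mul_zero]

lemma mem_conR {x : S.Γac} : x ∈ S.conR ↔ ∀ i, S.abv (S.coeff x i) ≤ 1 := Iff.rfl
lemma mem_bdR {x : S.Γac} : x ∈ S.bdR ↔ ∃ C, ∀ i, S.abv (S.coeff x i) ≤ C := Iff.rfl
lemma mem_oanR {x : S.Γac} : x ∈ S.oanR ↔ ∀ i, i < 0 → S.coeff x i = 0 := Iff.rfl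
lemma mem_omega {x : S.Γac} : x ∈ S.omegaSet ↔ x ∈ S.conR ∧ x ∈ S.oanR := Iff.rfl
lemma conR_le_bdR : S.conR ≤ S.bdR := fun _ hx => ⟨1, hx⟩

lemma const_mem_oanR (a : S.F) : S.const a ∈ S.oanR := fun n hn => by
  rw [S.coeff_const, if_neg (by omega)]
lemma const_mem_bdR (a : S.F) : S.const a ∈ S.bdR := ⟨S.abv a, fun n => by
  rw [S.coeff_const]; split_ifs
  · exact le_rfl
  · rw [S.abv_zero]; exact S.abv_nonneg _⟩
lemma const_mem_conR {a : S.F} (ha : S.abv a ≤ 1) : S.const a ∈ S.conR := fun n => by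
  rw [S.coeff_const]; split_ifs
  · exact ha
  · rw [S.abv_zero]; exact zero_le_one

lemma frob_mem_conR {x : S.Γac} (hx : x ∈ S.conR) : S.frob x ∈ S.conR := fun n => by
  rw [S.coeff_frob]; split_ifs
  · rw [S.abv_σF]; exact hx _
  · rw [S.abv_zero]; exact zero_le_one
lemma frob_mem_oanR {x : S.Γac} (hx : x ∈ S.oanR) : S.frob x ∈ S.oanR := fun n hn => by
  rw [S.coeff_frob]; split_ifs
  · rw [hx, map_zero]
    have h0 : (0 : ℤ) < p := by exact_mod_cast hp.out.pos
    exact Int.ediv_neg_of_neg_of_pos hn h0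
  · rfl

lemma det_mem (R : Subring S.Γac) {r : ℕ} {A : Matrix (Fin r) (Fin r) S.Γac}
    (h : ∀ i j, A i j ∈ R) : A.det ∈ R := by
  rw [Matrix.det_apply]
  refine sum_mem fun s _ => ?_
  rw [Units.smul_def]
  exact zsmul_mem (prod_mem fun i _ => h _ _) _

lemma adjugate_mem (R : Subring S.Γac) {r : ℕ} {A : Matrix (Fin r) (Fin r) S.Γac}
    (h : ∀ i j, A i j ∈ R) : ∀ i j, A.adjugate i j ∈ R := by
  intro i j
  rw [Matrix.adjugate_apply]
  apply S.det_mem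
  intro k l
  rw [Matrix.updateRow_apply]
  split_ifs
  · rw [Pi.single_apply]; split_ifs
    · exact one_mem _
    · exact zero_mem _
  · exact h _ _

lemma mul_mem_mat (R : Subring S.Γac) {r : ℕ} {A B : Matrix (Fin r) (Fin r) S.Γac}
    (hA : ∀ i j, A i j ∈ R) (hB : ∀ i j, B i j ∈ R) : ∀ i j, (A * B) i j ∈ R := fun i j => by
  rw [Matrix.mul_apply]; exact sum_mem fun k _ => mul_mem (hA _ _) (hB _ _)
lemma mulVec_mem (R : Subring S.Γac) {r : ℕ} {A : Matrix (Fin r) (Fin r) S.Γac}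
    {v : Fin r → S.Γac}
    (hA : ∀ i j, A i j ∈ R) (hB : ∀ i, v i ∈ R) : ∀ i, (A.mulVec v) i ∈ R := fun i => by
  rw [Matrix.mulVec, dotProduct]; exact sum_mem fun k _ => mul_mem (hA _ _) (hB _)

/-! monomials -/

lemma exists_mono (k : ℤ) : ∃ x : S.Γac, S.coeff x = fun n => if n = k then 1 else 0 := by
  apply S.mk_of_bdd _ 1
  · intro n _
    split_ifs
    · exact S.abv_one.le
    · rw [S.abv_zero]; exact zero_le_one
  · refine ⟨1/2, (1/2 : ℝ) ^ k, by norm_num, by norm_num, fun n _ => ?_⟩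
    split_ifs with h
    · subst h; rw [S.abv_one, ← zpow_add₀ (by norm_num)]; simp
    · rw [S.abv_zero]; positivity

/-- the monomial `t ^ k` -/
noncomputable def tz (k : ℤ) : S.Γac := (S.exists_mono k).choose
lemma coeff_tz (k n : ℤ) : S.coeff (S.tz k) n = if n = k then 1 else 0 :=
  congrFun (S.exists_mono k).choose_spec n
lemma coeff_tz_mul (k : ℤ) (x : S.Γac) (n : ℤ) : S.coeff (S.tz k * x) n = S.coeff x (n - k) := by
  rw [S.coeff_mul_eq {k}]
  · simp [S.coeff_tz]
  · intro i hi
    simp only [Finset.mem_singleton] at hi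
    simp [S.coeff_tz, hi]
lemma tz_mul_tz (k l : ℤ) : S.tz k * S.tz l = S.tz (k + l) := S.ext fun n => by
  rw [coeff_tz_mul, coeff_tz, coeff_tz]
  congr 1
  simp only [eq_iff_iff]; omega
lemma tz_zero : S.tz 0 = 1 := S.ext fun n => by rw [coeff_tz, S.coeff_one]
lemma tz_mem_conR (k : ℤ) : S.tz k ∈ S.conR := fun n => by
  rw [coeff_tz]; split_ifs
  · exact S.abv_one.le
  · rw [S.abv_zero]; exact zero_le_one

/-- choice of a radius -/
lemma exists_radius {x : S.Γac} {q : ℝ} (hq0 : 0 < q) (hq : q < 1)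
    (h1 : ∀ n, S.abv (S.coeff x n) ≤ 1) (h0 : S.coeff x 0 = 0)
    (hneg : ∀ n, n < 0 → S.abv (S.coeff x n) ≤ q) :
    ∃ ρ q' : ℝ, 0 < ρ ∧ ρ < 1 ∧ 0 < q' ∧ q' < 1 ∧ S.Bd ρ q' x := by
  obtain ⟨ρ0, C, hρ0, hρ01, hC, hd⟩ := S.coeff_decay' x
  set ρ1 := Real.sqrt ρ0
  have hρ1 : 0 < ρ1 := Real.sqrt_pos.2 hρ0
  have hρ11 : ρ1 < 1 := by rw [Real.sqrt_lt' one_pos]; simpa using hρ01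
  have hsq : ρ1 * ρ1 = ρ0 := Real.mul_self_sqrt hρ0.le
  set s := Real.sqrt q
  have hs0 : 0 < s := Real.sqrt_pos.2 hq0
  have hs1 : s < 1 := by rw [Real.sqrt_lt' one_pos]; simpa using hq
  have hss : s * s = q := Real.mul_self_sqrt hq0.le
  have ht : Filter.Tendsto (fun k : ℕ => C * ρ1 ^ k) Filter.atTop (nhds (C * 0)) :=
      (tendsto_pow_atTop_nhds_zero_of_lt_one hρ1.le hρ11).const_mul _
  rw [mul_zero] at ht
  obtain ⟨M, hM⟩ := (ht.eventually (gt_mem_nhds hs0)).exists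
  -- choose ρ close to one
  have hcont : Filter.Tendsto (fun ρ : ℝ => ρ ^ M) (nhdsWithin 1 (Set.Iio 1)) (nhds (1 ^ M)) :=
    ((continuous_pow M).tendsto 1).mono_left nhdsWithin_le_nhds
  rw [one_pow] at hcont
  have hev := (hcont.eventually (lt_mem_nhds hs1)).and
    ((Filter.Eventually.filter_mono nhdsWithin_le_nhds (lt_mem_nhds hρ11)).and self_mem_nhdsWithin)
  obtain ⟨ρ, hρM, hρ1ρ, hρlt⟩ := hev.exists
  have hρlt : ρ < 1 := hρlt
  have hρ : 0 < ρ := hρ1.trans hρ1ρ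
  refine ⟨ρ, max s ρ, hρ, hρlt, lt_max_of_lt_left hs0, max_lt hs1 hρlt, ?_⟩
  intro n
  have hz : 0 < ρ ^ (-n) := zpow_pos hρ _
  rcases lt_trichotomy n 0 with hn | hn | hn
  · refine le_trans ?_ (mul_le_mul_of_nonneg_right (le_max_left _ _) hz.le)
    obtain ⟨k, rfl⟩ : ∃ k : ℕ, n = -k := ⟨(-n).toNat, by omega⟩
    have e : -(-(k : ℤ)) = (k : ℤ) := by ring
    rw [e, zpow_natCast]
    by_cases hkM : M ≤ k
    · have := hd (-k) hn
      rw [e, zpow_natCast] at this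
      calc _ ≤ C * ρ0 ^ k := this
        _ = (C * ρ1 ^ k) * ρ1 ^ k := by rw [← hsq, mul_pow]; ring
        _ ≤ (C * ρ1 ^ M) * ρ ^ k := by
          apply mul_le_mul _ (pow_le_pow_left₀ hρ1.le hρ1ρ.le _) (by positivity) (by positivity)
          exact mul_le_mul_of_nonneg_left (pow_le_pow_of_le_one hρ1.le hρ11.le hkM) hC.le
        _ ≤ s * ρ ^ k := mul_le_mul_of_nonneg_right hM.le (by positivity)
    · calc _ ≤ q := hneg _ hn
        _ = s * s := hss.symm
        _ ≤ s * ρ ^ k := by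
          apply mul_le_mul_of_nonneg_left _ hs0.le
          exact hρM.le.trans (pow_le_pow_of_le_one hρ.le hρlt.le (by omega))
  · subst hn
    rw [h0, S.abv_zero]
    positivity
  · refine le_trans ?_ (mul_le_mul_of_nonneg_right (le_max_right _ _) hz.le)
    refine (h1 n).trans ?_
    have : ρ * ρ ^ (-n) = ρ ^ (1 - n) := by
      rw [sub_eq_add_neg, zpow_add₀ hρ.ne', zpow_one]
    rw [this]
    exact one_le_zpow_of_nonpos₀ hρ hρlt.le (by omega)

/-- normalized leading behaviour: norm `|c|`, order `s` -/
def Nrm (x : S.Γac) (c : S.F) (s : ℤ) : Prop :=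
  c ≠ 0 ∧ (∀ n, S.abv (S.coeff x n) ≤ S.abv c) ∧ S.abv (S.coeff x s) = S.abv c ∧
    ∀ n, n < s → S.abv (S.coeff x n) < S.abv c

lemma inv_aux {x : S.Γac} (h1 : ∀ n, S.abv (S.coeff x n) ≤ 1) (h0 : S.coeff x 0 = 1)
    (hneg : ∀ n, n < 0 → S.abv (S.coeff x n) < 1) :
    ∃ y, x * y = 1 ∧ (∀ n, S.abv (S.coeff y n) ≤ 1) ∧ ∀ n, n < 0 → S.abv (S.coeff y n) < 1 := by
  obtain ⟨w, hw⟩ := S.exists_unif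
  have hw0 := S.abv_pos hw.1
  set E := 1 - x with hE
  have hE1 : ∀ n, n ≠ 0 → S.coeff E n = - S.coeff x n := fun n hn => by
    rw [hE, S.coeff_sub, S.coeff_one, if_neg hn, zero_sub]
  have hE0 : S.coeff E 0 = 0 := by rw [hE, S.coeff_sub, S.coeff_one, h0]; simp
  have hEc : ∀ n, S.abv (S.coeff E n) ≤ 1 := fun n => by
    by_cases hn : n = 0
    · rw [hn, hE0, S.abv_zero]; exact zero_le_one
    · rw [hE1 n hn, S.abv_neg]; exact h1 n
  have hEn : ∀ n, n < 0 → S.abv (S.coeff E n) ≤ S.abv w := fun n hn => by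
    rw [hE1 n hn.ne, S.abv_neg]; exact hw.le S (hneg n hn)
  obtain ⟨ρ, q, hρ0, hρ1, hq0, hq1, hB⟩ := S.exists_radius hw0 hw.2.1 hEc hE0 hEn
  have hpow : ∀ k : ℕ, (∀ n, S.abv (S.coeff (E ^ k) n) ≤ 1) ∧
      ∀ n, n < 0 → S.abv (S.coeff (E ^ k) n) ≤ S.abv w := by
    intro k
    induction k with
    | zero =>
      refine ⟨fun n => ?_, fun n hn => ?_⟩
      · simpa using Bd.one (S := S) one_pos n
      · rw [pow_zero, S.coeff_one, if_neg hn.ne, S.abv_zero]; exact hw0.le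
    | succ k ih =>
      refine ⟨fun n => ?_, fun n hn => ?_⟩
      · rw [pow_succ]
        exact S.coeff_mul_le zero_le_one fun i =>
          mul_le_one₀ (ih.1 _) (S.abv_nonneg _) (hEc _)
      · rw [pow_succ]
        refine S.coeff_mul_le hw0.le fun i => ?_
        by_cases hi : i < 0
        · calc _ ≤ S.abv w * 1 := mul_le_mul (ih.2 i hi) (hEc _) (S.abv_nonneg _) hw0.le
            _ = _ := mul_one _
        · calc _ ≤ 1 * S.abv w := mul_le_mul (ih.1 i) (hEn _ (by omega)) (S.abv_nonneg _) zero_le_one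
            _ = _ := one_mul _
  obtain ⟨y, hy, hyB⟩ := S.exists_sum_series (fun k => E ^ k) (C := 1) (D := 1) hρ0 hρ1 hq0.le hq1
    (fun k => by simpa using hB.pow hρ0 k) (fun k n _ => (hpow k).1 n)
  refine ⟨y, ?_, fun n => hyB n 1 fun k => (hpow k).1 n, fun n hn =>
    (hyB n _ fun k => (hpow k).2 n hn).trans_lt hw.2.1⟩
  have hx : x = 1 - E := by rw [hE]; ring
  rw [← sub_eq_zero]
  apply Bd.eq_zero (C := 1) hq0.le hq1 hρ0
  intro K
  have e : x * y - 1 = (1 - E) * (y - ∑ k ∈ Finset.range K, E ^ k) - E ^ K := by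
    have := mul_neg_geom_sum E K
    rw [mul_sub, this, hx]; ring
  rw [e]
  refine Bd.sub ?_ (by simpa using hB.pow hρ0 K)
  have h3 : S.Bd ρ 1 (1 - E) := (Bd.one hρ0).sub (hB.mono hρ0 hq1.le)
  simpa using h3.mul hρ0 (hy K)

lemma Nrm.inv {x : S.Γac} {c : S.F} {s : ℤ} (h : S.Nrm x c s) :
    ∃ y, x * y = 1 ∧ (∀ n, S.abv (S.coeff y n) ≤ (S.abv c)⁻¹) ∧
      ∀ n, n < -s → S.abv (S.coeff y n) < (S.abv c)⁻¹ := by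
  obtain ⟨hc, h1, h2, h3⟩ := h
  have hc0 := S.abv_pos hc
  set a := S.coeff x s with ha
  have ha0 : a ≠ 0 := by intro h; rw [h, S.abv_zero] at h2; linarith
  obtain ⟨y, hy, hy1, hy2⟩ := S.inv_aux (x := S.const a⁻¹ * (S.tz (-s) * x))
    (fun n => by
      rw [S.coeff_const_mul, S.coeff_tz_mul, S.abv_mul, S.abv_inv, h2, inv_mul_le_iff₀ hc0, mul_one]
      exact h1 _)
    (by rw [S.coeff_const_mul, S.coeff_tz_mul]; simp [← ha, ha0])
    (fun n hn => by
      rw [S.coeff_const_mul, S.coeff_tz_mul, S.abv_mul, S.abv_inv, h2, inv_mul_lt_iff₀ hc0, mul_one]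
      exact h3 _ (by omega))
  refine ⟨S.const a⁻¹ * (S.tz (-s) * y), by rw [← hy]; ring, fun n => ?_, fun n hn => ?_⟩
  · rw [S.coeff_const_mul, S.coeff_tz_mul, S.abv_mul, S.abv_inv, h2]
    calc _ ≤ (S.abv c)⁻¹ * 1 := mul_le_mul_of_nonneg_left (hy1 _) (by positivity)
      _ = _ := mul_one _
  · rw [S.coeff_const_mul, S.coeff_tz_mul, S.abv_mul, S.abv_inv, h2]
    calc _ < (S.abv c)⁻¹ * 1 := mul_lt_mul_of_pos_left (hy2 _ (by omega)) (by positivity)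
      _ = _ := mul_one _

lemma exists_nrm {x : S.Γac} (hx : x ∈ S.bdR) (h0 : x ≠ 0) : ∃ c s, S.Nrm x c s := by
  obtain ⟨C, hC⟩ := hx
  obtain ⟨w, hw⟩ := S.exists_unif
  have hw0 := S.abv_pos hw.1
  obtain ⟨i, hi⟩ : ∃ i, S.coeff x i ≠ 0 := by
    by_contra hc
    push Not at hc
    exact h0 (S.ext fun n => by rw [hc, S.coeff_zero])
  -- maximal norm: exponents bounded below
  have hlow : ∃ b : ℤ, ∀ e : ℤ, S.abv w ^ e ≤ C → b ≤ e := by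
    obtain ⟨N, hN⟩ := pow_unbounded_of_one_lt C ((one_lt_inv₀ hw0).2 hw.2.1)
    refine ⟨-N, fun e he => ?_⟩
    by_contra hc
    push Not at hc
    have : (S.abv w) ^ (-(N : ℤ)) ≤ S.abv w ^ e :=
      zpow_le_zpow_right_of_le_one₀ hw0 hw.2.1.le hc.le
    rw [zpow_neg, zpow_natCast, ← inv_pow] at this
    linarith
  obtain ⟨b, hb⟩ := hlow
  let P : ℤ → Prop := fun e => ∃ i, S.coeff x i ≠ 0 ∧ S.abv (S.coeff x i) = S.abv w ^ e
  obtain ⟨e, ⟨i1, hi1, he⟩, hmin⟩ := Int.exists_least_of_bdd (P := P)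
    ⟨b, fun z ⟨i, hi, h⟩ => hb z (h ▸ hC i)⟩
    (by obtain ⟨n, hn⟩ := hw.2.2 _ hi; exact ⟨n, i, hi, hn⟩)
  have hle : ∀ n, S.abv (S.coeff x n) ≤ S.abv (S.coeff x i1) := by
    intro n
    by_cases hn : S.coeff x n = 0
    · rw [hn, S.abv_zero]; exact S.abv_nonneg _
    obtain ⟨k, hk⟩ := hw.2.2 _ hn
    rw [hk, he]
    exact zpow_le_zpow_right_of_le_one₀ hw0 hw.2.1.le (hmin k ⟨n, hn, hk⟩)
  -- least index
  obtain ⟨ρ, D, hρ0, hρ1, hD, hd⟩ := S.coeff_decay' x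
  have hc0 := S.abv_pos hi1
  have ht : Filter.Tendsto (fun k : ℕ => D * ρ ^ k) Filter.atTop (nhds (D * 0)) :=
      (tendsto_pow_atTop_nhds_zero_of_lt_one hρ0.le hρ1).const_mul _
  rw [mul_zero] at ht
  obtain ⟨M, hM⟩ := (ht.eventually (gt_mem_nhds hc0)).exists
  obtain ⟨s, hs, hsmin⟩ := Int.exists_least_of_bdd
    (P := fun n => S.abv (S.coeff x n) = S.abv (S.coeff x i1))
    ⟨-M - 1, fun z hz => by
      by_contra hc
      have hz' := hd z (by omega)
      rw [hz] at hz'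
      have : ρ ^ (-z) ≤ ρ ^ (M : ℤ) := zpow_le_zpow_right_of_le_one₀ hρ0 hρ1.le (by omega)
      rw [zpow_natCast] at this
      nlinarith⟩ ⟨i1, rfl⟩
  refine ⟨S.coeff x i1, s, hi1, hle, hs, fun n hn => lt_of_le_of_ne (hle n) fun h => ?_⟩
  have := hsmin n h
  omega

lemma exists_inv {x : S.Γac} (hx : x ∈ S.bdR) (h0 : x ≠ 0) : ∃ y ∈ S.bdR, x * y = 1 := by
  obtain ⟨c, s, h⟩ := S.exists_nrm hx h0
  obtain ⟨y, h1, h2, -⟩ := h.inv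
  exact ⟨y, ⟨_, h2⟩, h1⟩

/-- inverses of matrices over bounded elements -/
lemma exists_mat_inv {r : ℕ} {V : Matrix (Fin r) (Fin r) S.Γac} (hV : ∀ i j, V i j ∈ S.bdR)
    (h0 : V.det ≠ 0) : ∃ W : Matrix (Fin r) (Fin r) S.Γac, (∀ i j, W i j ∈ S.bdR) ∧
      V * W = 1 ∧ W * V = 1 := by
  obtain ⟨y, hy, hy1⟩ := S.exists_inv (S.det_mem _ hV) h0
  refine ⟨y • V.adjugate, fun i j => ?_, ?_, ?_⟩
  · exact mul_mem hy (S.adjugate_mem _ hV i j)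
  · rw [Matrix.mul_smul, Matrix.mul_adjugate, smul_smul, mul_comm y, hy1, one_smul]
  · rw [Matrix.smul_mul, Matrix.adjugate_mul, smul_smul, mul_comm y, hy1, one_smul]

end inversion
end AnSetting


namespace AnSetting

section splitting
variable {p : ℕ} [hp : Fact p.Prime] (S : AnSetting p)

/-- truncation of a series to a set of indices -/
lemma exists_trunc (s : Set ℤ) (x : S.Γac) : ∃ y : S.Γac, S.coeff y = fun n =>
    if n ∈ s then S.coeff x n else 0 := by
  have h : ∀ n, S.abv (if n ∈ s then S.coeff x n else 0) ≤ S.abv (S.coeff x n) := fun n => by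
    split_ifs
    · exact le_rfl
    · rw [S.abv_zero]; exact S.abv_nonneg _
  apply S.mk_of_decay
  · intro ε hε
    obtain ⟨N, hN, h1⟩ := S.coeff_growth x ε hε
    exact ⟨N, hN, fun n hn => (h n).trans (h1 n hn)⟩
  · obtain ⟨ρ, C, h0, h1, _, h2⟩ := S.coeff_decay' x
    exact ⟨ρ, C, h0, h1, fun n hn => (h n).trans (h2 n hn)⟩

/-- truncation -/
noncomputable def trunc (s : Set ℤ) (x : S.Γac) : S.Γac := (S.exists_trunc s x).choose
lemma coeff_trunc (s : Set ℤ) (x : S.Γac) (n : ℤ) : S.coeff (S.trunc s x) n =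
    if n ∈ s then S.coeff x n else 0 := congrFun (S.exists_trunc s x).choose_spec n

/-- the negative part -/
noncomputable def negp : S.Γac →+ S.Γac := AddMonoidHom.mk' (S.trunc (Set.Iio 0)) (fun x y => by
  apply S.ext; intro n
  rw [S.coeff_add]; simp only [S.coeff_trunc, S.coeff_add]
  split_ifs <;> simp)
lemma coeff_negp (x : S.Γac) (n : ℤ) : S.coeff (S.negp x) n = if n < 0 then S.coeff x n else 0 := by
  have h := S.coeff_trunc (Set.Iio 0) x n
  by_cases hn : n < 0
  · rw [if_pos hn]; rw [if_pos (Set.mem_Iio.2 hn)] at h; exact h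
  · rw [if_neg hn]; rw [if_neg (fun hh => hn (Set.mem_Iio.1 hh))] at h; exact h
lemma Bd.negp {ρ C : ℝ} {x : S.Γac} (hρ : 0 < ρ) (h : S.Bd ρ C x) : S.Bd ρ C (S.negp x) := by
  intro n
  rw [S.coeff_negp]; split_ifs
  · exact h n
  · rw [S.abv_zero]; exact mul_nonneg h.nonneg (zpow_nonneg hρ.le _)

/-- the tails are small in the Gauss norm -/
lemma tails {x : S.Γac} {ρ0 ρ C ε : ℝ} (hρ0 : 0 < ρ0) (hρ : ρ0 < ρ) (hρ1 : ρ < 1)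
    (hd : ∀ n : ℤ, n < 0 → S.abv (S.coeff x n) ≤ C * ρ0 ^ (-n)) (hε : 0 < ε) :
    ∃ N : ℕ, ∀ n : ℤ, n ∉ Set.Icc (-N : ℤ) N → S.abv (S.coeff x n) ≤ ε * ρ ^ (-n) := by
  have hρp : 0 < ρ := hρ0.trans hρ
  -- positive side
  set δ := (ρ⁻¹ - 1) / 2 with hδ
  have hinv : 1 < ρ⁻¹ := (one_lt_inv₀ hρp).2 hρ1
  have hδ0 : 0 < δ := by rw [hδ]; linarith
  obtain ⟨N1, hN10, hN1⟩ := S.coeff_growth x δ hδ0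
  have hlt : (1 + δ) * ρ < 1 := by
    have h1 : 1 + δ < ρ⁻¹ := by rw [hδ]; linarith
    calc (1 + δ) * ρ < ρ⁻¹ * ρ := mul_lt_mul_of_pos_right h1 hρp
      _ = 1 := inv_mul_cancel₀ hρp.ne'
  have hth0 : 0 ≤ (1 + δ) * ρ := by positivity
  obtain ⟨M1, hM1⟩ := exists_pow_lt_of_lt_one hε hlt
  -- negative side
  have hq : ρ0 / ρ < 1 := (div_lt_one hρp).2 hρ
  have hq0 : 0 ≤ ρ0 / ρ := by positivity
  obtain ⟨M2, hM2⟩ := exists_pow_lt_of_lt_one (show 0 < ε / (|C| + 1) by positivity) hq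
  refine ⟨N1.toNat + M1 + M2, fun n hn => ?_⟩
  simp only [Set.mem_Icc, not_and_or, not_le] at hn
  push_cast at hn
  rcases hn with hn | hn
  · obtain ⟨k, rfl⟩ : ∃ k : ℕ, n = -k := ⟨(-n).toNat, by omega⟩
    have h1 := hd (-k) (by omega)
    rw [neg_neg, zpow_natCast] at h1 ⊢
    refine h1.trans ?_
    have h2 : (ρ0 / ρ) ^ k ≤ (ρ0 / ρ) ^ M2 := pow_le_pow_of_le_one hq0 hq.le (by omega)
    have h3 : C ≤ |C| + 1 := by linarith [le_abs_self C]
    calc C * ρ0 ^ k ≤ (|C| + 1) * ρ0 ^ k := mul_le_mul_of_nonneg_right h3 (by positivity)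
      _ = (|C| + 1) * (ρ0 / ρ) ^ k * ρ ^ k := by
        rw [div_pow]; field_simp
      _ ≤ (|C| + 1) * (ε / (|C| + 1)) * ρ ^ k := by
        apply mul_le_mul_of_nonneg_right _ (by positivity)
        exact mul_le_mul_of_nonneg_left (h2.trans hM2.le) (by positivity)
      _ = ε * ρ ^ k := by field_simp
  · obtain ⟨k, rfl⟩ : ∃ k : ℕ, n = k := ⟨n.toNat, by omega⟩
    refine (hN1 _ (by omega)).trans ?_
    rw [zpow_neg, zpow_natCast, zpow_natCast, ← div_eq_mul_inv, le_div_iff₀ (by positivity),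
      ← mul_pow]
    exact (pow_le_pow_of_le_one hth0 hlt.le (by omega)).trans hM1.le

lemma exists_bd {x : S.Γac} {ρ0 ρ C : ℝ} (hρ0 : 0 < ρ0) (hρ : ρ0 < ρ) (hρ1 : ρ < 1)
    (hd : ∀ n : ℤ, n < 0 → S.abv (S.coeff x n) ≤ C * ρ0 ^ (-n)) : ∃ D, S.Bd ρ D x := by
  have hρp : 0 < ρ := hρ0.trans hρ
  obtain ⟨N, hN⟩ := S.tails hρ0 hρ hρ1 hd one_pos
  set D := ∑ n ∈ Finset.Icc (-N : ℤ) N, S.abv (S.coeff x n) * ρ ^ n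
  have hnn : ∀ n : ℤ, 0 ≤ S.abv (S.coeff x n) * ρ ^ n := fun n =>
    mul_nonneg (S.abv_nonneg _) (zpow_nonneg hρp.le _)
  refine ⟨max 1 D, fun n => ?_⟩
  by_cases hn : n ∈ Set.Icc (-N : ℤ) N
  · have h1 : S.abv (S.coeff x n) * ρ ^ n ≤ D :=
      Finset.single_le_sum (f := fun n => S.abv (S.coeff x n) * ρ ^ n) (fun i _ => hnn i)
        (by simpa using hn)
    rw [zpow_neg, ← div_eq_mul_inv, le_div_iff₀ (zpow_pos hρp _)]
    exact h1.trans (le_max_right _ _)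
  · exact (hN n hn).trans (mul_le_mul_of_nonneg_right (le_max_left _ _) (zpow_nonneg hρp.le _))

lemma exists_common {α : Type*} [Finite α] (f : α → S.Γac) : ∃ ρ : ℝ, 0 < ρ ∧ ρ < 1 ∧
    ∀ a, ∃ C, ∀ n : ℤ, n < 0 → S.abv (S.coeff (f a) n) ≤ C * ρ ^ (-n) := by
  have := Fintype.ofFinite α
  choose ρ C h0 h1 hC h using fun a => S.coeff_decay' (f a)
  by_cases hα : Nonempty α
  · obtain ⟨a0, ha0⟩ := Finite.exists_max ρ
    exact ⟨ρ a0, h0 _, h1 _, fun a => ⟨C a, S.decay_mono (h0 a) (ha0 a) (hC a).le (h a)⟩⟩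
  · exact ⟨1/2, by norm_num, by norm_num, fun a => (hα ⟨a⟩).elim⟩

/-- elements with Gauss norm at most one -/
noncomputable def gR (ρ : ℝ) (hρ : 0 < ρ) : Subring S.Γac where
  carrier := {x | S.Bd ρ 1 x}
  zero_mem' := Bd.zero hρ zero_le_one
  one_mem' := Bd.one hρ
  add_mem' := fun h h' => Bd.add h h'
  neg_mem' := fun h => Bd.neg h
  mul_mem' := fun h h' => by simpa using Bd.mul hρ h h'

/-- elements with Gauss norm at most `q`, an ideal -/
noncomputable def gI (ρ : ℝ) (hρ : 0 < ρ) (q : ℝ) (hq : 0 ≤ q) : Ideal (S.gR ρ hρ) where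
  carrier := {x | S.Bd ρ q x.1}
  zero_mem' := Bd.zero hρ hq
  add_mem' := fun h h' => Bd.add h h'
  smul_mem' := fun c x h => by simpa using Bd.mul hρ c.2 h

lemma det_one_add {r : ℕ} {ρ q : ℝ} (hρ : 0 < ρ) (hq0 : 0 ≤ q) (hq : q < 1)
    {X : Matrix (Fin r) (Fin r) S.Γac} (hX : ∀ i j, S.Bd ρ q (X i j)) : (1 + X).det ≠ 0 := by
  let Y : Matrix (Fin r) (Fin r) (S.gR ρ hρ) := fun i j => ⟨X i j, (hX i j).mono hρ hq.le⟩
  have hY : (S.gR ρ hρ).subtype.mapMatrix (1 + Y) = 1 + X := by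
    rw [map_add, map_one]; rfl
  let I := S.gI ρ hρ q hq0
  have h0 : (Ideal.Quotient.mk I).mapMatrix Y = 0 := by
    ext i j
    exact Ideal.Quotient.eq_zero_iff_mem.2 (hX i j)
  have h1 : Ideal.Quotient.mk I (1 + Y).det = 1 := by
    rw [RingHom.map_det, map_add, map_one, h0, add_zero, Matrix.det_one]
  have h2 : (1 + Y).det - 1 ∈ I := by
    rw [← Ideal.Quotient.eq_zero_iff_mem, map_sub, h1, map_one, sub_self]
  have h3 : S.Bd ρ q ((1 + X).det - 1) := by
    have : ((1 + Y).det : S.Γac) = (1 + X).det := by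
      rw [← hY, ← RingHom.map_det]; rfl
    rw [← this]; exact h2
  intro h
  have := h3 0
  rw [h, zero_sub, S.coeff_neg, S.abv_neg, S.coeff_one] at this
  simp [S.abv_one] at this
  linarith

/-- Birkhoff-type splitting for a matrix close to `1`. -/
lemma split_near {r : ℕ} {ρ q : ℝ} (hρ : 0 < ρ) (hρ1 : ρ < 1) (hq0 : 0 < q) (hq : q < 1)
    {E : Matrix (Fin r) (Fin r) S.Γac} (hE : ∀ i j, S.Bd ρ q (E i j)) :
    ∃ Z : Matrix (Fin r) (Fin r) S.Γac, (∀ i j, S.Bd ρ q (Z i j)) ∧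
      (∀ i j n, 0 ≤ n → S.coeff (Z i j) n = 0) ∧
      ∀ i j, ((1 + E) * (1 + Z)) i j ∈ S.oanR := by
  let N : Matrix (Fin r) (Fin r) S.Γac → Matrix (Fin r) (Fin r) S.Γac := fun X => X.map S.negp
  have hNadd : ∀ X Y, N (X + Y) = N X + N Y := fun X Y => by ext i j; simp [N]
  let Zs : ℕ → Matrix (Fin r) (Fin r) S.Γac := fun k => Nat.rec (- N E) (fun _ Z => - N (E * Z)) k
  have hZ0 : Zs 0 = - N E := rfl
  have hZS : ∀ k, Zs (k + 1) = - N (E * Zs k) := fun k => rfl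
  have hmul : ∀ (X Y : Matrix (Fin r) (Fin r) S.Γac) (C D : ℝ), 0 ≤ C → 0 ≤ D →
      (∀ i j, S.Bd ρ C (X i j)) →
      (∀ i j, S.Bd ρ D (Y i j)) → ∀ i j, S.Bd ρ (C * D) ((X * Y) i j) := by
    intro X Y C D hC hD hX hY i j
    rw [Matrix.mul_apply]
    exact Bd.sum hρ (mul_nonneg hC hD) _ _ fun k _ => (hX i k).mul hρ (hY k j)
  have hB : ∀ k, ∀ i j, S.Bd ρ (q * q ^ k) (Zs k i j) := by
    intro k
    induction k with
    | zero => intro i j; rw [hZ0]; simpa [N] using ((hE i j).negp S hρ).neg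
    | succ k ih =>
      intro i j; rw [hZS, pow_succ']
      exact ((hmul E (Zs k) _ _ hq0.le (by positivity) hE ih i j).negp S hρ).neg
  have hneg : ∀ k i j n, 0 ≤ n → S.coeff (Zs k i j) n = 0 := by
    intro k i j n hn
    cases k with
    | zero => rw [hZ0]; simp [N, S.coeff_neg, S.coeff_negp, hn]
    | succ k => rw [hZS]; simp [N, S.coeff_neg, S.coeff_negp, hn]
  have hser := fun i j => S.exists_sum_series (fun k => Zs k i j) (C := q) (D := 0) hρ hρ1 hq0.le hq
    (fun k => hB k i j) (fun k n hn => by rw [hneg k i j n hn, S.abv_zero])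
  choose Z hZ1 hZ2 using hser
  have hZ1' : ∀ K, ∀ i j, S.Bd ρ (q * q ^ K) ((Matrix.of Z - ∑ k ∈ Finset.range K, Zs k) i j) := by
    intro K i j
    rw [Matrix.sub_apply, Matrix.sum_apply]
    exact hZ1 i j K
  have hpart : ∀ K, N ((1 + E) * (1 + ∑ k ∈ Finset.range K, Zs k)) = - Zs K := by
    intro K
    induction K with
    | zero =>
      rw [Finset.range_zero, Finset.sum_empty, add_zero, mul_one, hNadd, hZ0, neg_neg]
      have : N 1 = 0 := by
        ext i j
        apply S.ext; intro n
        simp only [N, Matrix.map_apply, S.coeff_negp, Matrix.one_apply, Matrix.zero_apply,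
          S.coeff_zero]
        split_ifs with h1 h2
        · rw [S.coeff_one, if_neg h1.ne]
        · rw [S.coeff_zero]
        · rfl
      rw [this, zero_add]
    | succ K ih =>
      rw [Finset.sum_range_succ, ← add_assoc, mul_add, hNadd, ih, add_mul, one_mul, hNadd, hZS,
        neg_neg]
      have : N (Zs K) = Zs K := by
        ext i j
        apply S.ext; intro n
        simp only [N, Matrix.map_apply, S.coeff_negp]
        split_ifs with h1
        · rfl
        · rw [hneg K i j n (by omega)]
      rw [this]; abel
  refine ⟨Matrix.of Z, fun i j => by simpa using hZ1' 0 i j, fun i j n hn => ?_, fun i j => ?_⟩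
  · have := hZ2 i j n 0 (fun k => by rw [hneg k i j n hn, S.abv_zero])
    exact (S.abv_eq_zero _).1 (le_antisymm this (S.abv_nonneg _))
  · have hz : N ((1 + E) * (1 + Matrix.of Z)) i j = 0 := by
      apply Bd.eq_zero (C := 1) hq0.le hq hρ
      intro K
      have e : (1 + E) * (1 + Matrix.of Z) = (1 + E) * (1 + ∑ k ∈ Finset.range K, Zs k) +
        (1 + E) * (Matrix.of Z - ∑ k ∈ Finset.range K, Zs k) := by
        rw [← mul_add]; congr 1; abel
      have hqK : q * q ^ K ≤ 1 * q ^ K := mul_le_mul_of_nonneg_right hq.le (by positivity)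
      rw [e, hNadd, hpart]
      refine Bd.add ((hB K i j).neg.mono hρ hqK) (Bd.negp S hρ ?_)
      refine hmul _ _ 1 _ zero_le_one (by positivity) (fun i j => ?_)
        (fun i j => (hZ1' K i j).mono hρ (by linarith)) i j
      refine Bd.add ?_ ((hE i j).mono hρ hq.le)
      rw [Matrix.one_apply]; split_ifs
      · exact Bd.one hρ
      · exact Bd.zero hρ zero_le_one
    intro n hn
    have := congrArg (fun x => S.coeff x n) hz
    simpa [N, S.coeff_negp, hn, S.coeff_zero] using this

/-- half of the Birkhoff factorization -/
lemma exists_split {r : ℕ} {H H' : Matrix (Fin r) (Fin r) S.Γac} (hH : H * H' = 1) :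
    ∃ V : Matrix (Fin r) (Fin r) S.Γac, (∀ i j, V i j ∈ S.conR) ∧ V.det ≠ 0 ∧
      ∀ i j, (H * V) i j ∈ S.oanR := by
  obtain ⟨ρ0, h0, h1, hc⟩ := S.exists_common
    (fun a : (Fin r × Fin r) ⊕ (Fin r × Fin r) =>
      Sum.elim (fun b : Fin r × Fin r => H b.1 b.2) (fun b : Fin r × Fin r => H' b.1 b.2) a)
  set ρ := (ρ0 + 1) / 2
  have hρ0 : ρ0 < ρ := by simp only [ρ]; linarith
  have hρ1 : ρ < 1 := by simp only [ρ]; linarith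
  have hρ : 0 < ρ := h0.trans hρ0
  -- bound for H
  have hHb : ∃ D : ℝ, 0 < D ∧ ∀ i j, S.Bd ρ D (H i j) := by
    choose D hD using fun b : Fin r × Fin r => S.exists_bd h0 hρ0 hρ1 (hc (Sum.inl b)).choose_spec
    refine ⟨∑ b, D b + 1, ?_, fun i j => (hD (i, j)).mono hρ ?_⟩
    · have : 0 ≤ ∑ b, D b := Finset.sum_nonneg fun b _ => (hD b).nonneg
      linarith
    · have := Finset.single_le_sum (f := D) (fun b _ => (hD b).nonneg) (Finset.mem_univ (i, j))
      linarith
  obtain ⟨D, hD0, hD⟩ := hHb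
  set ε := 1 / (2 * D) with hε
  have hε0 : 0 < ε := by positivity
  choose N hN using fun b : Fin r × Fin r => S.tails h0 hρ0 hρ1 (hc (Sum.inr b)).choose_spec hε0
  simp only [Sum.elim_inr] at hN
  let P : Matrix (Fin r) (Fin r) S.Γac := fun i j =>
    S.trunc (Set.Icc (-(N (i, j)) : ℤ) (N (i, j))) (H' i j)
  have hPd : ∀ i j, S.Bd ρ ε ((P - H') i j) := by
    intro i j n
    rw [Matrix.sub_apply, S.coeff_sub, S.coeff_trunc]
    split_ifs with h
    · rw [sub_self, S.abv_zero]; exact mul_nonneg hε0.le (zpow_nonneg hρ.le _)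
    · rw [zero_sub, S.abv_neg]; exact hN (i, j) n h
  have hPb : ∀ i j, P i j ∈ S.bdR := by
    intro i j
    refine ⟨∑ n ∈ Finset.Icc (-(N (i, j)) : ℤ) (N (i, j)), S.abv (S.coeff (H' i j) n), fun n => ?_⟩
    rw [S.coeff_trunc]
    split_ifs with h
    · exact Finset.single_le_sum (f := fun n => S.abv (S.coeff (H' i j) n))
        (fun _ _ => S.abv_nonneg _) (by simpa using h)
    · rw [S.abv_zero]; exact Finset.sum_nonneg fun _ _ => S.abv_nonneg _
  set E := H * (P - H') with hEdef
  have hE : ∀ i j, S.Bd ρ (1/2) (E i j) := by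
    intro i j
    rw [hEdef, Matrix.mul_apply]
    refine Bd.sum hρ (by norm_num) _ _ fun k _ => ?_
    have := (hD i k).mul hρ (hPd k j)
    rwa [hε, show D * (1 / (2 * D)) = 1/2 by field_simp] at this
  have hHP : H * P = 1 + E := by rw [hEdef, mul_sub, hH]; abel
  obtain ⟨Z, hZ1, hZ2, hZ3⟩ := S.split_near hρ hρ1 (by norm_num : (0:ℝ) < 1/2) (by norm_num) hE
  have hZb : ∀ i j, (1 + Z) i j ∈ S.bdR := by
    intro i j
    refine add_mem ?_ ?_
    · rw [Matrix.one_apply]; split_ifs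
      · exact one_mem _
      · exact zero_mem _
    · refine ⟨1, fun n => ?_⟩
      by_cases hn : 0 ≤ n
      · rw [hZ2 i j n hn, S.abv_zero]; exact zero_le_one
      · refine (hZ1 i j n).trans ?_
        have : ρ ^ (-n) ≤ 1 := by
          obtain ⟨k, hk⟩ := Int.eq_ofNat_of_zero_le (show 0 ≤ -n by omega)
          rw [hk, zpow_natCast]; exact pow_le_one₀ hρ.le hρ1.le
        linarith
  -- scaling
  have hPZ := S.mul_mem_mat _ hPb hZb
  choose C hC using fun b : Fin r × Fin r => S.mem_bdR.1 (hPZ b.1 b.2)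
  have hCnn : ∀ b, 0 ≤ C b := fun b => (S.abv_nonneg _).trans (hC b 0)
  obtain ⟨k, hk⟩ := S.exists_p_pow (∑ b, C b)
  set a : S.F := (p : S.F) ^ k
  refine ⟨S.const a • (P * (1 + Z)), fun i j n => ?_, fun hdet => ?_, fun i j => ?_⟩
  · rw [Matrix.smul_apply, smul_eq_mul, S.coeff_const_mul, S.abv_mul]
    refine le_trans (mul_le_mul_of_nonneg_left ?_ (S.abv_nonneg _)) hk
    exact (hC (i, j) n).trans (Finset.single_le_sum (fun b _ => hCnn b) (Finset.mem_univ (i, j)))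
  · have ha : IsUnit (S.const a) :=
      (isUnit_iff_ne_zero.2 (pow_ne_zero _ S.p_ne_zero)).map S.const
    rw [Matrix.det_smul] at hdet
    have hd2 : (P * (1 + Z)).det = 0 := (ha.pow _).mul_right_eq_zero.1 hdet
    have hd3 : (H * (P * (1 + Z))).det = 0 := by rw [Matrix.det_mul, hd2, mul_zero]
    rw [← mul_assoc, hHP] at hd3
    have e : (1 + E) * (1 + Z) = 1 + (E + Z + E * Z) := by
      rw [add_mul, one_mul, mul_add, mul_one]; abel
    rw [e] at hd3
    refine S.det_one_add hρ (by norm_num : (0:ℝ) ≤ 1/2) (by norm_num) (fun i j => ?_) hd3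
    refine ((hE i j).add (hZ1 i j)).add ?_
    rw [Matrix.mul_apply]
    refine Bd.sum hρ (by norm_num) _ _ fun k _ => ?_
    exact ((hE i k).mul hρ (hZ1 k j)).mono hρ (by norm_num)
  · rw [Matrix.mul_smul, ← mul_assoc, hHP, Matrix.smul_apply, smul_eq_mul]
    exact mul_mem (S.const_mem_oanR _) (hZ3 i j)

end splitting
end AnSetting


namespace AnSetting

section lattice
variable {p : ℕ} [hp : Fact p.Prime] (S : AnSetting p)

/-- membership in the lattice defined by the trivialisation `H` -/
def IsN {r : ℕ} (H : Matrix (Fin r) (Fin r) S.Γac) (v : Fin r → S.Γac) : Prop :=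
  (∀ i, v i ∈ S.conR) ∧ ∀ i, (H.mulVec v) i ∈ S.oanR

lemma lattice_min {r : ℕ} {H Hi : Matrix (Fin r) (Fin r) S.Γac} (hH : H * Hi = 1)
    (hHi : Hi * H = 1) : ∃ V Vi : Matrix (Fin r) (Fin r) S.Γac,
      (∀ j, S.IsN H (V.col j)) ∧ V * Vi = 1 ∧ Vi * V = 1 ∧ (∀ i j, Vi i j ∈ S.bdR) ∧
      ∀ v, S.IsN H v → ∀ i, (∀ n, S.abv (S.coeff ((Vi.mulVec v) i) n) ≤ 1) ∧
        ∀ n, n < 0 → S.abv (S.coeff ((Vi.mulVec v) i) n) < 1 := by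
  obtain ⟨w, hw⟩ := S.exists_unif
  have hw0 := S.abv_pos hw.1
  obtain ⟨Ut, hU1, hU2, hU3⟩ := S.exists_split (H := Hi.transpose) (H' := H.transpose)
    (by rw [← Matrix.transpose_mul, hH, Matrix.transpose_one])
  set U := Ut.transpose with hU
  have hUc : ∀ i j, U i j ∈ S.conR := fun i j => hU1 j i
  have hUo : ∀ i j, (U * Hi) i j ∈ S.oanR := fun i j => by
    have := hU3 j i
    rwa [← Matrix.transpose_apply (Hi.transpose * Ut), Matrix.transpose_mul,
      Matrix.transpose_transpose] at this
  have hUd : U.det ≠ 0 := by rw [hU, Matrix.det_transpose]; exact hU2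
  obtain ⟨ud, -, hud⟩ := S.exists_inv (S.det_mem _ fun i j => S.conR_le_bdR (hUc i j)) hUd
  -- values
  have hUN : ∀ v, S.IsN H v → ∀ i, (U.mulVec v) i ∈ S.conR ∧ (U.mulVec v) i ∈ S.oanR := by
    intro v hv i
    refine ⟨S.mulVec_mem _ hUc hv.1 i, ?_⟩
    have : U.mulVec v = (U * Hi).mulVec (H.mulVec v) := by
      rw [Matrix.mulVec_mulVec, Matrix.mul_assoc, hHi, Matrix.mul_one]
    rw [this]; exact S.mulVec_mem _ hUo hv.2 i
  have hδ : ∀ V : Matrix (Fin r) (Fin r) S.Γac, (∀ j, S.IsN H (V.col j)) →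
      (U * V).det ∈ S.conR ∧ (U * V).det ∈ S.oanR := by
    intro V hV
    have : ∀ i j, (U * V) i j = (U.mulVec (V.col j)) i := fun i j => rfl
    exact ⟨S.det_mem _ fun i j => by rw [this]; exact (hUN _ (hV j) i).1,
      S.det_mem _ fun i j => by rw [this]; exact (hUN _ (hV j) i).2⟩
  have hδ0 : ∀ V : Matrix (Fin r) (Fin r) S.Γac, (U * V).det = 0 → V.det = 0 := by
    intro V h
    rw [Matrix.det_mul] at h
    calc V.det = (U.det * ud) * V.det := by rw [hud, one_mul]
      _ = ud * (U.det * V.det) := by ring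
      _ = 0 := by rw [h, mul_zero]
  let Q : ℕ → ℕ → Matrix (Fin r) (Fin r) S.Γac → Prop := fun n s V =>
    (∀ j, S.IsN H (V.col j)) ∧ (U * V).det ≠ 0 ∧ ∃ c, S.abv c = S.abv w ^ n ∧
      S.Nrm (U * V).det c s
  have hQ : ∀ V : Matrix (Fin r) (Fin r) S.Γac, (∀ j, S.IsN H (V.col j)) → (U * V).det ≠ 0 →
      ∃ n s, Q n s V := by
    intro V hV h0
    obtain ⟨hc, ho⟩ := hδ V hV
    obtain ⟨c, s, h⟩ := S.exists_nrm (S.conR_le_bdR hc) h0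
    obtain ⟨n, hn⟩ := hw.2.2 c h.1
    have hc1 : S.abv c ≤ 1 := by rw [← h.2.2.1]; exact hc s
    have hn0 : 0 ≤ n := by
      by_contra hneg
      push Not at hneg
      have : 1 < S.abv w ^ n := one_lt_zpow_of_neg₀ hw0 hw.2.1 hneg
      linarith [hn]
    have hs0 : 0 ≤ s := by
      by_contra hneg
      push Not at hneg
      have h2 := h.2.2.1
      rw [ho s hneg, S.abv_zero] at h2
      exact (S.abv_pos h.1).ne h2
    obtain ⟨n, rfl⟩ := Int.eq_ofNat_of_zero_le hn0
    obtain ⟨s, rfl⟩ := Int.eq_ofNat_of_zero_le hs0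
    exact ⟨n, s, hV, h0, c, by simpa using hn, h⟩
  obtain ⟨V0, hV01, hV02, hV03⟩ := S.exists_split hH
  have hex : ∃ n, ∃ s V, Q n s V := by
    obtain ⟨n, s, h⟩ := hQ V0 (fun j => ⟨fun i => hV01 i j, fun i => hV03 i j⟩)
      (fun h => hV02 (hδ0 _ h))
    exact ⟨n, s, V0, h⟩
  have hex2 := Nat.find_spec hex
  have hmin1 : ∀ n s V, Q n s V → Nat.find hex ≤ n := fun n s V h => Nat.find_min' hex ⟨s, V, h⟩
  set n := Nat.find hex
  obtain ⟨V, hVq⟩ := Nat.find_spec hex2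
  have hmin2 : ∀ s V, Q n s V → Nat.find hex2 ≤ s := fun s V h => Nat.find_min' hex2 ⟨V, h⟩
  set s := Nat.find hex2
  obtain ⟨hVN, hVd, c, hc, hnrm⟩ := hVq
  have hVd0 : V.det ≠ 0 := fun h => hVd (by rw [Matrix.det_mul, h, mul_zero])
  obtain ⟨Vi, hVi1, hVi2, hVi3⟩ := S.exists_mat_inv
    (V := V) (fun i j => S.conR_le_bdR ((hVN j).1 i)) hVd0
  refine ⟨V, Vi, hVN, hVi2, hVi3, hVi1, fun v hv i => ?_⟩
  set a := Vi.mulVec v with ha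
  have hVa : V.mulVec a = v := by rw [ha, Matrix.mulVec_mulVec, hVi2, Matrix.one_mulVec]
  set V' := V.updateCol i v with hV'
  have hdet : a i * (U * V).det = (U * V').det := by
    have h1 : V'.det = V.det * a i := by
      have := Matrix.cramer_apply V v i
      rw [hV', ← this, ← hVa, Matrix.cramer_eq_adjugate_mulVec, Matrix.mulVec_mulVec,
        Matrix.adjugate_mul, Matrix.smul_mulVec, Matrix.one_mulVec]; rfl
    rw [Matrix.det_mul, Matrix.det_mul, h1]; ring
  have hV'N : ∀ j, S.IsN H (V'.col j) := by
    intro j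
    by_cases hij : j = i
    · have : V'.col j = v := by ext k; simp [hV', Matrix.col, hij]
      rw [this]; exact hv
    · have : V'.col j = V.col j := by ext k; simp [hV', Matrix.col, hij]
      rw [this]; exact hVN j
  obtain ⟨y, hy1, hy2, hy3⟩ := hnrm.inv
  have hay : a i = y * (U * V').det := by
    rw [← hdet, mul_comm, mul_assoc, hy1, mul_one]
  have hcpos := S.abv_pos hnrm.1
  have hkey : (∀ m, S.abv (S.coeff (U * V').det m) ≤ S.abv c) ∧
      ∀ m : ℤ, m < s → S.abv (S.coeff (U * V').det m) < S.abv c := by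
    by_cases h0 : (U * V').det = 0
    · rw [h0]
      exact ⟨fun m => by rw [S.coeff_zero, S.abv_zero]; exact hcpos.le, fun m _ => by
        rw [S.coeff_zero, S.abv_zero]; exact hcpos⟩
    · obtain ⟨n', s', hq⟩ := hQ V' hV'N h0
      obtain ⟨_, _, c', hc', hnrm'⟩ := id hq
      have hle := hmin1 _ _ _ hq
      have hle' : S.abv c' ≤ S.abv c := by
        rw [hc, hc']; exact pow_le_pow_of_le_one hw0.le hw.2.1.le hle
      refine ⟨fun m => (hnrm'.2.1 m).trans hle', fun m hm => ?_⟩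
      rcases hle.eq_or_lt with heq | hlt
      · have : s ≤ s' := hmin2 s' V' (by rw [heq]; exact hq)
        exact (hnrm'.2.2.2 m (by omega)).trans_le hle'
      · refine (hnrm'.2.1 m).trans_lt ?_
        rw [hc, hc']; exact pow_lt_pow_right_of_lt_one₀ hw0 hw.2.1 hlt
  refine ⟨fun m => ?_, fun m hm => ?_⟩
  · rw [hay]
    refine S.coeff_mul_le zero_le_one fun k => ?_
    calc _ ≤ (S.abv c)⁻¹ * S.abv c :=
          mul_le_mul (hy2 k) (hkey.1 _) (S.abv_nonneg _) (inv_nonneg.2 hcpos.le)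
      _ = 1 := inv_mul_cancel₀ hcpos.ne'
  · refine lt_of_le_of_lt ?_ hw.2.1
    rw [hay]
    refine S.coeff_mul_le hw0.le fun k => ?_
    rw [← S.abv_mul]
    apply hw.le S
    rw [S.abv_mul]
    by_cases hk : k < -(s:ℤ)
    · calc _ ≤ S.abv (S.coeff y k) * S.abv c :=
            mul_le_mul_of_nonneg_left (hkey.1 _) (S.abv_nonneg _)
        _ < (S.abv c)⁻¹ * S.abv c := mul_lt_mul_of_pos_right (hy3 k hk) hcpos
        _ = 1 := inv_mul_cancel₀ hcpos.ne'
    · calc _ ≤ (S.abv c)⁻¹ * S.abv (S.coeff (U * V').det (m - k)) :=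
            mul_le_mul_of_nonneg_right (hy2 k) (S.abv_nonneg _)
        _ < (S.abv c)⁻¹ * S.abv c :=
            mul_lt_mul_of_pos_left (hkey.2 _ (by omega)) (inv_pos.2 hcpos)
        _ = 1 := inv_mul_cancel₀ hcpos.ne'

lemma lattice_basis {r : ℕ} {H Hi : Matrix (Fin r) (Fin r) S.Γac} (hH : H * Hi = 1)
    (hHi : Hi * H = 1) : ∃ V Vi : Matrix (Fin r) (Fin r) S.Γac,
      (∀ j, S.IsN H (V.col j)) ∧ V * Vi = 1 ∧ Vi * V = 1 ∧ (∀ i j, Vi i j ∈ S.bdR) ∧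
      ∀ v, S.IsN H v → ∀ i, (Vi.mulVec v) i ∈ S.omegaSet := by
  obtain ⟨w, hw⟩ := S.exists_unif
  have hw0 := S.abv_pos hw.1
  obtain ⟨V, Vi, hVN, hVi2, hVi3, hVi1, hmain⟩ := S.lattice_min hH hHi
  refine ⟨V, Vi, hVN, hVi2, hVi3, hVi1, fun v hv i => ⟨(hmain v hv i).1, fun n hn => ?_⟩⟩
  suffices h : ∀ k : ℕ, ∀ v, S.IsN H v → ∀ i, ∀ n, n < 0 →
      S.abv (S.coeff ((Vi.mulVec v) i) n) ≤ S.abv w ^ k from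
    S.eq_zero_of_pow_le (C := 1) hw0.le hw.2.1 fun k => by simpa using h k v hv i n hn
  intro k
  induction k with
  | zero => intro v hv i n hn; simpa using (hmain v hv i).1 n
  | succ k ih =>
    intro v hv i n hn
    set a := Vi.mulVec v with ha
    have hVa : V.mulVec a = v := by rw [ha, Matrix.mulVec_mulVec, hVi2, Matrix.one_mulVec]
    set e : Fin r → S.Γac := fun i => S.const w⁻¹ * S.negp (a i) with he
    have hec : ∀ i, e i ∈ S.conR := by
      intro i m
      rw [he]; dsimp only
      rw [S.coeff_const_mul, S.coeff_negp, S.abv_mul, S.abv_inv]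
      split_ifs with hm
      · rw [inv_mul_le_iff₀ hw0, mul_one]
        exact hw.le S ((hmain v hv i).2 m hm)
      · rw [S.abv_zero, mul_zero]; exact zero_le_one
    have hω : ∀ i, a i - S.negp (a i) ∈ S.oanR := by
      intro i m hm
      rw [S.coeff_sub, S.coeff_negp, if_pos hm, sub_self]
    have hv' : S.IsN H (V.mulVec e) := by
      refine ⟨S.mulVec_mem _ (fun i j => (hVN j).1 i) hec, fun i => ?_⟩
      have h1 : V.mulVec e = S.const w⁻¹ • (v - V.mulVec (fun i => a i - S.negp (a i))) := by
        conv_rhs => rw [← hVa]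
        rw [← Matrix.mulVec_sub, ← Matrix.mulVec_smul]
        congr 1
        ext i
        simp [he]
      rw [h1, Matrix.mulVec_smul, Matrix.mulVec_sub, Matrix.mulVec_mulVec]
      refine mul_mem (S.const_mem_oanR _) (sub_mem (hv.2 i) ?_)
      exact S.mulVec_mem _ (fun i j => (hVN j).2 i) hω i
    have := ih _ hv' i n hn
    rw [Matrix.mulVec_mulVec, hVi3, Matrix.one_mulVec, he] at this
    dsimp only at this
    rw [S.coeff_const_mul, S.coeff_negp, if_pos hn, S.abv_mul, S.abv_inv,
      inv_mul_le_iff₀ hw0] at this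
    rw [pow_succ, mul_comm]; exact this

/-- decomposition with respect to Frobenius -/
lemma exists_frob_part {x : S.Γac} (hx : x ∈ S.conR) (i : ℕ) (hi : i < p) :
    ∃ y ∈ S.conR, ∀ n, S.σF (S.coeff y n) = S.coeff x (p * n + i) := by
  have hp1 : (1 : ℤ) ≤ p := by exact_mod_cast hp.out.one_lt.le
  obtain ⟨ρ, C, h0, h1, hC, hd⟩ := S.coeff_decay' x
  have habv : ∀ z, S.abv (S.σF.symm z) = S.abv z := fun z => by
    rw [← S.abv_σF, RingEquiv.apply_symm_apply]
  obtain ⟨y, hy⟩ := S.mk_of_bdd (fun n => S.σF.symm (S.coeff x (p * n + i))) 1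
    (fun n _ => by rw [habv]; exact hx _) ⟨ρ, C * ρ ^ (-(p:ℤ)), h0, h1, fun n hn => by
      rw [habv]
      have hlt : (p : ℤ) * n + i < 0 := by
        have : (p : ℤ) * n ≤ p * (-1) := mul_le_mul_of_nonneg_left (by omega) (by omega)
        omega
      refine (hd _ hlt).trans ?_
      rw [mul_assoc, ← zpow_add₀ h0.ne']
      refine mul_le_mul_of_nonneg_left ?_ hC.le
      apply zpow_le_zpow_right_of_le_one₀ h0 h1.le
      have : ((p : ℤ) - 1) * n ≤ 0 := mul_nonpos_of_nonneg_of_nonpos (by omega) hn.le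
      nlinarith⟩
  refine ⟨y, fun n => ?_, fun n => ?_⟩
  · rw [hy]; dsimp only; rw [habv]; exact hx _
  · rw [hy]; simp

lemma coeff_sum_frob (z : ℕ → S.Γac) (n : ℤ) (i : ℕ) (hi : i < p) :
    S.coeff (∑ k ∈ Finset.range p, S.tz k * S.frob (z k)) (p * n + i) = S.σF (S.coeff (z i) n) := by
  have hp0 : (p : ℤ) ≠ 0 := by exact_mod_cast hp.out.ne_zero
  rw [S.coeff_sum, Finset.sum_eq_single i]
  · rw [S.coeff_tz_mul, S.coeff_frob, if_pos (by simp)]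
    congr 2
    rw [add_sub_cancel_right, Int.mul_ediv_cancel_left _ hp0]
  · intro k hk hki
    rw [Finset.mem_range] at hk
    rw [S.coeff_tz_mul, S.coeff_frob, if_neg]
    rintro ⟨m, hm⟩
    have h1 : (p : ℤ) ∣ (i - k : ℤ) := ⟨m - n, by rw [mul_sub]; omega⟩
    have h2 := Int.eq_zero_of_abs_lt_dvd h1 (by rw [abs_lt]; constructor <;> omega)
    omega
  · intro h; exact absurd (Finset.mem_range.2 hi) h

lemma sum_frob_parts (x : S.Γac) (y : ℕ → S.Γac)
    (hy : ∀ i, i < p → ∀ n, S.σF (S.coeff (y i) n) = S.coeff x (p * n + i)) :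
    x = ∑ k ∈ Finset.range p, S.tz k * S.frob (y k) := by
  apply S.ext
  intro n
  have hp0 : (0 : ℤ) < p := by exact_mod_cast hp.out.pos
  have h1 := Int.emod_nonneg n hp0.ne'
  have h2 := Int.emod_lt_of_pos n hp0
  obtain ⟨i, hi⟩ := Int.eq_ofNat_of_zero_le h1
  have hn : n = p * (n / p) + i := by
    have := Int.mul_ediv_add_emod n p; omega
  rw [hn, S.coeff_sum_frob _ _ i (by omega), hy i (by omega)]

theorem semistable_of_trivial {r : ℕ} {A H Hi : Matrix (Fin r) (Fin r) S.Γac}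
    (hA : S.IsCrystal S.conSet A)
    (hH : H * Hi = 1) (hHi : Hi * H = 1) (Δ : Matrix (Fin r) (Fin r) S.F) (hΔ : Δ.det ≠ 0)
    (hHA : H * A = Δ.map S.const * H.map S.frob) :
    ∃ A₀ : Matrix (Fin r) (Fin r) S.Γac,
        S.IsCrystal S.omegaSet A₀ ∧ S.Isogenous S.frob S.conSet A A₀ := by
  obtain ⟨hAc, B, ℓ, hBc, hAB, hBA⟩ := hA
  obtain ⟨V, Vi, hVN, hVVi, hViV, hVib, hN⟩ := S.lattice_basis hH hHi
  have hVVi' : V.map S.frob * Vi.map S.frob = 1 := by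
    rw [← Matrix.map_mul, hVVi]; exact Matrix.map_one _ (map_zero _) (map_one _)
  have hViV' : Vi.map S.frob * V.map S.frob = 1 := by
    rw [← Matrix.map_mul, hViV]; exact Matrix.map_one _ (map_zero _) (map_one _)
  have hHA' : H.map S.frob = (Δ⁻¹).map S.const * (H * A) := by
    rw [hHA, ← Matrix.mul_assoc, ← Matrix.map_mul, Matrix.nonsing_inv_mul _ (Ne.isUnit hΔ),
      Matrix.map_one _ (map_zero _) (map_one _), Matrix.one_mul]
  set A₀ := Vi * (A * V.map S.frob) with hA₀
  set B₀ := Vi.map S.frob * (B * V) with hB₀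
  have hA₀m : ∀ i j, A₀ i j ∈ S.omegaSet := by
    intro i j
    have h1 : A₀ i j = (Vi.mulVec ((A * V.map S.frob).col j)) i := rfl
    rw [h1]
    apply hN
    refine ⟨fun k => ?_, fun k => ?_⟩
    · exact S.mul_mem_mat _ hAc (fun i j => S.frob_mem_conR ((hVN j).1 i)) k j
    · have h2 : (H.mulVec ((A * V.map S.frob).col j)) k = (H * (A * V.map S.frob)) k j := rfl
      rw [h2, ← Matrix.mul_assoc, hHA, Matrix.mul_assoc, ← Matrix.map_mul]
      refine S.mul_mem_mat _ (fun i j => S.const_mem_oanR _) (fun i j => ?_) k j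
      exact S.frob_mem_oanR ((hVN j).2 i)
  have hB₀m : ∀ i j, B₀ i j ∈ S.omegaSet := by
    intro i j
    have hxc : ∀ k, (B * V) k j ∈ S.conR := fun k =>
      S.mul_mem_mat _ hBc (fun i j => (hVN j).1 i) k j
    have hxo : ∀ k, (H.map S.frob * (B * V)) k j ∈ S.oanR := by
      intro k
      have : H.map S.frob * (B * V) = (Δ⁻¹).map S.const * ((p : S.Γac) ^ ℓ • (H * V)) := by
        rw [hHA', Matrix.mul_assoc, Matrix.mul_assoc, ← Matrix.mul_assoc A, hAB]
        simp
      rw [this]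
      refine S.mul_mem_mat _ (fun i j => S.const_mem_oanR _) (fun i j => ?_) k j
      exact mul_mem (pow_mem (natCast_mem _ _) _) ((hVN j).2 i)
    have hex : ∀ k, ∃ y : ℕ → S.Γac, ∀ a, a < p → y a ∈ S.conR ∧
        ∀ n, S.σF (S.coeff (y a) n) = S.coeff ((B * V) k j) (p * n + a) := by
      intro k
      have := fun a (ha : a < p) => S.exists_frob_part (hxc k) a ha
      choose! y h1 h2 using this
      exact ⟨y, fun a ha => ⟨h1 a ha, h2 a ha⟩⟩
    choose y hy using hex
    have hdec : ∀ k, (B * V) k j = ∑ a ∈ Finset.range p, S.tz a * S.frob (y k a) := fun k =>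
      S.sum_frob_parts _ _ fun a ha => (hy k a ha).2
    have hmv : ∀ (M : Matrix (Fin r) (Fin r) S.Γac) k, (M.map S.frob * (B * V)) k j =
        ∑ a ∈ Finset.range p, S.tz a * S.frob ((M.mulVec fun l => y l a) k) := by
      intro M k
      rw [Matrix.mul_apply]
      simp_rw [hdec, Matrix.mulVec, dotProduct, map_sum, Finset.mul_sum]
      rw [Finset.sum_comm]
      refine Finset.sum_congr rfl fun a _ => Finset.sum_congr rfl fun l _ => ?_
      rw [map_mul, Matrix.map_apply]; ring
    have hyN : ∀ a, a < p → S.IsN H (fun l => y l a) := by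
      intro a ha
      refine ⟨fun l => (hy l a ha).1, fun k n hn => ?_⟩
      have h1 := hxo k (p * n + a) (by
        have hp0 : (0 : ℤ) < p := by exact_mod_cast hp.out.pos
        have : (p : ℤ) * n ≤ p * (-1) := mul_le_mul_of_nonneg_left (by omega) (by omega)
        omega)
      rw [hmv, S.coeff_sum_frob _ _ a ha] at h1
      exact (map_eq_zero _).1 h1
    rw [hB₀, hmv, mem_omega]
    have hh : ∀ a ∈ Finset.range p, (Vi.mulVec fun l => y l a) i ∈ S.omegaSet := fun a ha =>
      hN _ (hyN a (Finset.mem_range.1 ha)) i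
    refine ⟨sum_mem fun a ha => mul_mem (S.tz_mem_conR _) (S.frob_mem_conR (hh a ha).1),
      sum_mem fun a ha => mul_mem ?_ (S.frob_mem_oanR (hh a ha).2)⟩
    intro n hn
    rw [S.coeff_tz, if_neg (by omega)]
  refine ⟨A₀, ⟨hA₀m, B₀, ℓ, hB₀m, ?_, ?_⟩, ?_⟩
  · calc A₀ * B₀ = Vi * (A * ((V.map S.frob * Vi.map S.frob) * (B * V))) := by
          rw [hA₀, hB₀]; simp only [Matrix.mul_assoc]
      _ = Vi * ((A * B) * V) := by rw [hVVi', Matrix.one_mul, Matrix.mul_assoc A]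
      _ = _ := by rw [hAB]; simp [hViV]
  · calc B₀ * A₀ = Vi.map S.frob * (B * ((V * Vi) * (A * V.map S.frob))) := by
          rw [hA₀, hB₀]; simp only [Matrix.mul_assoc]
      _ = Vi.map S.frob * ((B * A) * V.map S.frob) := by
          rw [hVVi, Matrix.one_mul, Matrix.mul_assoc B]
      _ = _ := by rw [hBA]; simp [hViV']
  · choose C hC using fun b : Fin r × Fin r => S.mem_bdR.1 (hVib b.1 b.2)
    have hCnn : ∀ b, 0 ≤ C b := fun b => (S.abv_nonneg _).trans (hC b 0)
    obtain ⟨k, hk⟩ := S.exists_p_pow (∑ b, C b)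
    set a : S.F := (p : S.F) ^ k with ha
    have hσ : S.frob (S.const a) = S.const a := by rw [S.frob_const, ha]; simp
    refine ⟨S.const a • Vi, V, a, pow_ne_zero _ S.p_ne_zero, ?_, fun i j => ⟨?_, (hVN j).1 i⟩,
      ?_, ?_, ?_, ?_⟩
    · rw [ha, S.abv_pow, S.abv_p]
      exact pow_le_one₀ (inv_nonneg.2 p_pos.le) (inv_le_one_of_one_le₀ one_lt_p.le)
    · intro n
      rw [Matrix.smul_apply, smul_eq_mul, S.coeff_const_mul, S.abv_mul]
      refine le_trans (mul_le_mul_of_nonneg_left ?_ (S.abv_nonneg _)) hk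
      exact (hC (i, j) n).trans (Finset.single_le_sum (fun b _ => hCnn b) (Finset.mem_univ (i, j)))
    · have : (S.const a • Vi).map S.frob = S.const a • Vi.map S.frob := by
        ext i j; simp [hσ]
      rw [this, hA₀]
      simp [Matrix.mul_assoc, hVVi']
    · rw [hA₀, ← Matrix.mul_assoc, hVVi, Matrix.one_mul]
    · rw [Matrix.mul_smul, hVVi]
    · rw [Matrix.smul_mul, hViV]

end lattice
end AnSetting


namespace AnSetting
variable {p : ℕ} [hp : Fact p.Prime] (S : AnSetting p)
/-- bundled absolute value -/
noncomputable def absV : AbsoluteValue S.F ℝ where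
  toFun := S.abv
  map_mul' := S.abv_mul
  nonneg' := S.abv_nonneg
  eq_zero' := S.abv_eq_zero
  add_le' := fun x y => (S.abv_add_le x y).trans
    (max_le_add_of_nonneg (S.abv_nonneg x) (S.abv_nonneg y))
end AnSetting

namespace AnExt

section descent
variable {p : ℕ} [hp : Fact p.Prime] {S : AnSetting p} (E : AnExt p S)

lemma coord : ∃ (m : ℕ) (b : Fin m → E.T.F) (f : Fin m → E.T.F →+ S.F) (C : ℝ),
    0 < C ∧ (∀ k a y, f k (E.ι a * y) = a * f k y) ∧ (∀ y, y = ∑ k, E.ι (f k y) * b k) ∧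
    ∀ k y, S.abv (f k y) ≤ C * E.T.abv y := by
  let _ : NormedField S.F := S.absV.toNormedField
  let _ : NormedField E.T.F := E.T.absV.toNormedField
  let _ : NontriviallyNormedField S.F := ⟨⟨(p : S.F)⁻¹, by
    change 1 < S.abv _
    rw [S.abv_inv, S.abv_p, inv_inv]; exact AnSetting.one_lt_p⟩⟩
  have _ : CompleteSpace S.F := by
    apply Metric.complete_of_cauchySeq_tendsto
    intro u hu
    rw [Metric.cauchySeq_iff] at hu
    obtain ⟨x, hx⟩ := S.complete u (fun ε hε => by
      obtain ⟨N, hN⟩ := hu ε hε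
      exact ⟨N, fun a ha b hb => by have := hN a ha b hb; rwa [dist_eq_norm] at this⟩)
    refine ⟨x, ?_⟩
    rw [Metric.tendsto_atTop]
    intro ε hε
    obtain ⟨N, hN⟩ := hx ε hε
    exact ⟨N, fun n hn => by rw [dist_eq_norm]; exact hN n hn⟩
  let _ : Algebra S.F E.T.F := E.ι.toAlgebra
  let _ : NormedSpace S.F E.T.F := ⟨fun a b => by
    rw [Algebra.smul_def, norm_mul]
    apply le_of_eq
    congr 1
    exact E.abv_ι a⟩
  have _ : FiniteDimensional S.F E.T.F := by
    obtain ⟨n, b, hb⟩ := E.finite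
    refine ⟨⟨Finset.univ.image b, ?_⟩⟩
    rw [eq_top_iff]
    rintro y -
    obtain ⟨a, rfl⟩ := hb y
    refine sum_mem fun i _ => ?_
    have := Submodule.smul_mem (Submodule.span S.F (↑(Finset.univ.image b) : Set E.T.F)) (a i)
      (Submodule.subset_span (by simp : b i ∈ (↑(Finset.univ.image b) : Set E.T.F)))
    rwa [Algebra.smul_def] at this
  let b := Module.finBasis S.F E.T.F
  let g : Fin _ → E.T.F →L[S.F] S.F := fun k => LinearMap.toContinuousLinearMap (b.coord k)
  refine ⟨_, b, fun k => (b.coord k).toAddMonoidHom, (∑ k, ‖g k‖) + 1, ?_, ?_, ?_, ?_⟩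
  · have : 0 ≤ ∑ k, ‖g k‖ := Finset.sum_nonneg fun k _ => norm_nonneg _
    linarith
  · intro k a y
    have : E.ι a * y = a • y := (Algebra.smul_def a y).symm
    rw [this]
    exact map_smul (b.coord k) a y
  · intro y
    conv_lhs => rw [← b.sum_repr y]
    refine Finset.sum_congr rfl fun k _ => ?_
    rw [Algebra.smul_def]; rfl
  · intro k y
    have h1 := (g k).le_opNorm y
    refine h1.trans (mul_le_mul_of_nonneg_right ?_ (norm_nonneg _))
    have := Finset.single_le_sum (f := fun k => ‖g k‖) (fun k _ => norm_nonneg _) (Finset.mem_univ k)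
    linarith

lemma exists_dec (f : E.T.F →+ S.F) {C : ℝ} (hC : 0 < C) (hf : ∀ y, S.abv (f y) ≤ C * E.T.abv y)
    (X : E.T.Γac) : ∃ x : S.Γac, S.coeff x = fun n => f (E.T.coeff X n) := by
  apply S.mk_of_decay
  · intro ε hε
    have hε2 : 0 < ε / 2 := by linarith
    obtain ⟨N, hN, h1⟩ := E.T.coeff_growth X (ε / 2) hε2
    have hq : 1 < (1 + ε) / (1 + ε / 2) := by rw [one_lt_div (by linarith)]; linarith
    obtain ⟨M, hM0, hM⟩ := AnSetting.growth_of_le_mul (C := C)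
      (ε := (1 + ε) / (1 + ε / 2) - 1) (by linarith)
    refine ⟨max N M, le_max_of_le_left hN, fun n hn => (hf _).trans ?_⟩
    have h2 := h1 n ((le_max_left _ _).trans hn)
    have h3 := hM n ((le_max_right _ _).trans hn)
    have hpos : 0 < 1 + ε / 2 := by linarith
    rw [add_sub_cancel, div_zpow, le_div_iff₀ (zpow_pos hpos _)] at h3
    exact (mul_le_mul_of_nonneg_left h2 hC.le).trans h3
  · obtain ⟨ρ, D, h0, h1, hD, h2⟩ := E.T.coeff_decay' X
    refine ⟨ρ, C * D, h0, h1, fun n hn => (hf _).trans ?_⟩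
    rw [mul_assoc]
    exact mul_le_mul_of_nonneg_left (h2 n hn) hC.le

/-- decomposition of series -/
lemma exists_decomp : ∃ (m : ℕ) (b : Fin m → E.T.F) (f : Fin m → E.T.F →+ S.F)
    (d : Fin m → E.T.Γac →+ S.Γac), (∀ k X n, S.coeff (d k X) n = f k (E.T.coeff X n)) ∧
    (∀ X, X = ∑ k, E.T.const (b k) * E.j (d k X)) ∧
    (∀ k y x, d k (E.T.const y * E.j x) = S.const (f k y) * x) ∧
    (∀ k X x, d k (X * E.j x) = d k X * x) ∧ (∀ y, y = ∑ k, E.ι (f k y) * b k) := by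
  obtain ⟨m, b, f, C, hC, hf1, hf2, hf3⟩ := E.coord
  choose d hd using fun k => E.exists_dec (f k) hC (hf3 k)
  have hd' : ∀ k X n, S.coeff (d k X) n = f k (E.T.coeff X n) := fun k X n => congrFun (hd k X) n
  have hdadd : ∀ k X Y, d k (X + Y) = d k X + d k Y := fun k X Y => S.ext fun n => by
    rw [S.coeff_add, hd', hd', hd', E.T.coeff_add, map_add]
  let d' : Fin m → E.T.Γac →+ S.Γac := fun k => AddMonoidHom.mk' (d k) (hdadd k)
  have hd'' : ∀ k X n, S.coeff (d' k X) n = f k (E.T.coeff X n) := hd'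
  have h2 : ∀ X, X = ∑ k, E.T.const (b k) * E.j (d' k X) := fun X => E.T.ext fun n => by
    rw [E.T.coeff_sum]
    simp_rw [E.T.coeff_const_mul, E.coeff_j, hd'']
    conv_lhs => rw [hf2 (E.T.coeff X n)]
    exact Finset.sum_congr rfl fun k _ => mul_comm _ _
  have h3 : ∀ k y x, d' k (E.T.const y * E.j x) = S.const (f k y) * x := fun k y x =>
    S.ext fun n => by
      rw [hd'', E.T.coeff_const_mul, E.coeff_j, S.coeff_const_mul, mul_comm, hf1, mul_comm]
  refine ⟨m, b, f, d', hd'', h2, h3, fun k X x => ?_, hf2⟩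
  conv_lhs => rw [h2 X]
  conv_rhs => rw [h2 X]
  rw [Finset.sum_mul, map_sum, map_sum, Finset.sum_mul]
  refine Finset.sum_congr rfl fun l _ => ?_
  rw [mul_assoc, ← map_mul, h3, h3, mul_assoc]

lemma j_injective : Function.Injective E.j := fun x y h => S.ext fun n => by
  have := congrArg (fun z => E.T.coeff z n) h
  simp only [E.coeff_j] at this
  exact E.ι.injective this

lemma exists_rows {K : Type*} [Field K] {r : ℕ} {ι : Type*} [Fintype ι] (M : Matrix ι (Fin r) K)
    (L : Matrix (Fin r) ι K) (h : L * M = 1) : ∃ f : Fin r → ι, (M.submatrix f id).det ≠ 0 := by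
  have hspan : Submodule.span K (Set.range M.row) = ⊤ := by
    rw [eq_top_iff]
    rintro v -
    have : v = Matrix.vecMul (Matrix.vecMul v L) M := by
      rw [Matrix.vecMul_vecMul, h, Matrix.vecMul_one]
    rw [this, Matrix.vecMul_eq_sum]
    exact sum_mem fun i _ => Submodule.smul_mem _ _ (Submodule.subset_span ⟨i, rfl⟩)
  obtain ⟨f, hf1, hf2, hf3⟩ := Submodule.exists_fun_fin_finrank_span_eq K (Set.range M.row)
  have hr : Module.finrank K (Submodule.span K (Set.range M.row)) = r := by
    rw [hspan, finrank_top, Module.finrank_fin_fun]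
  choose g hg using hf1
  refine ⟨fun i => g (Fin.cast hr.symm i), ?_⟩
  have hli : LinearIndependent K (fun i : Fin r => f (Fin.cast hr.symm i)) :=
    hf3.comp _ (Fin.cast_injective _)
  have : (M.submatrix (fun i => g (Fin.cast hr.symm i)) id).row =
      fun i : Fin r => f (Fin.cast hr.symm i) := by
    funext i
    rw [← hg]; rfl
  rw [← this, Matrix.linearIndependent_rows_iff_isUnit, Matrix.isUnit_iff_isUnit_det] at hli
  exact hli.ne_zero

theorem descend {r : ℕ} {A : Matrix (Fin r) (Fin r) S.Γac} (c : Fin r → E.T.F)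
    (hc : ∀ i, c i ≠ 0) {H Hi : Matrix (Fin r) (Fin r) E.T.Γac} (hH : H * Hi = 1) (hHi : Hi * H = 1)
    (hHA : H * A.map E.j = Matrix.diagonal (fun i => E.T.const (c i)) * H.map E.T.frob) :
    ∃ (G Gi : Matrix (Fin r) (Fin r) S.Γac) (Δ : Matrix (Fin r) (Fin r) S.F), G * Gi = 1 ∧
      Gi * G = 1 ∧ Δ.det ≠ 0 ∧ G * A = Δ.map S.const * G.map S.frob := by
  obtain ⟨m, b, f, d, hd1, hd2, hd3, hd4, hf⟩ := E.exists_decomp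
  set D := Matrix.diagonal (fun i => E.T.const (c i)) with hD
  have hdA : ∀ k (X : Matrix (Fin r) (Fin r) E.T.Γac) (Y : Matrix (Fin r) (Fin r) S.Γac),
      (X * Y.map E.j).map (d k) = X.map (d k) * Y := by
    intro k X Y
    ext i l
    simp [Matrix.mul_apply, hd4]
  have hAi : A.map E.j * Hi.map E.T.frob = Hi * D := by
    have h1 : H.map E.T.frob * Hi.map E.T.frob = 1 := by
      rw [← Matrix.map_mul, hH]; exact Matrix.map_one _ (map_zero _) (map_one _)
    calc A.map E.j * Hi.map E.T.frob = Hi * (H * A.map E.j) * Hi.map E.T.frob := by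
          rw [← Matrix.mul_assoc Hi, hHi, Matrix.one_mul]
      _ = Hi * D := by rw [hHA, Matrix.mul_assoc, Matrix.mul_assoc, h1, Matrix.mul_one]
  -- the stacked matrix
  obtain ⟨Ht, hHtdef⟩ : ∃ Ht : Matrix (Fin r × Fin m) (Fin r) S.Γac,
      ∀ a l, Ht a l = d a.2 (H a.1 l) := ⟨Matrix.of fun a l => d a.2 (H a.1 l), fun _ _ => rfl⟩
  have hHt : ∀ i l, H i l = ∑ k, E.T.const (b k) * E.j (Ht (i, k) l) := fun i l => by
    simp_rw [hHtdef]; exact hd2 _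
  have hrel : ∀ i k l, ∑ u, Ht (i, k) u * A u l =
      ∑ k', S.const (f k (c i * E.T.σF (b k'))) * S.frob (Ht (i, k') l) := by
    intro i k l
    have h1 : ∑ u, Ht (i, k) u * A u l = d k ((H * A.map E.j) i l) := by
      rw [Matrix.mul_apply, map_sum]
      exact Finset.sum_congr rfl fun u _ => by rw [Matrix.map_apply, hd4, hHtdef]
    rw [h1, hHA, hD, Matrix.diagonal_mul, Matrix.map_apply, hHt, map_sum, Finset.mul_sum, map_sum]
    refine Finset.sum_congr rfl fun k' _ => ?_
    rw [map_mul E.T.frob, E.T.frob_const, E.frob_j, ← mul_assoc, ← map_mul, hd3]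
  obtain ⟨X, hXdef⟩ : ∃ X : Matrix (Fin r × Fin m) (Fin r) E.T.Γac, X = Ht.map E.j * Hi := ⟨_, rfl⟩
  have hX : ∀ i k l, X (i, k) l * E.T.const (c l) =
      ∑ k', E.T.const (E.ι (f k (c i * E.T.σF (b k')))) * E.T.frob (X (i, k') l) := by
    intro i k l
    have h1 : X (i, k) l * E.T.const (c l) = (Ht.map E.j * (Hi * D)) (i, k) l := by
      rw [← Matrix.mul_assoc, hD, Matrix.mul_diagonal, hXdef]
    have hjc : ∀ a, E.j (S.const a) = E.T.const (E.ι a) := fun a => E.T.ext fun n => by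
      rw [E.coeff_j, S.coeff_const, E.T.coeff_const]; split_ifs <;> simp
    have h2 : (Ht.map E.j * A.map E.j) = Matrix.of fun a l => ∑ k', E.T.const (E.ι (f a.2 (c a.1 *
        E.T.σF (b k')))) * E.T.frob (E.j (Ht (a.1, k') l)) := by
      ext ⟨i, k⟩ l
      rw [← Matrix.map_mul, Matrix.map_apply, Matrix.mul_apply, hrel, map_sum]
      simp_rw [map_mul, hjc, Matrix.of_apply, E.frob_j]
    rw [h1, ← hAi, ← Matrix.mul_assoc, h2, Matrix.mul_apply]
    simp_rw [Matrix.of_apply, Finset.sum_mul]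
    rw [Finset.sum_comm]
    refine Finset.sum_congr rfl fun k' _ => ?_
    rw [hXdef, Matrix.mul_apply, map_sum, Finset.mul_sum]
    refine Finset.sum_congr rfl fun u _ => ?_
    rw [map_mul E.T.frob, mul_assoc]; rfl
  have hX0 : ∀ N : ℕ, ∀ n : ℤ, n ≠ 0 → n.natAbs ≤ N → ∀ i k l, E.T.coeff (X (i, k) l) n = 0 := by
    intro N
    induction N with
    | zero => intro n hn h; omega
    | succ N ih =>
      intro n hn hle i k l
      have h1 : E.T.coeff (X (i, k) l * E.T.const (c l)) n = E.T.coeff _ n :=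
        congrArg (fun z => E.T.coeff z n) (hX i k l)
      rw [mul_comm, E.T.coeff_const_mul, E.T.coeff_sum] at h1
      have h2 : c l * E.T.coeff (X (i, k) l) n = 0 := by
        rw [h1]
        refine Finset.sum_eq_zero fun k' _ => ?_
        rw [E.T.coeff_const_mul, E.T.coeff_frob]
        split_ifs with hdv
        · obtain ⟨q, rfl⟩ := hdv
          have hp0 : (p : ℤ) ≠ 0 := by exact_mod_cast hp.out.ne_zero
          rw [Int.mul_ediv_cancel_left _ hp0, ih q, map_zero, mul_zero]
          · rintro rfl; simp at hn
          · rw [Int.natAbs_mul, Int.natAbs_natCast] at hle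
            have h2 := hp.out.two_le
            have h3 : q.natAbs ≠ 0 := by
              intro h; apply hn; rw [Int.natAbs_eq_zero.1 h, mul_zero]
            have : 2 * q.natAbs ≤ p * q.natAbs := Nat.mul_le_mul_right _ h2
            omega
        · rw [mul_zero]
      exact (mul_eq_zero.1 h2).resolve_left (hc l)
  obtain ⟨Ξ, hΞ⟩ : ∃ Ξ : Matrix (Fin r × Fin m) (Fin r) E.T.F, ∀ a l, Ξ a l =
      E.T.coeff (X a l) 0 := ⟨Matrix.of fun a l => E.T.coeff (X a l) 0, fun _ _ => rfl⟩
  have hXc : X = Ξ.map E.T.const := by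
    ext ⟨i, k⟩ l
    apply E.T.ext
    intro n
    rw [Matrix.map_apply, E.T.coeff_const]
    split_ifs with h
    · rw [h, hΞ]
    · exact hX0 _ n h le_rfl i k l
  obtain ⟨L, hL⟩ : ∃ L : Matrix (Fin r) (Fin r × Fin m) E.T.F, ∀ i a, L i a =
      if a.1 = i then b a.2 else 0 :=
    ⟨Matrix.of fun i a => if a.1 = i then b a.2 else 0, fun _ _ => rfl⟩
  have hLX : L * Ξ = 1 := by
    have h1 : (L.map E.T.const) * (Ht.map E.j) = H := by
      ext i l
      rw [Matrix.mul_apply, Fintype.sum_prod_type, Finset.sum_eq_single i]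
      · rw [hHt]
        exact Finset.sum_congr rfl fun k _ => by simp [hL]
      · intro i' _ hne
        exact Finset.sum_eq_zero fun k _ => by simp [hL, hne]
      · intro h; exact absurd (Finset.mem_univ _) h
    have h2 : (L * Ξ).map E.T.const = (1 : Matrix (Fin r) (Fin r) E.T.F).map E.T.const := by
      rw [Matrix.map_mul, ← hXc, hXdef, ← Matrix.mul_assoc, h1, hH,
        Matrix.map_one _ (map_zero _) (map_one _)]
    exact Matrix.map_injective E.T.const_injective h2
  obtain ⟨g, hg⟩ := exists_rows Ξ L hLX
  set Gm := Ξ.submatrix g id with hGm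
  set Hn : Matrix (Fin r) (Fin r) S.Γac := Ht.submatrix g id with hHn
  have hjHn : Hn.map E.j = Gm.map E.T.const * H := by
    have h1 : Hn.map E.j * Hi = Gm.map E.T.const := by
      ext i l
      have := congrFun (congrFun hXc (g i)) l
      rw [hXdef] at this
      exact this
    rw [← h1, Matrix.mul_assoc, hHi, Matrix.mul_one]
  have hGi : Gm⁻¹.map E.T.const * Gm.map E.T.const = 1 := by
    rw [← Matrix.map_mul, Matrix.nonsing_inv_mul _ (Ne.isUnit hg),
      Matrix.map_one _ (map_zero _) (map_one _)]
  -- inverse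
  obtain ⟨l, hl⟩ : ∃ l, f l 1 ≠ 0 := by
    by_contra hcon
    push Not at hcon
    have := hf 1
    simp [hcon] at this
  set Y := Hi * Gm⁻¹.map E.T.const with hY
  have hYH : Y * Hn.map E.j = 1 := by
    rw [hjHn, hY, Matrix.mul_assoc, ← Matrix.mul_assoc _ _ H, hGi, Matrix.one_mul, hHi]
  set K : Matrix (Fin r) (Fin r) S.Γac := S.const (f l 1)⁻¹ • Y.map (d l) with hK
  have hd1' : d l 1 = S.const (f l 1) := by
    have := hd3 l 1 1; simpa using this
  have hKH : K * Hn = 1 := by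
    rw [hK, Matrix.smul_mul, ← hdA, hYH]
    ext i k
    rw [Matrix.smul_apply, Matrix.map_apply]
    by_cases hik : i = k
    · rw [hik, Matrix.one_apply_eq, Matrix.one_apply_eq, hd1', smul_eq_mul, ← map_mul,
        inv_mul_cancel₀ hl, map_one]
    · rw [Matrix.one_apply_ne hik, Matrix.one_apply_ne hik, map_zero, smul_zero]
  have hHK : Hn * K = 1 := mul_eq_one_comm.1 hKH
  have hjK : K.map E.j = Y := by
    have h1 : Hn.map E.j * K.map E.j = 1 := by
      rw [← Matrix.map_mul, hHK]; exact Matrix.map_one _ (map_zero _) (map_one _)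
    calc K.map E.j = (Y * Hn.map E.j) * K.map E.j := by rw [hYH, Matrix.one_mul]
      _ = Y := by rw [Matrix.mul_assoc, h1, Matrix.mul_one]
  set D1 := Hn * A * K.map S.frob with hD1
  set D2 : Matrix (Fin r) (Fin r) E.T.F := Gm * Matrix.diagonal c * (Gm⁻¹).map E.T.σF with hD2
  have hjD1 : D1.map E.j = D2.map E.T.const := by
    have h1 : (K.map S.frob).map E.j = Y.map E.T.frob := by
      rw [← hjK]; ext i k; simp [E.frob_j]
    have h2 : ((Gm⁻¹).map E.T.const).map E.T.frob = ((Gm⁻¹).map E.T.σF).map E.T.const := by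
      ext i k; simp [E.T.frob_const]
    have h3 : (Matrix.diagonal c).map E.T.const = D := by
      rw [hD, Matrix.diagonal_map (map_zero _)]
    rw [hD1, hD2, Matrix.map_mul, Matrix.map_mul, Matrix.map_mul, Matrix.map_mul, h1, h3, ← h2, hjHn,
      hY, Matrix.map_mul, Matrix.mul_assoc, Matrix.mul_assoc, ← Matrix.mul_assoc (A.map E.j), hAi,
      Matrix.mul_assoc, ← Matrix.mul_assoc H, hH, Matrix.one_mul]
    simp only [Matrix.mul_assoc]
  set Δ : Matrix (Fin r) (Fin r) S.F := fun i k => S.coeff (D1 i k) 0 with hΔ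
  have hD1c : D1 = Δ.map S.const := by
    ext i k
    apply S.ext
    intro n
    rw [Matrix.map_apply, S.coeff_const]
    split_ifs with h
    · rw [h]
    · apply E.ι.injective
      have := congrArg (fun M => E.T.coeff (M i k) n) hjD1
      simp only [Matrix.map_apply, E.coeff_j, E.T.coeff_const, if_neg h] at this
      rw [this, map_zero]
  have hιΔ : Δ.map E.ι = D2 := by
    ext i k
    have := congrArg (fun M => E.T.coeff (M i k) 0) hjD1
    simpa [E.coeff_j, E.T.coeff_const] using this
  refine ⟨Hn, K, Δ, hHK, hKH, ?_, ?_⟩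
  · intro h0
    have h1 : (Δ.map E.ι).det = 0 := by
      have h2 := (RingHom.map_det E.ι Δ).symm
      rw [h0, map_zero] at h2
      exact h2
    have h3 : ((Gm⁻¹).map E.T.σF).det ≠ 0 := by
      have h2 := (RingHom.map_det (E.T.σF : E.T.F →+* E.T.F) (Gm⁻¹)).symm
      intro hz
      have h4 : (E.T.σF : E.T.F →+* E.T.F) (Gm⁻¹).det = 0 := h2.symm.trans hz
      rw [map_eq_zero, Matrix.det_nonsing_inv, Ring.inverse_eq_inv', inv_eq_zero] at h4
      exact hg h4
    rw [hιΔ, hD2, Matrix.det_mul, Matrix.det_mul, Matrix.det_diagonal] at h1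
    exact mul_ne_zero (mul_ne_zero hg (Finset.prod_ne_zero_iff.2 fun i _ => hc i)) h3 h1
  · have h1 : K.map S.frob * Hn.map S.frob = 1 := by
      rw [← Matrix.map_mul, hKH]; exact Matrix.map_one _ (map_zero _) (map_one _)
    rw [← hD1c, hD1, Matrix.mul_assoc, h1, Matrix.mul_one]

end descent
end AnExt

namespace AnSetting
variable {p : ℕ} [hp : Fact p.Prime] (S : AnSetting p)

theorem semistable_of_constant {r : ℕ}
    (A : Matrix (Fin r) (Fin r) S.Γac) (hA : S.IsCrystal S.conSet A)
    (E : AnExt p S) (c : Fin r → E.T.F) (hc : ∀ i, c i ≠ 0 ∧ E.T.abv (c i) ≤ 1)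
    (h : E.T.Isogenous E.T.frob Set.univ (A.map E.j)
          (Matrix.diagonal fun i => E.T.const (c i))) :
    (∃ A₀ : Matrix (Fin r) (Fin r) S.Γac,
        S.IsCrystal S.omegaSet A₀ ∧ S.Isogenous S.frob S.conSet A A₀) := by
  obtain ⟨H, H', e, he, -, -, h1, -, h3, h4⟩ := h
  have hee : E.T.const e⁻¹ * E.T.const e = 1 := by rw [← map_mul, inv_mul_cancel₀ he, map_one]
  obtain ⟨G, Gi, Δ, hG, hGi, hΔ, hGA⟩ := E.descend c (fun i => (hc i).1) (H := H)
    (Hi := E.T.const e⁻¹ • H') (by rw [Matrix.mul_smul, h4, smul_smul, hee, one_smul])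
    (by rw [Matrix.smul_mul, h3, smul_smul, hee, one_smul]) h1
  exact S.semistable_of_trivial hA hG hGi Δ hΔ hGA
end AnSetting


namespace AnSetting

section Llemma
variable {p : ℕ} [hp : Fact p.Prime] (S : AnSetting p)

lemma abv_eval_lt {h : Polynomial S.F} (hh : ∀ i, S.abv (h.coeff i) < 1) {x : S.F}
    (hx : S.abv x ≤ 1) : S.abv (h.eval x) < 1 := by
  rw [Polynomial.eval_eq_sum_range]
  refine S.abv_sum_lt _ _ one_pos fun i _ => ?_
  rw [S.abv_mul, S.abv_pow]
  calc _ ≤ S.abv (h.coeff i) * 1 :=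
        mul_le_mul_of_nonneg_left (pow_le_one₀ (S.abv_nonneg _) hx) (S.abv_nonneg _)
    _ < 1 := by rw [mul_one]; exact hh i

lemma approx_root {f : Polynomial S.F} (hf : ∀ i, S.abv (f.coeff i) ≤ 1) {k : ℕ} (hk : 0 < k)
    (hk1 : S.abv (f.coeff k) = 1) : ∃ x, S.abv x ≤ 1 ∧ S.abv (f.eval x) < 1 := by
  let s := f.support.filter (fun i => S.abv (f.coeff i) = 1)
  have hks : k ∈ s := by
    rw [Finset.mem_filter, Polynomial.mem_support_iff]
    refine ⟨fun h => ?_, hk1⟩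
    rw [h, S.abv_zero] at hk1; exact zero_ne_one hk1
  obtain ⟨K, hKs, hKm⟩ := s.exists_max_image id ⟨k, hks⟩
  have hK1 : S.abv (f.coeff K) = 1 := (Finset.mem_filter.1 hKs).2
  have hkK : k ≤ K := hKm k hks
  have hgt : ∀ i, K < i → S.abv (f.coeff i) < 1 := by
    intro i hi
    refine lt_of_le_of_ne (hf i) fun h => ?_
    have : i ∈ s := by
      rw [Finset.mem_filter, Polynomial.mem_support_iff]
      refine ⟨fun h' => ?_, h⟩
      rw [h', S.abv_zero] at h; exact zero_ne_one h
    have := hKm i this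
    simp at this; omega
  set a := f.coeff K
  have ha0 : a ≠ 0 := fun h => by rw [h, S.abv_zero] at hK1; exact zero_ne_one hK1
  let g' : Polynomial S.F := ∑ i ∈ Finset.range (K + 1), Polynomial.monomial i (f.coeff i)
  have hg' : ∀ i, g'.coeff i = if i < K + 1 then f.coeff i else 0 := by
    intro i
    simp [g', Polynomial.finset_sum_coeff, Polynomial.coeff_monomial]
  let g := Polynomial.C a⁻¹ * g'
  have hg : ∀ i, g.coeff i = a⁻¹ * if i < K + 1 then f.coeff i else 0 := fun i => by
    rw [← hg', Polynomial.coeff_C_mul]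
  have hdeg : g.natDegree ≤ K := by
    rw [Polynomial.natDegree_le_iff_coeff_eq_zero]
    intro i hi
    rw [hg, if_neg (by omega), mul_zero]
  have hgK : g.coeff K = 1 := by
    rw [hg, if_pos (by omega), inv_mul_cancel₀ ha0]
  have hdeg' : g.natDegree = K := le_antisymm hdeg
    (Polynomial.le_natDegree_of_ne_zero (by rw [hgK]; exact one_ne_zero))
  obtain ⟨x, hx1, hx2⟩ := S.residue_algClosed g
    (Polynomial.monic_of_natDegree_le_of_coeff_eq_one K hdeg hgK)
    (fun i => by
      rw [hg, S.abv_mul, S.abv_inv, hK1, inv_one, one_mul]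
      split_ifs
      · exact hf i
      · rw [S.abv_zero]; exact zero_le_one) (by omega)
  refine ⟨x, hx1, ?_⟩
  have hfg : f = Polynomial.C a * g + (f - g') := by
    have : Polynomial.C a * g = g' := by
      simp only [g, ← mul_assoc, ← Polynomial.C_mul, mul_inv_cancel₀ ha0, Polynomial.C_1, one_mul]
    rw [this]; ring
  rw [hfg, Polynomial.eval_add, Polynomial.eval_mul, Polynomial.eval_C]
  refine S.abv_add_lt (by rw [S.abv_mul, hK1, one_mul]; exact hx2) (S.abv_eval_lt (fun i => ?_) hx1)
  rw [Polynomial.coeff_sub, hg']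
  split_ifs with h
  · rw [sub_self, S.abv_zero]; exact one_pos
  · rw [sub_zero]; exact hgt i (by omega)

lemma abv_iter (k : ℕ) (x : S.F) : S.abv (S.σF^[k] x) = S.abv x := by
  induction k with
  | zero => rfl
  | succ k ih => rw [Function.iterate_succ_apply', S.abv_σF, ih]

lemma abv_pow_sub_pow {a b : S.F} (ha : S.abv a ≤ 1) (hb : S.abv b ≤ 1) (h : S.abv (a - b) < 1)
    (n : ℕ) : S.abv (a ^ n - b ^ n) < 1 := by
  induction n with
  | zero => simp [S.abv_zero]
  | succ n ih =>
    have : a ^ (n+1) - b ^ (n+1) = a * (a ^ n - b ^ n) + (a - b) * b ^ n := by ring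
    rw [this]
    refine S.abv_add_lt ?_ ?_
    · rw [S.abv_mul]
      calc _ ≤ 1 * S.abv (a ^ n - b ^ n) := mul_le_mul_of_nonneg_right ha (S.abv_nonneg _)
        _ < 1 := by rwa [one_mul]
    · rw [S.abv_mul, S.abv_pow]
      calc _ ≤ S.abv (a - b) * 1 :=
            mul_le_mul_of_nonneg_left (pow_le_one₀ (S.abv_nonneg _) hb) (S.abv_nonneg _)
        _ < 1 := by rwa [mul_one]

lemma iter_frob {x : S.F} (hx : S.abv x ≤ 1) (k : ℕ) : S.abv (S.σF^[k] x - x ^ p ^ k) < 1 := by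
  induction k with
  | zero => simp [S.abv_zero]
  | succ k ih =>
    rw [Function.iterate_succ_apply']
    have h1 := S.σF_frob (S.σF^[k] x) (by rw [S.abv_iter]; exact hx)
    have h2 := S.abv_pow_sub_pow (by rw [S.abv_iter]; exact hx)
      (by rw [S.abv_pow]; exact pow_le_one₀ (S.abv_nonneg _) hx) ih p
    rw [← pow_mul, ← pow_succ] at h2
    have := S.abv_add_lt h1 h2
    rwa [sub_add_sub_cancel] at this

/-- the σ-polynomial operator -/
noncomputable def Lop (n : ℕ) (β : ℕ → S.F) (y : S.F) : S.F :=
  ∑ k ∈ Finset.range (n + 1), β k * S.σF^[k] y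

lemma Lop_add (n : ℕ) (β : ℕ → S.F) (x y : S.F) : S.Lop n β (x + y) = S.Lop n β x + S.Lop n β y := by
  simp only [Lop, iterate_map_add, mul_add, Finset.sum_add_distrib]
lemma Lop_sub (n : ℕ) (β : ℕ → S.F) (x y : S.F) : S.Lop n β (x - y) = S.Lop n β x - S.Lop n β y := by
  simp only [Lop, iterate_map_sub, mul_sub, Finset.sum_sub_distrib]
lemma Lop_le {n : ℕ} {β : ℕ → S.F} (hβ : ∀ k, k ≤ n → S.abv (β k) ≤ 1) (y : S.F) :
    S.abv (S.Lop n β y) ≤ S.abv y := by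
  refine S.abv_sum_le _ _ (S.abv_nonneg _) fun k hk => ?_
  rw [S.abv_mul, S.abv_iter]
  have := hβ k (by have := Finset.mem_range.1 hk; omega)
  calc _ ≤ 1 * S.abv y := mul_le_mul_of_nonneg_right this (S.abv_nonneg _)
    _ = _ := one_mul _

lemma Lop_sub_poly {n : ℕ} {β : ℕ → S.F} (hβ : ∀ k, k ≤ n → S.abv (β k) ≤ 1) {x : S.F}
    (hx : S.abv x ≤ 1) :
    S.abv (S.Lop n β x - ∑ k ∈ Finset.range (n + 1), β k * x ^ p ^ k) < 1 := by
  rw [Lop, ← Finset.sum_sub_distrib]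
  refine S.abv_sum_lt _ _ one_pos fun k hk => ?_
  rw [← mul_sub, S.abv_mul]
  have := hβ k (by have := Finset.mem_range.1 hk; omega)
  calc _ ≤ 1 * S.abv (S.σF^[k] x - x ^ p ^ k) := mul_le_mul_of_nonneg_right this (S.abv_nonneg _)
    _ < 1 := by rw [one_mul]; exact S.iter_frob hx k

/-- coefficients of sparse polynomials -/
lemma sparse_coeff (n : ℕ) (β : ℕ → S.F) (e : ℕ → ℕ) (he : Function.Injective e) :
    (∀ k, k ≤ n → (∑ k ∈ Finset.range (n + 1), Polynomial.monomial (e k) (β k)).coeff (e k) = β k) ∧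
    ((∀ k, k ≤ n → S.abv (β k) ≤ 1) → ∀ i, S.abv ((∑ k ∈ Finset.range (n + 1),
      Polynomial.monomial (e k) (β k)).coeff i) ≤ 1) := by
  constructor
  · intro k hk
    rw [Polynomial.finset_sum_coeff, Finset.sum_eq_single k]
    · simp
    · intro l _ hl
      rw [Polynomial.coeff_monomial, if_neg (fun h => hl (he h))]
    · intro h; exact absurd (Finset.mem_range.2 (by omega)) h
  · intro h i
    rw [Polynomial.finset_sum_coeff]
    refine S.abv_sum_le _ _ zero_le_one fun k hk => ?_
    rw [Polynomial.coeff_monomial]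
    split_ifs
    · exact h k (by have := Finset.mem_range.1 hk; omega)
    · rw [S.abv_zero]; exact zero_le_one

lemma Lop_step0 {n : ℕ} {β : ℕ → S.F} (hβ : ∀ k, k ≤ n → S.abv (β k) ≤ 1)
    (h1 : ∃ k, k ≤ n ∧ S.abv (β k) = 1) {z : S.F} (hz : S.abv z ≤ 1) :
    ∃ y, S.abv y ≤ 1 ∧ S.abv (z - S.Lop n β y) < 1 := by
  obtain ⟨k, hk, hk1⟩ := h1
  have hinj : Function.Injective (fun k : ℕ => p ^ k) := Nat.pow_right_injective hp.out.two_le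
  obtain ⟨hs1, hs2⟩ := S.sparse_coeff n β (fun k => p ^ k) hinj
  set f0 : Polynomial S.F := ∑ k ∈ Finset.range (n + 1), Polynomial.monomial (p ^ k) (β k)
  have hpk : 0 < p ^ k := pow_pos hp.out.pos k
  obtain ⟨x, hx1, hx2⟩ := S.approx_root (f := f0 - Polynomial.C z) (k := p ^ k) (fun i => by
    rw [Polynomial.coeff_sub, Polynomial.coeff_C]
    refine S.abv_sub_le' (hs2 hβ i) ?_
    split_ifs
    · exact hz
    · rw [S.abv_zero]; exact zero_le_one) hpk (by
      rw [Polynomial.coeff_sub, Polynomial.coeff_C, if_neg hpk.ne', sub_zero]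
      exact (congrArg S.abv (hs1 k hk)).trans hk1)
  refine ⟨x, hx1, ?_⟩
  have h3 := S.Lop_sub_poly hβ hx1
  rw [Polynomial.eval_sub, Polynomial.eval_C] at hx2
  have h4 : f0.eval x = ∑ k ∈ Finset.range (n + 1), β k * x ^ p ^ k := by
    simp [f0, Polynomial.eval_finset_sum]
  rw [← h4] at h3
  have := S.abv_add_lt h3 hx2
  rw [sub_add_sub_cancel] at this
  rwa [S.abv_sub_comm]

lemma Lop_step {w : S.F} (hw : S.IsUnif w) {n : ℕ} {β : ℕ → S.F} (hβ : ∀ k, k ≤ n → S.abv (β k) ≤ 1)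
    (h1 : ∃ k, k ≤ n ∧ S.abv (β k) = 1) (i : ℕ) {z : S.F} (hz : S.abv z ≤ S.abv w ^ i) :
    ∃ y, S.abv y ≤ S.abv w ^ i ∧ S.abv (z - S.Lop n β y) ≤ S.abv w ^ (i + 1) := by
  have hw0 := S.abv_pos hw.1
  have hwi : w ^ i ≠ 0 := pow_ne_zero _ hw.1
  have hwi0 : 0 < S.abv w ^ i := pow_pos hw0 i
  have habv : ∀ k, S.abv (β k * S.σF^[k] (w ^ i) / w ^ i) = S.abv (β k) := fun k => by
    rw [S.abv_div, S.abv_mul, S.abv_iter, mul_div_assoc, div_self (by rw [S.abv_pow]; exact hwi0.ne'),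
      mul_one]
  obtain ⟨y, hy1, hy2⟩ := S.Lop_step0 (n := n) (β := fun k => β k * S.σF^[k] (w ^ i) / w ^ i)
    (fun k hk => by rw [habv]; exact hβ k hk)
    (by obtain ⟨k, hk, h⟩ := h1; exact ⟨k, hk, by rw [habv]; exact h⟩) (z := z / w ^ i)
    (by rw [S.abv_div, S.abv_pow]; exact (div_le_one hwi0).2 hz)
  refine ⟨w ^ i * y, ?_, ?_⟩
  · rw [S.abv_mul, S.abv_pow]
    calc _ ≤ S.abv w ^ i * 1 := mul_le_mul_of_nonneg_left hy1 hwi0.le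
      _ = _ := mul_one _
  · have h2 : z - S.Lop n β (w ^ i * y) =
        w ^ i * (z / w ^ i - S.Lop n (fun k => β k * S.σF^[k] (w ^ i) / w ^ i) y) := by
      rw [mul_sub, mul_div_cancel₀ _ hwi]
      congr 1
      rw [Lop, Lop, Finset.mul_sum]
      refine Finset.sum_congr rfl fun k _ => ?_
      rw [iterate_map_mul]
      field_simp
    rw [h2, S.abv_mul, S.abv_pow, pow_succ]
    exact mul_le_mul_of_nonneg_left (hw.le S hy2) hwi0.le

lemma Lop_solve {w : S.F} (hw : S.IsUnif w) {n : ℕ} {β : ℕ → S.F}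
    (hβ : ∀ k, k ≤ n → S.abv (β k) ≤ 1)
    (h1 : ∃ k, k ≤ n ∧ S.abv (β k) = 1) (i : ℕ) {z : S.F} (hz : S.abv z ≤ S.abv w ^ i) :
    ∃ y, S.abv y ≤ S.abv w ^ i ∧ S.Lop n β y = z := by
  have hw0 := S.abv_pos hw.1
  have hstep : ∀ (i : ℕ) (z : S.F), ∃ y, S.abv z ≤ S.abv w ^ i →
      S.abv y ≤ S.abv w ^ i ∧ S.abv (z - S.Lop n β y) ≤ S.abv w ^ (i + 1) := by
    intro i z
    by_cases h : S.abv z ≤ S.abv w ^ i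
    · obtain ⟨y, hy⟩ := S.Lop_step hw hβ h1 i h
      exact ⟨y, fun _ => hy⟩
    · exact ⟨0, fun h' => absurd h' h⟩
  choose Y hY using hstep
  let zs : ℕ → S.F := fun m => Nat.rec z (fun m x => x - S.Lop n β (Y (i + m) x)) m
  have hzs : ∀ m, S.abv (zs m) ≤ S.abv w ^ (i + m) := by
    intro m
    induction m with
    | zero => exact hz
    | succ m ih => exact (hY (i + m) (zs m) ih).2
  obtain ⟨s, hs⟩ := S.exists_sum (fun m => Y (i + m) (zs m)) (C := S.abv w ^ i) hw0.le hw.2.1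
    (fun m => by rw [← pow_add]; exact (hY (i + m) (zs m) (hzs m)).1)
  have hpart : ∀ K, z - S.Lop n β (∑ m ∈ Finset.range K, Y (i + m) (zs m)) = zs K := by
    intro K
    induction K with
    | zero => simp [zs, Lop]
    | succ K ih =>
      rw [Finset.sum_range_succ, Lop_add, ← sub_sub, ih]
  refine ⟨s, by simpa using hs 0, ?_⟩
  rw [← sub_eq_zero]
  refine S.eq_zero_of_pow_le (C := S.abv w ^ i) hw0.le hw.2.1 fun K => ?_
  have h2 : S.Lop n β s - z = S.Lop n β (s - ∑ m ∈ Finset.range K, Y (i + m) (zs m)) - zs K := by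
    rw [← hpart K, Lop_sub]; ring
  rw [h2]
  refine S.abv_sub_le' ((S.Lop_le hβ _).trans (hs K)) ?_
  rw [← pow_add]; exact hzs K

lemma Lop_surj {n : ℕ} {β : ℕ → S.F} (h1 : ∃ k, k ≤ n ∧ β k ≠ 0) (z : S.F) :
    ∃ y, S.Lop n β y = z := by
  obtain ⟨w, hw⟩ := S.exists_unif
  obtain ⟨k, hk, hk0⟩ := h1
  obtain ⟨l, hl, hlm⟩ := (Finset.range (n + 1)).exists_max_image (fun k => S.abv (β k))
    ⟨0, by simp⟩
  have hl0 : β l ≠ 0 := by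
    intro h
    have := hlm k (Finset.mem_range.2 (by omega))
    rw [h, S.abv_zero] at this
    exact absurd (S.abv_pos hk0) (by linarith)
  have hlpos := S.abv_pos hl0
  obtain ⟨N, hN⟩ := S.exists_p_pow (S.abv (z / β l))
  set a : S.F := (p : S.F) ^ N with ha
  have ha0 : a ≠ 0 := pow_ne_zero _ S.p_ne_zero
  obtain ⟨y, -, hy⟩ := S.Lop_solve hw (n := n) (β := fun k => β k / β l)
    (fun k hk => by
      rw [S.abv_div, div_le_one hlpos]
      exact hlm k (Finset.mem_range.2 (by omega)))
    ⟨l, by have := Finset.mem_range.1 hl; omega, by rw [S.abv_div, div_self hlpos.ne']⟩ 0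
    (z := a * (z / β l)) (by rw [S.abv_mul, pow_zero]; exact hN)
  refine ⟨a⁻¹ * y, ?_⟩
  have hσ : ∀ k, S.σF^[k] a⁻¹ = a⁻¹ := fun k => by
    apply Function.iterate_fixed
    rw [ha]; simp
  have h2 : S.Lop n β (a⁻¹ * y) = a⁻¹ * β l * S.Lop n (fun k => β k / β l) y := by
    rw [Lop, Lop, Finset.mul_sum]
    refine Finset.sum_congr rfl fun k _ => ?_
    rw [iterate_map_mul, hσ]
    field_simp
  rw [h2, hy]
  field_simp

lemma Lop_kernel {n : ℕ} {β : ℕ → S.F} (hβ : ∀ k, k ≤ n → S.abv (β k) ≤ 1)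
    (h0 : S.abv (β 0) = 1) {k : ℕ} (hk0 : 0 < k) (hk : k ≤ n) (hk1 : S.abv (β k) = 1) :
    ∃ y, y ≠ 0 ∧ S.abv y = 1 ∧ S.Lop n β y = 0 := by
  obtain ⟨w, hw⟩ := S.exists_unif
  have hp2 := hp.out.two_le
  have hpos : ∀ k, 0 < p ^ k := fun k => pow_pos hp.out.pos k
  have hinj : Function.Injective (fun k : ℕ => p ^ k - 1) := fun a b h => by
    have h1 := hpos a
    have h2 := hpos b
    dsimp only at h
    exact Nat.pow_right_injective hp2 (show p ^ a = p ^ b by omega)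
  obtain ⟨hs1, hs2⟩ := S.sparse_coeff n β (fun k => p ^ k - 1) hinj
  set g : Polynomial S.F := ∑ k ∈ Finset.range (n + 1), Polynomial.monomial (p ^ k - 1) (β k)
  have hpk : 0 < p ^ k - 1 := by
    have : p ^ 1 ≤ p ^ k := Nat.pow_le_pow_right hp.out.pos hk0
    rw [pow_one] at this
    omega
  obtain ⟨x, hx1, hx2⟩ := S.approx_root (f := g) (k := p ^ k - 1) (hs2 hβ) hpk
    ((congrArg S.abv (hs1 k hk)).trans hk1)
  have hg0 : g.coeff 0 = β 0 := by simpa using hs1 0 (Nat.zero_le _)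
  have hx : S.abv x = 1 := by
    by_contra hne
    have hlt := lt_of_le_of_ne hx1 hne
    have h3 : S.abv (g.eval x - β 0) < 1 := by
      rw [← hg0, Polynomial.eval_eq_sum_range, Finset.sum_range_succ', pow_zero, mul_one,
        add_sub_cancel_right]
      refine S.abv_sum_lt _ _ one_pos fun i _ => ?_
      rw [S.abv_mul, S.abv_pow, pow_succ]
      calc _ ≤ 1 * (1 * S.abv x) := mul_le_mul (hs2 hβ _)
            (mul_le_mul_of_nonneg_right (pow_le_one₀ (S.abv_nonneg _) hx1) (S.abv_nonneg _))
            (mul_nonneg (pow_nonneg (S.abv_nonneg _) _) (S.abv_nonneg _)) zero_le_one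
        _ < 1 := by simpa using hlt
    have := S.abv_sub_lt hx2 h3
    rw [sub_sub_cancel, h0] at this
    exact lt_irrefl _ this
  have hL : S.abv (S.Lop n β x) < 1 := by
    have h3 := S.Lop_sub_poly hβ hx1
    have h4 : ∑ k ∈ Finset.range (n + 1), β k * x ^ p ^ k = x * g.eval x := by
      simp only [g, Polynomial.eval_finset_sum, Polynomial.eval_monomial, Finset.mul_sum]
      refine Finset.sum_congr rfl fun k _ => ?_
      obtain ⟨m, hm⟩ := Nat.exists_eq_add_of_le' (hpos k)
      rw [hm, Nat.add_sub_cancel, pow_succ]; ring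
    rw [h4] at h3
    have h5 : S.abv (x * g.eval x) < 1 := by rw [S.abv_mul, hx, one_mul]; exact hx2
    have := S.abv_add_lt h3 h5
    rwa [sub_add_cancel] at this
  obtain ⟨y', hy1, hy2⟩ := S.Lop_solve hw hβ ⟨0, Nat.zero_le _, h0⟩ 1 (z := S.Lop n β x)
    (by rw [pow_one]; exact hw.le S hL)
  rw [pow_one] at hy1
  have habs : S.abv (x - y') = 1 := by
    rw [← hx]
    apply S.abv_eq_of_sub_lt
    have : x - y' - x = - y' := by ring
    rw [this, S.abv_neg, hx]
    exact hy1.trans_lt hw.2.1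
  refine ⟨x - y', fun h => ?_, habs, by rw [Lop_sub, hy2, sub_self]⟩
  rw [h, S.abv_zero] at habs; exact zero_ne_one habs

lemma exists_fixed_unif : ∃ w, S.IsUnif w ∧ S.σF w = w := by
  obtain ⟨w, hw⟩ := S.exists_unif
  have hw0 := S.abv_pos hw.1
  have hσw : S.abv (S.σF w / w) = 1 := by rw [S.abv_div, S.abv_σF, div_self hw0.ne']
  obtain ⟨u, hu0, hu1, hu⟩ := S.Lop_kernel (n := 1)
    (β := fun k => if k = 0 then -1 else S.σF w / w)
    (fun k _ => by
      split_ifs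
      · rw [S.abv_neg, S.abv_one]
      · exact hσw.le) (by simp [S.abv_neg, S.abv_one]) (k := 1) one_pos le_rfl (by simpa using hσw)
  have habs : S.abv (w * u) = S.abv w := by rw [S.abv_mul, hu1, mul_one]
  refine ⟨w * u, ⟨mul_ne_zero hw.1 hu0, by rw [habs]; exact hw.2.1, by rw [habs]; exact hw.2.2⟩, ?_⟩
  simp [Lop, Finset.sum_range_succ] at hu
  rw [map_mul]
  have hw1 := hw.1
  field_simp at hu
  linear_combination hu

end Llemma
end AnSetting


namespace KExt

open Polynomial

section Gen

variable {R : Type} [CommRing R] [Nontrivial R] (a : R) (N : ℕ)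

/-- The ring `R[X]/(X^N - a)`. -/
abbrev Ring' : Type := AdjoinRoot (X ^ N - C a : R[X])

variable (hN : 0 < N)

theorem monic (hN : 0 < N) : (X ^ N - C a : R[X]).Monic := monic_X_pow_sub_C a hN.ne'

/-- Coordinates. -/
noncomputable def crd (hN : 0 < N) (i : ℕ) : Ring' a N →ₗ[R] R :=
  (Polynomial.lcoeff R i).comp (AdjoinRoot.modByMonicHom (monic a N hN))

/-- The root. -/
noncomputable def rt : Ring' a N := AdjoinRoot.root _

theorem rt_pow : (rt a N) ^ N = AdjoinRoot.of _ a := by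
  have h := AdjoinRoot.eval₂_root (X ^ N - C a : R[X])
  simp only [eval₂_sub, eval₂_X_pow, eval₂_C] at h
  exact sub_eq_zero.mp h

theorem eq_sum (x : Ring' a N) :
    x = ∑ i ∈ Finset.range N, AdjoinRoot.of _ (crd a N hN i x) * rt a N ^ i := by
  have h := AdjoinRoot.mk_leftInverse (monic a N hN) x
  have hd : (AdjoinRoot.modByMonicHom (monic a N hN) x).natDegree < N := by
    obtain ⟨f, rfl⟩ := AdjoinRoot.mk_surjective x
    rw [AdjoinRoot.modByMonicHom_mk]
    have := natDegree_modByMonic_lt f (monic a N hN) (by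
      intro h1
      have h2 := congrArg natDegree h1
      rw [natDegree_X_pow_sub_C, natDegree_one] at h2
      omega)
    rwa [natDegree_X_pow_sub_C] at this
  conv_lhs => rw [← h]
  conv_lhs => rw [as_sum_range' _ N hd]
  rw [map_sum]
  refine Finset.sum_congr rfl fun i _ => ?_
  rw [← C_mul_X_pow_eq_monomial, map_mul, map_pow]
  rfl

theorem crd_rt_lt {k : ℕ} (hk : k < N) (i : ℕ) :
    crd a N hN i (rt a N ^ k) = if i = k then 1 else 0 := by
  have : rt a N ^ k = AdjoinRoot.mk (X ^ N - C a : R[X]) (X ^ k) := by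
    rw [map_pow]; rfl
  rw [this, crd, LinearMap.comp_apply, AdjoinRoot.modByMonicHom_mk,
    (modByMonic_eq_self_iff (monic a N hN)).2]
  · simp [coeff_X_pow]
  · rw [degree_X_pow, degree_X_pow_sub_C hN]
    exact_mod_cast hk

theorem of_mul (c : R) (x : Ring' a N) : AdjoinRoot.of _ c * x = c • x := by
  rw [Algebra.smul_def]; rfl

theorem of_mul_rt (c : R) (k : ℕ) : AdjoinRoot.of _ c * rt a N ^ k =
    AdjoinRoot.of _ (c * a ^ (k / N)) * rt a N ^ (k % N) := by
  conv_lhs => rw [← Nat.div_add_mod k N, pow_add, pow_mul, rt_pow]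
  rw [map_mul, map_pow, mul_assoc]

theorem crd_rt (c : R) (k i : ℕ) :
    crd a N hN i (AdjoinRoot.of _ c * rt a N ^ k) =
      if i = k % N then c * a ^ (k / N) else 0 := by
  rw [of_mul_rt, of_mul, map_smul, crd_rt_lt _ _ hN (Nat.mod_lt _ hN)]
  simp

theorem crd_of (c : R) (i : ℕ) :
    crd a N hN i (AdjoinRoot.of _ c) = if i = 0 then c else 0 := by
  have := crd_rt a N hN c 0 i
  simpa using this

theorem ext {x y : Ring' a N} (h : ∀ i < N, crd a N hN i x = crd a N hN i y) : x = y := by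
  rw [eq_sum a N hN x, eq_sum a N hN y]
  exact Finset.sum_congr rfl fun i hi => by rw [h i (Finset.mem_range.mp hi)]

/-- element with given coordinates -/
theorem crd_sum (c : ℕ → R) {i : ℕ} (hi : i < N) :
    crd a N hN i (∑ k ∈ Finset.range N, AdjoinRoot.of _ (c k) * rt a N ^ k) = c i := by
  rw [map_sum, Finset.sum_eq_single i]
  · rw [crd_rt, Nat.mod_eq_of_lt hi, Nat.div_eq_of_lt hi]; simp
  · intro k hk hne
    rw [crd_rt, Nat.mod_eq_of_lt (Finset.mem_range.mp hk), if_neg (Ne.symm hne)]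
  · intro h; exact absurd (Finset.mem_range.mpr hi) h

variable {R' : Type} [CommRing R'] [Nontrivial R']

/-- functoriality -/
noncomputable def map {a : R} {a' : R'} (f : R →+* R') (h : f a = a') : Ring' a N →+* Ring' a' N :=
  AdjoinRoot.lift ((AdjoinRoot.of _).comp f) (rt a' N) (by
    simp only [eval₂_sub, eval₂_X_pow, eval₂_C, RingHom.comp_apply, h]
    rw [rt_pow, sub_self])

variable {a} {a' : R'} (f : R →+* R') (h : f a = a')

theorem map_of (x : R) : map N f h (AdjoinRoot.of _ x) = AdjoinRoot.of _ (f x) :=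
  AdjoinRoot.lift_of _

theorem map_rt : map N f h (rt a N) = rt a' N := AdjoinRoot.lift_root _

theorem crd_map (x : Ring' a N) {i : ℕ} (hi : i < N) :
    crd a' N hN i (map N f h x) = f (crd a N hN i x) := by
  conv_lhs => rw [eq_sum a N hN x]
  rw [map_sum]
  simp only [map_mul, map_pow, map_of, map_rt]
  exact crd_sum a' N hN (fun k => f (crd a N hN k x)) hi

theorem map_surj (hf : Function.Surjective f) : Function.Surjective (map N f h) := by
  intro y
  choose g hg using hf
  rcases Nat.eq_zero_or_pos N with rfl | hN
  · obtain ⟨q, rfl⟩ := AdjoinRoot.mk_surjective y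
    obtain ⟨q', rfl⟩ := Polynomial.map_surjective f (fun z => ⟨g z, hg z⟩) q
    refine ⟨AdjoinRoot.mk _ q', ?_⟩
    rw [map, AdjoinRoot.lift_mk, ← eval₂_map]
    exact (AdjoinRoot.aeval_eq (q'.map f)).symm ▸ rfl
  · refine ⟨∑ k ∈ Finset.range N, AdjoinRoot.of _ (g (crd a' N hN k y)) * rt a N ^ k, ?_⟩
    rw [map_sum]
    simp only [map_mul, map_pow, map_of, map_rt, hg]
    exact (eq_sum a' N hN y).symm

end Gen

end KExt


namespace AnSetting

section ExtNorm
variable {p : ℕ} [hp : Fact p.Prime] (S : AnSetting p) {w : S.F} {N : ℕ}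

open KExt

/-- The absolute value of the new uniformizer. -/
noncomputable def rho (w : S.F) (N : ℕ) : ℝ := S.abv w ^ ((1 : ℝ) / N)

lemma rho_pos (hw : S.IsUnif w) : 0 < S.rho w N := Real.rpow_pos_of_pos (S.abv_pos hw.1) _

lemma rho_pow (hN : 0 < N) : S.rho w N ^ N = S.abv w := by
  rw [rho, ← Real.rpow_natCast, ← Real.rpow_mul (S.abv_nonneg w), one_div,
    inv_mul_cancel₀ (by exact_mod_cast hN.ne'), Real.rpow_one]

lemma rho_lt_one (hw : S.IsUnif w) (hN : 0 < N) : S.rho w N < 1 := by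
  by_contra h
  push Not at h
  have := one_le_pow₀ h (n := N)
  rw [S.rho_pow hN] at this
  exact absurd hw.2.1 (not_lt.mpr this)

/-- The norm on the Kummer extension. -/
noncomputable def nv (w : S.F) (hN : 0 < N) (x : Ring' w N) : ℝ :=
  (Finset.range N).sup' (Finset.nonempty_range_iff.mpr hN.ne')
    (fun i => S.abv (crd w N hN i x) * S.rho w N ^ i)


lemma nv_le_iff (hN : 0 < N) {x : Ring' w N} {C : ℝ} :
    S.nv w hN x ≤ C ↔ ∀ i < N, S.abv (crd w N hN i x) * S.rho w N ^ i ≤ C := by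
  rw [nv, Finset.sup'_le_iff]; simp

lemma nv_lt_iff (hN : 0 < N) {x : Ring' w N} {C : ℝ} :
    S.nv w hN x < C ↔ ∀ i < N, S.abv (crd w N hN i x) * S.rho w N ^ i < C := by
  rw [nv, Finset.sup'_lt_iff]; simp

lemma le_nv (hN : 0 < N) (x : Ring' w N) {i : ℕ} (hi : i < N) :
    S.abv (crd w N hN i x) * S.rho w N ^ i ≤ S.nv w hN x := (S.nv_le_iff hN).1 le_rfl i hi

lemma exists_nv (hN : 0 < N) (x : Ring' w N) :
    ∃ i < N, S.nv w hN x = S.abv (crd w N hN i x) * S.rho w N ^ i := by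
  obtain ⟨i, hi, h⟩ := Finset.exists_mem_eq_sup' (s := Finset.range N)
    (Finset.nonempty_range_iff.mpr hN.ne') (fun i => S.abv (crd w N hN i x) * S.rho w N ^ i)
  exact ⟨i, Finset.mem_range.mp hi, h⟩

lemma nv_nonneg (hw : S.IsUnif w) (hN : 0 < N) (x : Ring' w N) : 0 ≤ S.nv w hN x := by
  obtain ⟨i, _, h⟩ := S.exists_nv hN x
  rw [h]
  exact mul_nonneg (S.abv_nonneg _) (pow_nonneg (S.rho_pos hw).le _)

lemma nv_add_le (hw : S.IsUnif w) (hN : 0 < N) (x y : Ring' w N) : S.nv w hN (x + y) ≤ max (S.nv w hN x) (S.nv w hN y) := by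
  rw [S.nv_le_iff hN]
  intro i hi
  rw [map_add]
  have hr := pow_nonneg (S.rho_pos (N := N) hw).le i
  refine (mul_le_mul_of_nonneg_right (S.abv_add_le _ _) hr).trans ?_
  rw [max_mul_of_nonneg _ _ hr]
  exact max_le_max (S.le_nv hN x hi) (S.le_nv hN y hi)

lemma nv_eq_zero (hw : S.IsUnif w) (hN : 0 < N) (x : Ring' w N) : S.nv w hN x = 0 ↔ x = 0 := by
  constructor
  · intro h
    refine KExt.ext w N hN fun i hi => ?_
    have h1 := S.le_nv hN x hi
    rw [h] at h1
    have hr := pow_pos (S.rho_pos (N := N) hw) i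
    have h2 : S.abv (crd w N hN i x) ≤ 0 := by
      by_contra h3
      push Not at h3
      exact absurd (mul_pos h3 hr) (not_lt.mpr h1)
    rw [map_zero]
    exact (S.abv_eq_zero _).1 (le_antisymm h2 (S.abv_nonneg _))
  · rintro rfl
    obtain ⟨i, _, h⟩ := S.exists_nv hN (0 : Ring' w N)
    rw [h, map_zero, S.abv_zero, zero_mul]

lemma nv_neg (hN : 0 < N) (x : Ring' w N) : S.nv w hN (-x) = S.nv w hN x := by
  simp only [nv, map_neg, S.abv_neg]

lemma nv_mon (hw : S.IsUnif w) (hN : 0 < N) (c : S.F) (k : ℕ) :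
    S.nv w hN (AdjoinRoot.of _ c * rt w N ^ k) = S.abv c * S.rho w N ^ k := by
  have key : S.abv (c * w ^ (k / N)) * S.rho w N ^ (k % N) = S.abv c * S.rho w N ^ k := by
    conv_rhs => rw [← Nat.div_add_mod k N, pow_add, pow_mul, S.rho_pow hN]
    rw [S.abv_mul, S.abv_pow, mul_assoc]
  apply le_antisymm
  · rw [S.nv_le_iff hN]
    intro i hi
    rw [crd_rt]
    split_ifs with h
    · rw [h, key]
    · rw [S.abv_zero, zero_mul]
      exact mul_nonneg (S.abv_nonneg _) (pow_nonneg (S.rho_pos hw).le _)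
  · rw [← key]
    have := S.le_nv hN (AdjoinRoot.of _ c * rt w N ^ k) (Nat.mod_lt k hN)
    rwa [crd_rt, if_pos rfl] at this

lemma nv_of (hw : S.IsUnif w) (hN : 0 < N) (c : S.F) : S.nv w hN (AdjoinRoot.of _ c) = S.abv c := by
  have := S.nv_mon hw hN c 0
  simpa using this

lemma nv_sum_le (hw : S.IsUnif w) (hN : 0 < N) {α : Type*} (s : Finset α) (f : α → Ring' w N) {C : ℝ} (hC : 0 ≤ C)
    (h : ∀ i ∈ s, S.nv w hN (f i) ≤ C) : S.nv w hN (∑ i ∈ s, f i) ≤ C := by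
  induction s using Finset.induction_on with
  | empty => simpa [(S.nv_eq_zero hw hN 0).2 rfl] using hC
  | insert a s ha ih =>
    rw [Finset.sum_insert ha]
    exact (S.nv_add_le hw hN _ _).trans (max_le (h a (Finset.mem_insert_self _ _))
      (ih fun i hi => h i (Finset.mem_insert_of_mem hi)))

lemma nv_mul_le (hw : S.IsUnif w) (hN : 0 < N) (x y : Ring' w N) : S.nv w hN (x * y) ≤ S.nv w hN x * S.nv w hN y := by
  have h0 : 0 ≤ S.nv w hN x * S.nv w hN y := mul_nonneg (S.nv_nonneg hw hN x) (S.nv_nonneg hw hN y)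
  conv_lhs => rw [eq_sum w N hN x, eq_sum w N hN y, Finset.sum_mul_sum]
  refine S.nv_sum_le hw hN _ _ h0 fun i hi => S.nv_sum_le hw hN _ _ h0 fun j hj => ?_
  have e : (AdjoinRoot.of _ (crd w N hN i x) * rt w N ^ i) *
      (AdjoinRoot.of _ (crd w N hN j y) * rt w N ^ j) =
      AdjoinRoot.of _ (crd w N hN i x * crd w N hN j y) * rt w N ^ (i + j) := by
    rw [map_mul, pow_add]; ring
  rw [e, S.nv_mon hw hN, S.abv_mul, pow_add]
  calc _ = (S.abv (crd w N hN i x) * S.rho w N ^ i) * (S.abv (crd w N hN j y) * S.rho w N ^ j) := by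
        ring
    _ ≤ _ := mul_le_mul (S.le_nv hN x (Finset.mem_range.mp hi)) (S.le_nv hN y (Finset.mem_range.mp hj))
        (mul_nonneg (S.abv_nonneg _) (pow_nonneg (S.rho_pos hw).le _)) (S.nv_nonneg hw hN x)

lemma mon_inj (hw : S.IsUnif w) {a b : S.F} (ha : a ≠ 0) (hb : b ≠ 0) {i j : ℕ} (hi : i < N) (hj : j < N)
    (h : S.abv a * S.rho w N ^ i = S.abv b * S.rho w N ^ j) : i = j := by
  obtain ⟨u, hu⟩ := hw.2.2 a ha
  obtain ⟨v, hv⟩ := hw.2.2 b hb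
  have hN : 0 < N := by omega
  have h0 := S.rho_pos (N := N) hw
  have hz : ∀ (u : ℤ) (i : ℕ), S.abv w ^ u * S.rho w N ^ i = S.rho w N ^ ((N : ℤ) * u + i) := by
    intro u i
    rw [zpow_add₀ h0.ne', zpow_mul, zpow_natCast, S.rho_pow hN, zpow_natCast]
  rw [hu, hv, hz, hz] at h
  have h2 := zpow_right_injective₀ h0 (S.rho_lt_one hw hN).ne h
  have h3 : (i : ℤ) - j = N * (v - u) := by linarith
  have h4 : (N : ℤ) ∣ (i : ℤ) - j := ⟨_, h3⟩
  have h5 : (i : ℤ) - j = 0 := Int.eq_zero_of_abs_lt_dvd h4 (by rw [abs_lt]; omega)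
  omega

lemma nv_lead (hw : S.IsUnif w) (hN : 0 < N) {x : Ring' w N} (hx : x ≠ 0) : ∃ (i : ℕ) (c : S.F), i < N ∧ c ≠ 0 ∧
    S.nv w hN x = S.abv c * S.rho w N ^ i ∧
    S.nv w hN (x - AdjoinRoot.of _ c * rt w N ^ i) < S.nv w hN x := by
  obtain ⟨i, hi, h⟩ := S.exists_nv hN x
  have hpos : 0 < S.nv w hN x :=
    lt_of_le_of_ne (S.nv_nonneg hw hN x) (fun h => hx ((S.nv_eq_zero hw hN x).1 h.symm))
  have hc : crd w N hN i x ≠ 0 := by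
    intro h0
    rw [h, h0, S.abv_zero, zero_mul] at hpos
    exact lt_irrefl _ hpos
  refine ⟨i, _, hi, hc, h, ?_⟩
  rw [S.nv_lt_iff hN]
  intro j hj
  rw [map_sub, crd_rt, Nat.mod_eq_of_lt hi, Nat.div_eq_of_lt hi, pow_zero, mul_one]
  split_ifs with hij
  · rw [hij, sub_self, S.abv_zero, zero_mul]; exact hpos
  · rw [sub_zero]
    by_cases h0 : crd w N hN j x = 0
    · rw [h0, S.abv_zero, zero_mul]; exact hpos
    · refine lt_of_le_of_ne (S.le_nv hN x hj) fun he => hij ?_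
      rw [h] at he
      exact S.mon_inj hw h0 hc hj hi he

lemma nv_eq_of_sub_lt (hw : S.IsUnif w) (hN : 0 < N) {x y : Ring' w N} (h : S.nv w hN (x - y) < S.nv w hN y) :
    S.nv w hN x = S.nv w hN y := by
  apply le_antisymm
  · have := S.nv_add_le hw hN (x - y) y
    rw [sub_add_cancel] at this
    exact this.trans (max_le h.le le_rfl)
  · by_contra hlt
    push Not at hlt
    have := S.nv_add_le hw hN (y - x) x
    rw [sub_add_cancel, ← neg_sub, S.nv_neg] at this
    exact absurd this (not_le.mpr (max_lt h hlt))

lemma nv_mul (hw : S.IsUnif w) (hN : 0 < N) (x y : Ring' w N) : S.nv w hN (x * y) = S.nv w hN x * S.nv w hN y := by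
  by_cases hx : x = 0
  · rw [hx, zero_mul, (S.nv_eq_zero hw hN 0).2 rfl, zero_mul]
  by_cases hy : y = 0
  · rw [hy, mul_zero, (S.nv_eq_zero hw hN 0).2 rfl, mul_zero]
  have px : 0 < S.nv w hN x :=
    lt_of_le_of_ne (S.nv_nonneg hw hN x) (fun h => hx ((S.nv_eq_zero hw hN x).1 h.symm))
  have py : 0 < S.nv w hN y :=
    lt_of_le_of_ne (S.nv_nonneg hw hN y) (fun h => hy ((S.nv_eq_zero hw hN y).1 h.symm))
  obtain ⟨i, c, hi, hc, h1, h2⟩ := S.nv_lead hw hN hx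
  obtain ⟨j, d, hj, hd, h3, h4⟩ := S.nv_lead hw hN hy
  set X := AdjoinRoot.of _ c * rt w N ^ i with hX
  set Y := AdjoinRoot.of _ d * rt w N ^ j with hY
  have hXY : S.nv w hN (X * Y) = S.nv w hN x * S.nv w hN y := by
    have : X * Y = AdjoinRoot.of _ (c * d) * rt w N ^ (i + j) := by
      rw [hX, hY, map_mul, pow_add]; ring
    rw [this, S.nv_mon hw hN, h1, h3, S.abv_mul, pow_add]; ring
  have hXx : S.nv w hN X = S.nv w hN x := by rw [hX, S.nv_mon hw hN, h1]
  rw [← hXY]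
  apply S.nv_eq_of_sub_lt hw hN
  rw [hXY]
  have e : x * y - X * Y = (x - X) * y + X * (y - Y) := by ring
  rw [e]
  refine (S.nv_add_le hw hN _ _).trans_lt (max_lt ?_ ?_)
  · exact (S.nv_mul_le hw hN _ _).trans_lt (mul_lt_mul_of_pos_right h2 py)
  · refine (S.nv_mul_le hw hN _ _).trans_lt ?_
    rw [hXx]
    exact mul_lt_mul_of_pos_left h4 px

lemma nv_discrete (hw : S.IsUnif w) (hN : 0 < N) {x : Ring' w N} (hx : x ≠ 0) :
    ∃ n : ℤ, S.nv w hN x = (p : ℝ) ^ ((n : ℝ) / ((S.m * N : ℕ) : ℝ)) := by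
  obtain ⟨i, c, hi, hc, h1, h2⟩ := S.nv_lead hw hN hx
  obtain ⟨u, hu⟩ := S.abv_discrete c hc
  obtain ⟨v, hv⟩ := S.abv_discrete w hw.1
  refine ⟨u * N + v * i, ?_⟩
  have hm : (S.m : ℝ) ≠ 0 := by exact_mod_cast S.m_pos.ne'
  have hN' : (N : ℝ) ≠ 0 := by exact_mod_cast hN.ne'
  rw [h1, hu, rho, hv, ← Real.rpow_natCast, ← Real.rpow_mul p_pos.le, ← Real.rpow_mul p_pos.le,
    ← Real.rpow_add p_pos]
  congr 1
  push_cast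
  field_simp

lemma nv_approx (hw : S.IsUnif w) (hN : 0 < N) {x : Ring' w N} (hx : S.nv w hN x ≤ 1) :
    ∃ y, S.abv y ≤ 1 ∧ S.nv w hN (x - AdjoinRoot.of _ y) < 1 := by
  have h0 := S.le_nv hN x hN
  rw [pow_zero, mul_one] at h0
  refine ⟨crd w N hN 0 x, h0.trans hx, ?_⟩
  rw [S.nv_lt_iff hN]
  intro i hi
  rw [map_sub, crd_of]
  split_ifs with h
  · rw [h, sub_self, S.abv_zero, zero_mul]; exact one_pos
  · rw [sub_zero]
    by_cases h0 : crd w N hN i x = 0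
    · rw [h0, S.abv_zero, zero_mul]; exact one_pos
    · refine lt_of_le_of_ne ((S.le_nv hN x hi).trans hx) fun he => h ?_
      refine S.mon_inj hw h0 one_ne_zero hi hN ?_
      rw [he, S.abv_one]; simp

/-- The extension is an integral domain. -/
lemma kext_domain (hw : S.IsUnif w) (hN : 0 < N) : IsDomain (Ring' w N) := by
  have : Nontrivial (Ring' w N) := ⟨0, 1, fun h => by
    have h1 := S.nv_of hw hN 1
    rw [map_one, ← h, (S.nv_eq_zero hw hN 0).2 rfl, S.abv_one] at h1
    exact zero_ne_one h1⟩
  have : NoZeroDivisors (Ring' w N) := ⟨fun {x y} h => by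
    have h1 := S.nv_mul hw hN x y
    rw [h, (S.nv_eq_zero hw hN 0).2 rfl] at h1
    rcases mul_eq_zero.mp h1.symm with h2 | h2
    · exact Or.inl ((S.nv_eq_zero hw hN x).1 h2)
    · exact Or.inr ((S.nv_eq_zero hw hN y).1 h2)⟩
  exact NoZeroDivisors.to_isDomain _

/-- The field structure. -/
@[reducible] noncomputable def kextField (hw : S.IsUnif w) (hN : 0 < N) : Field (Ring' w N) :=
  letI := S.kext_domain hw hN
  letI : Module.Finite S.F (Ring' w N) := (monic w N hN).finite_adjoinRoot
  fieldOfFiniteDimensional S.F (Ring' w N)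

end ExtNorm
end AnSetting


namespace AnSetting

section ExtCoeff
variable {p : ℕ} [hp : Fact p.Prime] (S : AnSetting p) {w : S.F} {N : ℕ}

open KExt

lemma nontrivial_ac : Nontrivial S.Γac := inferInstance

/-- coefficients of an element of the extended ring -/
noncomputable def co (hN : 0 < N) (x : Ring' (S.const w) N) (n : ℤ) : Ring' w N :=
  ∑ i ∈ Finset.range N, AdjoinRoot.of _ (S.coeff (crd (S.const w) N hN i x) n) * rt w N ^ i

lemma crd_co (hN : 0 < N) (x : Ring' (S.const w) N) (n : ℤ) {i : ℕ} (hi : i < N) :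
    crd w N hN i (S.co hN x n) = S.coeff (crd (S.const w) N hN i x) n :=
  crd_sum w N hN (fun i => S.coeff (crd (S.const w) N hN i x) n) hi

lemma co_inj (hN : 0 < N) : Function.Injective (S.co (w := w) hN) := by
  intro x y h
  refine KExt.ext _ N hN fun i hi => S.ext fun n => ?_
  rw [← S.crd_co hN x n hi, ← S.crd_co hN y n hi, h]

lemma co_add (hN : 0 < N) (x y : Ring' (S.const w) N) (n : ℤ) :
    S.co hN (x + y) n = S.co hN x n + S.co hN y n := by
  refine KExt.ext _ N hN fun i hi => ?_
  rw [map_add, S.crd_co hN _ n hi, S.crd_co hN _ n hi, S.crd_co hN _ n hi, map_add, S.coeff_add]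

lemma co_zero (hN : 0 < N) (n : ℤ) : S.co (w := w) hN 0 n = 0 := by
  refine KExt.ext _ N hN fun i hi => ?_
  rw [map_zero, S.crd_co hN _ n hi, map_zero, S.coeff_zero]

lemma co_mon (hN : 0 < N) (z : S.Γac) (k : ℕ) (n : ℤ) :
    S.co hN (AdjoinRoot.of _ z * rt (S.const w) N ^ k) n =
      AdjoinRoot.of _ (S.coeff z n) * rt w N ^ k := by
  refine KExt.ext _ N hN fun i hi => ?_
  rw [S.crd_co hN _ n hi, crd_rt, crd_rt]
  split_ifs with h
  · rw [← map_pow, mul_comm z, S.coeff_const_mul, mul_comm]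
  · rw [S.coeff_zero]

lemma co_of (hN : 0 < N) (z : S.Γac) (n : ℤ) :
    S.co (w := w) hN (AdjoinRoot.of _ z) n = AdjoinRoot.of _ (S.coeff z n) := by
  have := S.co_mon (w := w) hN z 0 n
  simpa using this

/-- constants -/
noncomputable def kconst (w : S.F) (N : ℕ) : Ring' w N →+* Ring' (S.const w) N :=
  KExt.map N S.const rfl

lemma co_const (hN : 0 < N) (a : Ring' w N) (n : ℤ) :
    S.co hN (S.kconst w N a) n = if n = 0 then a else 0 := by
  refine KExt.ext _ N hN fun i hi => ?_
  rw [S.crd_co hN _ n hi, kconst, crd_map N hN _ _ _ hi, S.coeff_const]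
  split_ifs
  · rfl
  · rw [map_zero]

/-- frobenius -/
noncomputable def kfrob (hσ : S.σF w = w) (N : ℕ) : Ring' (S.const w) N →+* Ring' (S.const w) N :=
  KExt.map N S.frob (by rw [S.frob_const, hσ])

/-- sigma -/
noncomputable def ksig (hσ : S.σF w = w) (N : ℕ) : Ring' w N →+* Ring' w N :=
  KExt.map N (S.σF : S.F →+* S.F) (by simpa using hσ)

lemma crd_ksig (hσ : S.σF w = w) (hN : 0 < N) (x : Ring' w N) {i : ℕ} (hi : i < N) :
    crd w N hN i (S.ksig hσ N x) = S.σF (crd w N hN i x) := crd_map N hN _ _ _ hi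

lemma nv_ksig (hσ : S.σF w = w) (hN : 0 < N) (x : Ring' w N) :
    S.nv w hN (S.ksig hσ N x) = S.nv w hN x := by
  have : ∀ C, S.nv w hN (S.ksig hσ N x) ≤ C ↔ S.nv w hN x ≤ C := by
    intro C
    rw [S.nv_le_iff hN, S.nv_le_iff hN]
    refine forall₂_congr fun i hi => ?_
    rw [S.crd_ksig hσ hN _ hi, S.abv_σF]
  exact le_antisymm ((this _).2 le_rfl) ((this _).1 le_rfl)

lemma co_frob (hσ : S.σF w = w) (hN : 0 < N) (x : Ring' (S.const w) N) (n : ℤ) :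
    S.co hN (S.kfrob hσ N x) n =
      if (p : ℤ) ∣ n then S.ksig hσ N (S.co hN x (n / (p : ℤ))) else 0 := by
  refine KExt.ext _ N hN fun i hi => ?_
  rw [S.crd_co hN _ n hi, kfrob, crd_map N hN _ _ _ hi, S.coeff_frob]
  split_ifs
  · rw [S.crd_ksig hσ hN _ hi, S.crd_co hN _ _ hi]
  · rw [map_zero]

lemma nv_le_of_abv (hw : S.IsUnif w) (hN : 0 < N) {x : Ring' w N} {C : ℝ}
    (h : ∀ i < N, S.abv (crd w N hN i x) ≤ C) : S.nv w hN x ≤ C := by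
  rw [S.nv_le_iff hN]
  intro i hi
  refine le_trans ?_ (h i hi)
  exact mul_le_of_le_one_right (S.abv_nonneg _)
    (pow_le_one₀ (S.rho_pos hw).le (S.rho_lt_one hw hN).le)

lemma co_growth (hw : S.IsUnif w) (hN : 0 < N) (x : Ring' (S.const w) N) (ε : ℝ) (hε : 0 < ε) :
    ∃ M : ℤ, 0 ≤ M ∧ ∀ n : ℤ, M ≤ n → S.nv w hN (S.co hN x n) ≤ (1 + ε) ^ n := by
  choose M hM0 hM using fun i => S.coeff_growth (crd (S.const w) N hN i x) ε hε
  have hne := Finset.nonempty_range_iff.mpr hN.ne'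
  refine ⟨(Finset.range N).sup' hne M, ?_, fun n hn => ?_⟩
  · exact (hM0 0).trans (Finset.le_sup' M (Finset.mem_range.mpr hN))
  · refine S.nv_le_of_abv hw hN fun i hi => ?_
    rw [S.crd_co hN _ _ hi]
    exact hM i n ((Finset.le_sup' M (Finset.mem_range.mpr hi)).trans hn)

lemma co_decay (hw : S.IsUnif w) (hN : 0 < N) (x : Ring' (S.const w) N) :
    ∃ c d : ℝ, 0 < c ∧ 0 < d ∧ ∀ n : ℤ, n < 0 →
      S.nv w hN (S.co hN x n) ≤ (p : ℝ) ^ (c * (n : ℝ) + d) := by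
  choose c d hc hd h using fun i => S.coeff_decay (crd (S.const w) N hN i x)
  have hne := Finset.nonempty_range_iff.mpr hN.ne'
  refine ⟨(Finset.range N).inf' hne c, (Finset.range N).sup' hne d, ?_, ?_, fun n hn => ?_⟩
  · rw [Finset.lt_inf'_iff]; exact fun i _ => hc i
  · exact (hd 0).trans_le (Finset.le_sup' d (Finset.mem_range.mpr hN))
  · refine S.nv_le_of_abv hw hN fun i hi => ?_
    rw [S.crd_co hN _ _ hi]
    refine (h i n hn).trans (Real.rpow_le_rpow_of_exponent_le one_lt_p.le ?_)
    have h1 := Finset.inf'_le c (Finset.mem_range.mpr hi)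
    have h2 := Finset.le_sup' d (Finset.mem_range.mpr hi)
    have h3 : (n : ℝ) < 0 := by exact_mod_cast hn
    nlinarith

lemma co_surj (hw : S.IsUnif w) (hN : 0 < N) (f : ℤ → Ring' w N)
    (h1 : ∀ ε : ℝ, 0 < ε → ∃ M : ℤ, 0 ≤ M ∧ ∀ n : ℤ, M ≤ n → S.nv w hN (f n) ≤ (1 + ε) ^ n)
    (h2 : ∃ c d : ℝ, 0 < c ∧ 0 < d ∧ ∀ n : ℤ, n < 0 →
      S.nv w hN (f n) ≤ (p : ℝ) ^ (c * (n : ℝ) + d)) :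
    ∃ x, S.co hN x = f := by
  have key : ∀ i, i < N → ∀ n, S.abv (w * crd w N hN i (f n)) ≤ S.nv w hN (f n) := by
    intro i hi n
    refine le_trans ?_ (S.le_nv hN (f n) hi)
    rw [S.abv_mul, mul_comm]
    refine mul_le_mul_of_nonneg_left ?_ (S.abv_nonneg _)
    rw [← S.rho_pow hN]
    exact pow_le_pow_of_le_one (S.rho_pos hw).le (S.rho_lt_one hw hN).le hi.le
  have hex : ∀ i, ∃ y, i < N → S.coeff y = fun n => w * crd w N hN i (f n) := by
    intro i
    by_cases hi : i < N
    · obtain ⟨y, hy⟩ := S.coeff_surjective (fun n => w * crd w N hN i (f n))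
        (fun ε hε => by
          obtain ⟨M, hM0, hM⟩ := h1 ε hε
          exact ⟨M, hM0, fun n hn => (key i hi n).trans (hM n hn)⟩)
        (by
          obtain ⟨c, d, hc, hd, h⟩ := h2
          exact ⟨c, d, hc, hd, fun n hn => (key i hi n).trans (h n hn)⟩)
      exact ⟨y, fun _ => hy⟩
    · exact ⟨0, fun h => absurd h hi⟩
  choose y hy using hex
  refine ⟨∑ k ∈ Finset.range N, AdjoinRoot.of _ (S.const w⁻¹ * y k) * rt (S.const w) N ^ k, ?_⟩
  funext n
  refine KExt.ext _ N hN fun i hi => ?_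
  rw [S.crd_co hN _ _ hi, crd_sum _ N hN (fun k => S.const w⁻¹ * y k) hi, S.coeff_const_mul,
    hy i hi, ← mul_assoc, inv_mul_cancel₀ hw.1, one_mul]

lemma co_mul (hw : S.IsUnif w) (hN : 0 < N) (x y : Ring' (S.const w) N) (n : ℤ) (ε : ℝ)
    (hε : 0 < ε) : ∃ A : Finset ℤ, ∀ T : Finset ℤ, A ⊆ T →
      S.nv w hN (S.co hN (x * y) n - ∑ i ∈ T, S.co hN x i * S.co hN y (n - i)) < ε := by
  obtain ⟨Q, hQ⟩ : ∃ Q : Ring' (S.const w) N → Ring' (S.const w) N → Prop, ∀ x y, Q x y ↔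
    ∃ A : Finset ℤ, ∀ T : Finset ℤ, A ⊆ T →
      S.nv w hN (S.co hN (x * y) n - ∑ i ∈ T, S.co hN x i * S.co hN y (n - i)) < ε :=
    ⟨_, fun _ _ => Iff.rfl⟩
  have hz := (S.nv_eq_zero hw hN 0).2 rfl
  have zl : ∀ y, Q 0 y := fun y => (hQ _ _).2 ⟨∅, fun T _ => by
    simp only [zero_mul, S.co_zero, Finset.sum_const_zero, sub_self, hz, hε]⟩
  have zr : ∀ y, Q y 0 := fun y => (hQ _ _).2 ⟨∅, fun T _ => by
    simp only [mul_zero, S.co_zero, Finset.sum_const_zero, sub_self, hz, hε]⟩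
  have al : ∀ x x' y, Q x y → Q x' y → Q (x + x') y := by
    intro x x' y h h'
    obtain ⟨A, hA⟩ := (hQ _ _).1 h
    obtain ⟨A', hA'⟩ := (hQ _ _).1 h'
    refine (hQ _ _).2 ⟨A ∪ A', fun T hT => ?_⟩
    have e : S.co hN ((x + x') * y) n - ∑ i ∈ T, S.co hN (x + x') i * S.co hN y (n - i) =
        (S.co hN (x * y) n - ∑ i ∈ T, S.co hN x i * S.co hN y (n - i)) +
        (S.co hN (x' * y) n - ∑ i ∈ T, S.co hN x' i * S.co hN y (n - i)) := by
      simp only [add_mul, S.co_add, Finset.sum_add_distrib]; ring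
    rw [e]
    exact (S.nv_add_le hw hN _ _).trans_lt (max_lt (hA T (Finset.union_subset_left hT))
      (hA' T (Finset.union_subset_right hT)))
  have ar : ∀ x y y', Q x y → Q x y' → Q x (y + y') := by
    intro x y y' h h'
    obtain ⟨A, hA⟩ := (hQ _ _).1 h
    obtain ⟨A', hA'⟩ := (hQ _ _).1 h'
    refine (hQ _ _).2 ⟨A ∪ A', fun T hT => ?_⟩
    have e : S.co hN (x * (y + y')) n - ∑ i ∈ T, S.co hN x i * S.co hN (y + y') (n - i) =
        (S.co hN (x * y) n - ∑ i ∈ T, S.co hN x i * S.co hN y (n - i)) +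
        (S.co hN (x * y') n - ∑ i ∈ T, S.co hN x i * S.co hN y' (n - i)) := by
      simp only [mul_add, S.co_add, Finset.sum_add_distrib]; ring
    rw [e]
    exact (S.nv_add_le hw hN _ _).trans_lt (max_lt (hA T (Finset.union_subset_left hT))
      (hA' T (Finset.union_subset_right hT)))
  have sl : ∀ (s : Finset ℕ) (f : ℕ → Ring' (S.const w) N) y, (∀ i ∈ s, Q (f i) y) →
      Q (∑ i ∈ s, f i) y := fun s f y h =>
    Finset.sum_induction f (fun x => Q x y) (fun a b => al a b y) (zl y) h
  have sr : ∀ (s : Finset ℕ) (f : ℕ → Ring' (S.const w) N) y, (∀ i ∈ s, Q y (f i)) →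
      Q y (∑ i ∈ s, f i) := fun s f y h =>
    Finset.sum_induction f (fun x => Q y x) (fun a b => ar y a b) (zr y) h
  have hm : ∀ (a b : S.Γac) (k l : ℕ), Q (AdjoinRoot.of _ a * rt (S.const w) N ^ k)
      (AdjoinRoot.of _ b * rt (S.const w) N ^ l) := by
    intro a b k l
    obtain ⟨A, hA⟩ := S.coeff_mul a b n ε hε
    refine (hQ _ _).2 ⟨A, fun T hT => ?_⟩
    have e1 : (AdjoinRoot.of _ a * rt (S.const w) N ^ k) * (AdjoinRoot.of _ b * rt (S.const w) N ^ l)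
        = AdjoinRoot.of _ (a * b) * rt (S.const w) N ^ (k + l) := by
      rw [map_mul, pow_add]; ring
    have e2 : S.co hN ((AdjoinRoot.of _ a * rt (S.const w) N ^ k) *
        (AdjoinRoot.of _ b * rt (S.const w) N ^ l)) n -
        ∑ i ∈ T, S.co hN (AdjoinRoot.of _ a * rt (S.const w) N ^ k) i *
          S.co hN (AdjoinRoot.of _ b * rt (S.const w) N ^ l) (n - i) =
        AdjoinRoot.of _ (S.coeff (a * b) n - ∑ i ∈ T, S.coeff a i * S.coeff b (n - i)) *
          rt w N ^ (k + l) := by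
      rw [e1, S.co_mon, map_sub, sub_mul, map_sum, Finset.sum_mul]
      congr 1
      refine Finset.sum_congr rfl fun i _ => ?_
      rw [S.co_mon, S.co_mon, map_mul, pow_add]; ring
    rw [e2, S.nv_mon hw hN]
    refine lt_of_le_of_lt ?_ (hA T hT)
    exact mul_le_of_le_one_right (S.abv_nonneg _)
      (pow_le_one₀ (S.rho_pos hw).le (S.rho_lt_one hw hN).le)
  refine (hQ _ _).1 ?_
  rw [eq_sum _ N hN x, eq_sum _ N hN y]
  exact sl _ _ _ fun i _ => sr _ _ _ fun j _ => hm _ _ _ _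

lemma nv_complete (hw : S.IsUnif w) (hN : 0 < N) (f : ℕ → Ring' w N)
    (hf : ∀ ε : ℝ, 0 < ε → ∃ M, ∀ a ≥ M, ∀ b ≥ M, S.nv w hN (f a - f b) < ε) :
    ∃ x, ∀ ε : ℝ, 0 < ε → ∃ M, ∀ a ≥ M, S.nv w hN (f a - x) < ε := by
  have hc : ∀ i, ∃ x : S.F, i < N → ∀ ε : ℝ, 0 < ε → ∃ M, ∀ a ≥ M,
      S.abv (crd w N hN i (f a) - x) < ε := by
    intro i
    by_cases hi : i < N
    · obtain ⟨x, hx⟩ := S.complete (fun a => crd w N hN i (f a)) (fun ε hε => by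
        have hr := pow_pos (S.rho_pos (N := N) hw) i
        obtain ⟨M, hM⟩ := hf (ε * S.rho w N ^ i) (mul_pos hε hr)
        refine ⟨M, fun a ha b hb => ?_⟩
        have := (S.le_nv hN _ hi).trans_lt (hM a ha b hb)
        rw [map_sub] at this
        exact lt_of_mul_lt_mul_right this hr.le)
      exact ⟨x, fun _ => hx⟩
    · exact ⟨0, fun h => absurd h hi⟩
  choose c hc using hc
  refine ⟨∑ k ∈ Finset.range N, AdjoinRoot.of _ (c k) * rt w N ^ k, fun ε hε => ?_⟩
  have hM : ∀ i, ∃ M, i < N → ∀ a ≥ M, S.abv (crd w N hN i (f a) - c i) < ε := by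
    intro i
    by_cases hi : i < N
    · obtain ⟨M, hM⟩ := hc i hi ε hε
      exact ⟨M, fun _ => hM⟩
    · exact ⟨0, fun h => absurd h hi⟩
  choose M hM using hM
  refine ⟨(Finset.range N).sup M, fun a ha => ?_⟩
  rw [S.nv_lt_iff hN]
  intro i hi
  rw [map_sub, crd_sum _ N hN c hi]
  refine lt_of_le_of_lt ?_ (hM i hi a ((Finset.le_sup (f := M) (Finset.mem_range.mpr hi)).trans ha))
  exact mul_le_of_le_one_right (S.abv_nonneg _)
    (pow_le_one₀ (S.rho_pos hw).le (S.rho_lt_one hw hN).le)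

lemma nv_sum_lt (hw : S.IsUnif w) (hN : 0 < N) {α : Type*} (s : Finset α) (f : α → Ring' w N)
    {C : ℝ} (hC : 0 < C)
    (h : ∀ i ∈ s, S.nv w hN (f i) < C) : S.nv w hN (∑ i ∈ s, f i) < C := by
  induction s using Finset.induction_on with
  | empty => simpa [(S.nv_eq_zero hw hN 0).2 rfl] using hC
  | insert a s ha ih =>
    rw [Finset.sum_insert ha]
    exact (S.nv_add_le hw hN _ _).trans_lt (max_lt (h a (Finset.mem_insert_self _ _))
      (ih fun i hi => h i (Finset.mem_insert_of_mem hi)))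

lemma nv_pow (hw : S.IsUnif w) (hN : 0 < N) (x : Ring' w N) (k : ℕ) :
    S.nv w hN (x ^ k) = S.nv w hN x ^ k := by
  induction k with
  | zero =>
    have := S.nv_of hw hN 1
    rw [map_one, S.abv_one] at this
    rw [pow_zero, pow_zero, this]
  | succ k ih => rw [pow_succ, pow_succ, S.nv_mul hw hN, ih]

lemma nv_residue (hw : S.IsUnif w) (hN : 0 < N) (f : Polynomial (Ring' w N)) (hf : f.Monic)
    (hi : ∀ i, S.nv w hN (f.coeff i) ≤ 1) (hd : 0 < f.natDegree) :
    ∃ x : Ring' w N, S.nv w hN x ≤ 1 ∧ S.nv w hN (Polynomial.eval x f) < 1 := by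
  choose c hc1 hc2 using fun i => S.nv_approx hw hN (hi i)
  obtain ⟨g, hg⟩ : ∃ g : Polynomial S.F, g = ∑ i ∈ Finset.range (f.natDegree + 1),
    Polynomial.monomial i (c i) := ⟨_, rfl⟩
  have hgc : ∀ i, g.coeff i = if i < f.natDegree + 1 then c i else 0 := by
    intro i
    rw [hg, Polynomial.finset_sum_coeff]
    simp [Polynomial.coeff_monomial]
  have hlead : S.abv (c f.natDegree) = 1 := by
    have h1 := hc2 f.natDegree
    rw [show f.coeff f.natDegree = 1 from hf, ← map_one (AdjoinRoot.of _), ← map_sub,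
      S.nv_of hw hN] at h1
    rw [S.abv_sub_comm] at h1
    have := S.abv_eq_of_sub_lt (x := c f.natDegree) (y := 1) (by rwa [S.abv_one])
    rw [this, S.abv_one]
  obtain ⟨x, hx1, hx2⟩ := S.approx_root (f := g) (fun i => by
    rw [hgc]
    split_ifs
    · exact hc1 i
    · rw [S.abv_zero]; exact zero_le_one) hd (by rw [hgc, if_pos (Nat.lt_succ_self _), hlead])
  refine ⟨AdjoinRoot.of _ x, by rwa [S.nv_of hw hN], ?_⟩
  have e : Polynomial.eval (AdjoinRoot.of _ x) f = (∑ i ∈ Finset.range (f.natDegree + 1),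
      (f.coeff i - AdjoinRoot.of _ (c i)) * (AdjoinRoot.of _ x) ^ i) +
      AdjoinRoot.of _ (Polynomial.eval x g) := by
    rw [Polynomial.eval_eq_sum_range, hg, Polynomial.eval_finset_sum, map_sum,
      ← Finset.sum_add_distrib]
    refine Finset.sum_congr rfl fun i _ => ?_
    rw [Polynomial.eval_monomial, map_mul, map_pow]; ring
  rw [e]
  refine (S.nv_add_le hw hN _ _).trans_lt (max_lt ?_ (by rwa [S.nv_of hw hN]))
  refine S.nv_sum_lt hw hN _ _ one_pos fun i _ => ?_
  rw [S.nv_mul hw hN, S.nv_pow hw hN, S.nv_of hw hN]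
  exact (mul_le_of_le_one_right (S.nv_nonneg hw hN _)
    (pow_le_one₀ (S.abv_nonneg _) hx1)).trans_lt (hc2 i)

lemma ksig_frob (hw : S.IsUnif w) (hσ : S.σF w = w) (hN : 0 < N) (x : Ring' w N)
    (hx : S.nv w hN x ≤ 1) : S.nv w hN (S.ksig hσ N x - x ^ p) < 1 := by
  obtain ⟨y, hy1, hy2⟩ := S.nv_approx hw hN hx
  obtain ⟨q, hq⟩ := sub_dvd_pow_sub_pow (AdjoinRoot.of _ y : Ring' w N) x p
  have hsub : ∀ a b : Ring' w N, S.nv w hN (a - b) ≤ max (S.nv w hN a) (S.nv w hN b) := by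
    intro a b
    rw [sub_eq_add_neg, ← S.nv_neg hN b]
    exact S.nv_add_le hw hN _ _
  have e : S.ksig hσ N x - x ^ p = S.ksig hσ N (x - AdjoinRoot.of _ y) +
      (AdjoinRoot.of _ (S.σF y - y ^ p) + ((AdjoinRoot.of _ y) ^ p - x ^ p)) := by
    rw [map_sub (S.ksig hσ N), map_sub, map_pow, show S.ksig hσ N (AdjoinRoot.of _ y) =
      AdjoinRoot.of _ (S.σF y) from KExt.map_of N _ _ y]
    ring
  rw [e]
  refine (S.nv_add_le hw hN _ _).trans_lt (max_lt (by rwa [S.nv_ksig]) ?_)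
  refine (S.nv_add_le hw hN _ _).trans_lt (max_lt (by rw [S.nv_of hw hN]; exact S.σF_frob y hy1) ?_)
  rw [← (Commute.all (AdjoinRoot.of _ y : Ring' w N) x).geom_sum₂_mul p, S.nv_mul hw hN]
  have h1 : S.nv w hN (∑ i ∈ Finset.range p, (AdjoinRoot.of _ y : Ring' w N) ^ i * x ^ (p - 1 - i)) ≤ 1 := by
    refine S.nv_sum_le hw hN _ _ zero_le_one fun i _ => ?_
    rw [S.nv_mul hw hN, S.nv_pow hw hN, S.nv_pow hw hN, S.nv_of hw hN]
    exact mul_le_one₀ (pow_le_one₀ (S.abv_nonneg _) hy1) (pow_nonneg (S.nv_nonneg hw hN _) _)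
      (pow_le_one₀ (S.nv_nonneg hw hN _) hx)
  have h2 : S.nv w hN (AdjoinRoot.of _ y - x) < 1 := by rwa [← S.nv_neg, neg_sub]
  calc _ ≤ 1 * S.nv w hN (AdjoinRoot.of _ y - x) :=
        mul_le_mul_of_nonneg_right h1 (S.nv_nonneg hw hN _)
    _ < 1 := by rwa [one_mul]

end ExtCoeff
end AnSetting


namespace AnSetting

section ExtBuild
variable {p : ℕ} [hp : Fact p.Prime] (S : AnSetting p) {w : S.F} {N : ℕ}

open KExt

lemma ksig_bij (hw : S.IsUnif w) (hσ : S.σF w = w) (hN : 0 < N) :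
    Function.Bijective (S.ksig hσ N) := by
  constructor
  · rw [injective_iff_map_eq_zero]
    intro x hx
    rw [← S.nv_eq_zero hw hN, ← S.nv_ksig hσ hN, hx]
    exact (S.nv_eq_zero hw hN 0).2 rfl
  · exact KExt.map_surj N _ _ S.σF.surjective

lemma ksig_of (hσ : S.σF w = w) (x : S.F) :
    S.ksig hσ N (AdjoinRoot.of _ x) = AdjoinRoot.of _ (S.σF x) := KExt.map_of N _ _ x

lemma ksig_rt (hσ : S.σF w = w) : S.ksig hσ N (rt w N) = rt w N := KExt.map_rt N _ _

lemma kfrob_of (hσ : S.σF w = w) (x : S.Γac) :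
    S.kfrob hσ N (AdjoinRoot.of _ x) = AdjoinRoot.of _ (S.frob x) := KExt.map_of N _ _ x

/-- The extended setting. -/
noncomputable def kset (hw : S.IsUnif w) (hσ : S.σF w = w) (hN : 0 < N) : AnSetting p where
  F := Ring' w N
  fieldF := S.kextField hw hN
  abv := S.nv w hN
  abv_nonneg := S.nv_nonneg hw hN
  abv_eq_zero := S.nv_eq_zero hw hN
  abv_mul := S.nv_mul hw hN
  abv_add_le := S.nv_add_le hw hN
  abv_p := by
    have h := S.nv_of hw hN (p : S.F)
    rw [map_natCast, S.abv_p] at h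
    exact h
  m := S.m * N
  m_pos := Nat.mul_pos S.m_pos hN
  abv_discrete := fun x hx => S.nv_discrete hw hN hx
  complete := S.nv_complete hw hN
  residue_algClosed := S.nv_residue hw hN
  σF := RingEquiv.ofBijective (S.ksig hσ N) (S.ksig_bij hw hσ hN)
  abv_σF := S.nv_ksig hσ hN
  σF_frob := S.ksig_frob hw hσ hN
  Γac := Ring' (S.const w) N
  commΓac := inferInstance
  coeff := S.co hN
  coeff_injective := S.co_inj hN
  coeff_add := S.co_add hN
  coeff_growth := S.co_growth hw hN
  coeff_decay := S.co_decay hw hN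
  coeff_surjective := S.co_surj hw hN
  coeff_one := fun i => by
    have h := S.co_of (w := w) hN 1 i
    rw [map_one, S.coeff_one] at h
    rw [h]
    split_ifs
    · exact map_one _
    · exact map_zero _
  t := AdjoinRoot.of _ S.t
  coeff_t := fun i => by
    rw [S.co_of (w := w) hN, S.coeff_t]
    split_ifs
    · exact map_one _
    · exact map_zero _
  const := S.kconst w N
  coeff_const := S.co_const hN
  coeff_mul := S.co_mul hw hN
  frob := S.kfrob hσ N
  coeff_frob := S.co_frob hσ hN

/-- The extension. -/
noncomputable def kext (hw : S.IsUnif w) (hσ : S.σF w = w) (hN : 0 < N) : AnExt p S where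
  T := S.kset hw hσ hN
  ι := (AdjoinRoot.of _ : S.F →+* Ring' w N)
  abv_ι := S.nv_of hw hN
  σ_ι := fun x => S.ksig_of hσ x
  finite := ⟨N, fun i => rt w N ^ (i : ℕ), fun y => ⟨fun i => crd w N hN i y, by
    have h := eq_sum w N hN y
    rw [Finset.sum_range] at h
    exact h⟩⟩
  totallyRamified := fun y hy => S.nv_approx hw hN hy
  j := AdjoinRoot.of _
  coeff_j := S.co_of hN
  frob_j := fun x => S.kfrob_of hσ x

theorem exists_root_ext (hw : S.IsUnif w) (hσ : S.σF w = w) (hN : 0 < N) :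
    ∃ (E : AnExt p S) (Y : E.T.F), Y ^ N = E.ι w ∧ E.T.σF Y = Y :=
  ⟨S.kext hw hσ hN, (show (S.kset hw hσ hN).F from (rt w N : Ring' w N)), rt_pow w N, S.ksig_rt hσ⟩

end ExtBuild
end AnSetting

namespace AnExt
variable {p : ℕ} [hp : Fact p.Prime]

/-- The trivial extension. -/
noncomputable def self (S : AnSetting p) : AnExt p S where
  T := S
  ι := RingHom.id _
  abv_ι := fun _ => rfl
  σ_ι := fun _ => rfl
  finite := ⟨1, fun _ => 1, fun y => ⟨fun _ => y, by simp⟩⟩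
  totallyRamified := fun y hy => ⟨y, hy, by simp [S.abv_zero]⟩
  j := RingHom.id _
  coeff_j := fun _ _ => rfl
  frob_j := fun _ => rfl

/-- Composition of extensions. -/
noncomputable def trans {S : AnSetting p} (E : AnExt p S) (E' : AnExt p E.T) : AnExt p S where
  T := E'.T
  ι := E'.ι.comp E.ι
  abv_ι := fun x => (E'.abv_ι _).trans (E.abv_ι x)
  σ_ι := fun x => by rw [RingHom.comp_apply, E'.σ_ι, E.σ_ι]; rfl
  finite := by
    obtain ⟨n, b, hb⟩ := E.finite
    obtain ⟨n', b', hb'⟩ := E'.finite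
    refine ⟨n * n', fun k => E'.ι (b (finProdFinEquiv.symm k).1) * b' (finProdFinEquiv.symm k).2, ?_⟩
    intro y
    obtain ⟨a', ha'⟩ := hb' y
    choose a ha using fun i => hb (a' i)
    refine ⟨fun k => a (finProdFinEquiv.symm k).2 (finProdFinEquiv.symm k).1, ?_⟩
    rw [Equiv.sum_comp finProdFinEquiv.symm (fun q : Fin n × Fin n' => (E'.ι.comp E.ι) (a q.2 q.1) *
      (E'.ι (b q.1) * b' q.2)), Fintype.sum_prod_type, Finset.sum_comm, ha']
    refine Finset.sum_congr rfl fun i _ => ?_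
    conv_lhs => rw [ha i, map_sum, Finset.sum_mul]
    refine Finset.sum_congr rfl fun k _ => ?_
    rw [map_mul, RingHom.comp_apply, mul_assoc]
  totallyRamified := fun y hy => by
    obtain ⟨x', h1, h2⟩ := E'.totallyRamified y hy
    obtain ⟨x, h3, h4⟩ := E.totallyRamified x' h1
    refine ⟨x, h3, ?_⟩
    have e : y - (E'.ι.comp E.ι) x = (y - E'.ι x') + E'.ι (x' - E.ι x) := by
      rw [map_sub]; simp
    rw [e]
    exact E'.T.abv_add_lt h2 (by rwa [E'.abv_ι])
  j := E'.j.comp E.j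
  coeff_j := fun x n => by rw [RingHom.comp_apply, E'.coeff_j, E.coeff_j]; rfl
  frob_j := fun x => by rw [RingHom.comp_apply, E'.frob_j, E.frob_j]; rfl

end AnExt


namespace AnSetting

lemma exists_cyclic {K V : Type} [Field K] [AddCommGroup V] [Module K V] [FiniteDimensional K V]
    (v : ℕ → V) (hv : v 0 ≠ 0) : ∃ s, (∃ b : ℕ → K, v (s + 1) =
      ∑ j ∈ Finset.range (s + 1), b j • v j) ∧ v s ∉ Submodule.span K (v '' Set.Iio s) := by
  have hex : ∃ r, v r ∈ Submodule.span K (v '' Set.Iio r) := by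
    let W : ℕ →o Submodule K V := ⟨fun r => Submodule.span K (v '' Set.Iio r),
      fun a b hab => Submodule.span_mono (Set.image_mono (Set.Iio_subset_Iio hab))⟩
    obtain ⟨r, hr⟩ := monotone_stabilizes_iff_noetherian.2
      (inferInstance : IsNoetherian K V) W
    refine ⟨r, ?_⟩
    have h1 : v r ∈ W (r + 1) := Submodule.subset_span ⟨r, Nat.lt_succ_self r, rfl⟩
    rw [← hr (r + 1) (Nat.le_succ r)] at h1
    exact h1
  obtain ⟨r, hr, hmin⟩ : ∃ r, v r ∈ Submodule.span K (v '' Set.Iio r) ∧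
      ∀ k < r, v k ∉ Submodule.span K (v '' Set.Iio k) :=
    ⟨Nat.find hex, Nat.find_spec hex, fun k hk => Nat.find_min hex hk⟩
  rcases r with _ | s
  · exfalso
    have h0 : v '' Set.Iio 0 = ∅ := by simp
    rw [h0, Submodule.span_empty, Submodule.mem_bot] at hr
    exact hv hr
  · refine ⟨s, ?_, hmin s (Nat.lt_succ_self s)⟩
    have h1 : v '' Set.Iio (s + 1) = Set.range (fun j : Fin (s + 1) => v j) := by
      ext z
      constructor
      · rintro ⟨j, hj, rfl⟩; exact ⟨⟨j, hj⟩, rfl⟩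
      · rintro ⟨j, rfl⟩; exact ⟨j, j.2, rfl⟩
    rw [h1, Submodule.mem_span_range_iff_exists_fun] at hr
    obtain ⟨c, hc⟩ := hr
    refine ⟨fun j => if h : j < s + 1 then c ⟨j, h⟩ else 0, ?_⟩
    rw [← hc, Finset.sum_range]
    exact Finset.sum_congr rfl fun i _ => by
      dsimp only; rw [dif_pos i.2]

section Eigen
variable {p : ℕ} [hp : Fact p.Prime] (S : AnSetting p)

lemma iter_mul (k : ℕ) (x y : S.F) : S.σF^[k] (x * y) = S.σF^[k] x * S.σF^[k] y := by
  induction k generalizing x y with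
  | zero => rfl
  | succ k ih => rw [Function.iterate_succ_apply, Function.iterate_succ_apply,
      Function.iterate_succ_apply, map_mul, ih]

lemma eigen_rec (b : ℕ → S.F) (l y : S.F) (hl : S.σF l = l) :
    ∃ x : ℕ → S.F, x 0 = l⁻¹ * (b 0 * S.σF y) ∧
      (∀ j, x (j + 1) = l⁻¹ * (S.σF (x j) + b (j + 1) * S.σF y)) ∧
      ∀ j, x j = ∑ i ∈ Finset.range (j + 1), l⁻¹ ^ (i + 1) * S.σF^[i] (b (j - i)) *
        S.σF^[i + 1] y := by
  have hl' : S.σF l⁻¹ = l⁻¹ := by rw [map_inv₀, hl]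
  let x : ℕ → S.F := fun j => Nat.rec (l⁻¹ * (b 0 * S.σF y))
    (fun j xj => l⁻¹ * (S.σF xj + b (j + 1) * S.σF y)) j
  have h0 : x 0 = l⁻¹ * (b 0 * S.σF y) := rfl
  have h1 : ∀ j, x (j + 1) = l⁻¹ * (S.σF (x j) + b (j + 1) * S.σF y) := fun j => rfl
  refine ⟨x, h0, h1, fun j => ?_⟩
  induction j with
  | zero => rw [h0]; simp [mul_assoc]
  | succ j ih =>
    rw [h1, ih, Finset.sum_range_succ' _ (j + 1), map_sum, mul_add, Finset.mul_sum]
    congr 1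
    · refine Finset.sum_congr rfl fun i hi => ?_
      rw [map_mul, map_mul, map_pow, hl', Nat.add_sub_add_right]
      simp only [Function.iterate_succ_apply', pow_succ]
      ring
    · simp [mul_assoc]

lemma eigen_of_cyclic {M : Type} [AddCommGroup M] [Module S.F M] (Ψ : M →+ M)
    (hΨ : ∀ (c : S.F) z, Ψ (c • z) = S.σF c • Ψ z) (V : ℕ → M) (hV : ∀ j, Ψ (V j) = V (j + 1))
    (s : ℕ) (b : ℕ → S.F) (hb : V (s + 1) = ∑ j ∈ Finset.range (s + 1), b j • V j)
    (l : S.F) (hl0 : l ≠ 0) (hl : S.σF l = l)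
    (hle : ∀ k, 1 ≤ k → k ≤ s + 1 → S.abv (b (s + 1 - k)) ≤ S.abv l ^ k)
    (heq : ∃ k, 1 ≤ k ∧ k ≤ s + 1 ∧ S.abv (b (s + 1 - k)) = S.abv l ^ k) :
    ∃ x : ℕ → S.F, x s ≠ 0 ∧ Ψ (∑ j ∈ Finset.range (s + 1), x j • V j) =
      l • ∑ j ∈ Finset.range (s + 1), x j • V j := by
  obtain ⟨β, hβ⟩ : ∃ β : ℕ → S.F, ∀ k, β k = if k = 0 then 1 else
    -(l⁻¹ ^ k * S.σF^[k - 1] (b (s + 1 - k))) := ⟨_, fun _ => rfl⟩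
  have hβ0 : β 0 = 1 := by rw [hβ, if_pos rfl]
  have hlp := S.abv_pos hl0
  have hβa : ∀ k, 1 ≤ k → S.abv (β k) = (S.abv l ^ k)⁻¹ * S.abv (b (s + 1 - k)) := by
    intro k hk
    rw [hβ, if_neg (by omega), S.abv_neg, S.abv_mul, S.abv_pow, S.abv_inv, S.abv_iter, inv_pow]
  obtain ⟨k0, hk1, hk2, hk3⟩ := heq
  obtain ⟨y, hy0, -, hy⟩ := S.Lop_kernel (n := s + 1) (β := β) (k := k0) (by
      intro k hk
      rcases Nat.eq_zero_or_pos k with rfl | hk'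
      · rw [hβ0, S.abv_one]
      · rw [hβa k hk', inv_mul_le_iff₀ (pow_pos hlp _), mul_one]
        exact hle k hk' hk)
    (by rw [hβ0, S.abv_one]) hk1 hk2 (by
      rw [hβa k0 hk1, hk3, inv_mul_cancel₀ (pow_pos hlp _).ne'])
  obtain ⟨x, hx0, hx1, hx⟩ := S.eigen_rec b l y hl
  have hxs : x s = y := by
    rw [hx]
    rw [Lop, Finset.sum_range_succ', hβ0] at hy
    have : ∑ i ∈ Finset.range (s + 1), l⁻¹ ^ (i + 1) * S.σF^[i] (b (s - i)) * S.σF^[i + 1] y =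
        - ∑ k ∈ Finset.range (s + 1), β (k + 1) * S.σF^[k + 1] y := by
      rw [← Finset.sum_neg_distrib]
      refine Finset.sum_congr rfl fun i _ => ?_
      rw [hβ, if_neg (Nat.succ_ne_zero i), show s + 1 - (i + 1) = s - i by omega,
        show i + 1 - 1 = i from rfl]
      ring
    rw [this]
    have h2 : S.σF^[0] y = y := rfl
    rw [h2, one_mul] at hy
    linear_combination -hy
  refine ⟨x, by rwa [hxs], ?_⟩
  rw [map_sum]
  simp only [hΨ, hV]
  rw [Finset.sum_range_succ, hb, hxs, Finset.smul_sum, Finset.smul_sum,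
    Finset.sum_range_succ' (fun j => S.σF y • b j • V j),
    Finset.sum_range_succ' (fun j => l • x j • V j), ← add_assoc, ← Finset.sum_add_distrib]
  congr 1
  · refine Finset.sum_congr rfl fun j _ => ?_
    rw [hx1, smul_smul, smul_smul, ← add_smul, ← mul_assoc, mul_inv_cancel₀ hl0, one_mul,
      mul_comm (b (j + 1))]
  · rw [hx0, smul_smul, smul_smul, ← mul_assoc, mul_inv_cancel₀ hl0, one_mul, mul_comm]

/-- The semilinear map attached to a matrix. -/
def semi {ι : Type} [Fintype ι] (A : Matrix ι ι S.F) : (ι → S.F) →+ (ι → S.F) where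
  toFun x := A.mulVec (fun i => S.σF (x i))
  map_zero' := by
    have : (fun i : ι => S.σF ((0 : ι → S.F) i)) = 0 := by funext i; simp
    rw [this, Matrix.mulVec_zero]
  map_add' x y := by
    have : (fun i : ι => S.σF ((x + y) i)) = (fun i => S.σF (x i)) + (fun i => S.σF (y i)) := by
      funext i; simp
    rw [this, Matrix.mulVec_add]

lemma semi_apply {ι : Type} [Fintype ι] (A : Matrix ι ι S.F) (x : ι → S.F) :
    S.semi A x = A.mulVec (fun i => S.σF (x i)) := rfl

lemma semi_smul {ι : Type} [Fintype ι] (A : Matrix ι ι S.F) (c : S.F) (x : ι → S.F) :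
    S.semi A (c • x) = S.σF c • S.semi A x := by
  rw [semi_apply, semi_apply, ← Matrix.mulVec_smul]
  congr 1
  funext i
  simp

lemma semi_inj {ι : Type} [Fintype ι] [DecidableEq ι] (A : Matrix ι ι S.F) (hA : A.det ≠ 0) (x : ι → S.F)
    (h : S.semi A x = 0) : x = 0 := by
  rw [semi_apply] at h
  have := Matrix.eq_zero_of_mulVec_eq_zero hA h
  funext i
  have h2 := congrFun this i
  simpa using h2

theorem exists_eigen {n : ℕ} (hn : 0 < n) (A : Matrix (Fin n) (Fin n) S.F) (hA : A.det ≠ 0) :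
    ∃ (E : AnExt p S) (l : E.T.F) (u : Fin n → E.T.F), l ≠ 0 ∧ u ≠ 0 ∧
      E.T.semi (A.map E.ι) u = l • u := by
  obtain ⟨v, hv0, hv⟩ : ∃ v : ℕ → Fin n → S.F, v 0 = Pi.single ⟨0, hn⟩ 1 ∧
      ∀ j, v (j + 1) = S.semi A (v j) :=
    ⟨fun j => (S.semi A)^[j] (Pi.single ⟨0, hn⟩ 1), rfl,
      fun j => Function.iterate_succ_apply' _ _ _⟩
  have hvne : ∀ j, v j ≠ 0 := by
    intro j
    induction j with
    | zero =>
      rw [hv0]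
      intro h
      have := congrFun h ⟨0, hn⟩
      simp at this
    | succ j ih => rw [hv]; exact fun h => ih (S.semi_inj A hA _ h)
  obtain ⟨s, ⟨b, hb⟩, hmin⟩ := exists_cyclic (K := S.F) v (hvne 0)
  obtain ⟨g, hg1, hg2⟩ : ∃ g : Fin n → S.F, dotProduct (v s) g ≠ 0 ∧
      ∀ j < s, dotProduct (v j) g = 0 := by
    obtain ⟨f, hf1, hf2⟩ := Submodule.exists_le_ker_of_notMem hmin
    have hfg : ∀ x, f x = dotProduct x (fun i => f (Pi.single i 1)) := fun x => by
      rw [LinearMap.pi_apply_eq_sum_univ f x]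
      refine Finset.sum_congr rfl fun i _ => ?_
      rw [smul_eq_mul]
      congr 2
      funext k
      rw [Pi.single_apply]
      simp only [eq_comm]
    refine ⟨fun i => f (Pi.single i 1), by rwa [← hfg], fun j hj => ?_⟩
    rw [← hfg]
    exact hf2 (Submodule.subset_span ⟨j, hj, rfl⟩)
  obtain ⟨k0, hk0, hmax⟩ := Finset.exists_max_image (Finset.Icc 1 (s + 1))
    (fun k => S.abv (b (s + 1 - k)) ^ ((1 : ℝ) / k)) ⟨1, by simp⟩
  rw [Finset.mem_Icc] at hk0
  have hroot : ∀ (z : ℝ) (k : ℕ), 0 ≤ z → 1 ≤ k → (z ^ ((1 : ℝ) / k)) ^ k = z := by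
    intro z k hz hk
    rw [← Real.rpow_natCast, ← Real.rpow_mul hz, one_div,
      inv_mul_cancel₀ (by exact_mod_cast (by omega : k ≠ 0)), Real.rpow_one]
  have hbne : b (s + 1 - k0) ≠ 0 := by
    intro h0
    apply hvne (s + 1)
    rw [hb]
    refine Finset.sum_eq_zero fun j hj => ?_
    have hj' := Finset.mem_range.mp hj
    have h1 := hmax (s + 1 - j) (Finset.mem_Icc.mpr ⟨by omega, by omega⟩)
    rw [h0, S.abv_zero, Real.zero_rpow (by
      have : (k0 : ℝ) ≠ 0 := by exact_mod_cast (by omega : k0 ≠ 0)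
      exact one_div_ne_zero this), show s + 1 - (s + 1 - j) = j by omega] at h1
    have h2 := hroot (S.abv (b j)) (s + 1 - j) (S.abv_nonneg _) (by omega)
    have h3 : S.abv (b j) ^ ((1 : ℝ) / (s + 1 - j : ℕ)) = 0 :=
      le_antisymm h1 (Real.rpow_nonneg (S.abv_nonneg _) _)
    rw [h3, zero_pow (by omega)] at h2
    rw [(S.abv_eq_zero _).1 h2.symm, zero_smul]
  obtain ⟨w, hw, hσ⟩ := S.exists_fixed_unif
  obtain ⟨e, he⟩ := hw.2.2 _ hbne
  obtain ⟨E, Y, hY1, hY2⟩ := S.exists_root_ext hw hσ (N := k0) (by omega)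
  have hY0 : Y ≠ 0 := by
    rintro rfl
    rw [zero_pow (by omega)] at hY1
    exact hw.1 ((map_eq_zero E.ι).1 hY1.symm)
  have hYa : E.T.abv Y ^ k0 = S.abv w := by rw [← E.T.abv_pow, hY1, E.abv_ι]
  have hla : E.T.abv (Y ^ e) ^ k0 = S.abv (b (s + 1 - k0)) := by
    rw [he, ← hYa, E.T.abv_zpow, ← zpow_natCast, ← zpow_natCast, ← zpow_mul, ← zpow_mul, mul_comm]
  have hla' : E.T.abv (Y ^ e) = S.abv (b (s + 1 - k0)) ^ ((1 : ℝ) / k0) := by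
    refine (pow_left_inj₀ (E.T.abv_nonneg _) (Real.rpow_nonneg (S.abv_nonneg _) _)
      (by omega : k0 ≠ 0)).1 ?_
    rw [hla, hroot _ _ (S.abv_nonneg _) hk0.1]
  obtain ⟨x, hx1, hx2⟩ := E.T.eigen_of_cyclic (E.T.semi (A.map E.ι)) (E.T.semi_smul _)
    (fun j i => E.ι (v j i)) (by
      intro j
      funext i
      rw [hv, semi_apply, semi_apply]
      simp only [Matrix.mulVec, dotProduct, Matrix.map_apply, map_sum, map_mul, E.σ_ι]) s
    (fun j => E.ι (b j)) (by
      funext i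
      have := congrArg E.ι (congrFun hb i)
      rw [this, Finset.sum_apply, Finset.sum_apply, map_sum]
      refine Finset.sum_congr rfl fun j _ => ?_
      rw [Pi.smul_apply, Pi.smul_apply, smul_eq_mul, smul_eq_mul, map_mul])
    (Y ^ e) (zpow_ne_zero _ hY0) (by rw [map_zpow₀, hY2])
    (by
      intro k h1 h2
      rw [E.abv_ι, hla', ← hroot (S.abv (b (s + 1 - k))) k (S.abv_nonneg _) h1]
      exact pow_le_pow_left₀ (Real.rpow_nonneg (S.abv_nonneg _) _)
        (hmax k (Finset.mem_Icc.mpr ⟨h1, h2⟩)) k)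
    ⟨k0, hk0.1, hk0.2, by rw [E.abv_ι, hla]⟩
  refine ⟨E, Y ^ e, _, zpow_ne_zero _ hY0, ?_, hx2⟩
  intro h0
  apply hx1
  have h3 : dotProduct (∑ j ∈ Finset.range (s + 1), x j • fun i => E.ι (v j i))
      (fun i => E.ι (g i)) = x s * E.ι (dotProduct (v s) g) := by
    have h4 : ∀ j, dotProduct (x j • fun i => E.ι (v j i)) (fun i => E.ι (g i)) =
        x j * E.ι (dotProduct (v j) g) := by
      intro j
      rw [smul_dotProduct, smul_eq_mul]
      simp only [dotProduct, map_sum, map_mul]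
    rw [sum_dotProduct, Finset.sum_range_succ, h4, Finset.sum_eq_zero, zero_add]
    intro j hj
    rw [h4, hg2 j (Finset.mem_range.mp hj), map_zero, mul_zero]
  rw [h0, zero_dotProduct] at h3
  rcases mul_eq_zero.mp h3.symm with h | h
  · exact h
  · exact absurd ((map_eq_zero E.ι).1 h) hg1

end Eigen
end AnSetting


namespace AnSetting

lemma exists_complete_col {K : Type} [Field K] {n : ℕ} (u : Fin (n + 1) → K) (hu : u ≠ 0) :
    ∃ B : Matrix (Fin (n + 1)) (Fin (n + 1)) K, B.det ≠ 0 ∧ ∀ i, B i 0 = u i := by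
  obtain ⟨i0, hi0⟩ := Function.ne_iff.mp hu
  refine ⟨((1 : Matrix (Fin (n + 1)) (Fin (n + 1)) K).updateCol i0 u).submatrix id
    (Equiv.swap 0 i0), ?_, fun i => ?_⟩
  · rw [Matrix.det_permute']
    refine mul_ne_zero ?_ ?_
    · rcases Int.units_eq_one_or (Equiv.Perm.sign (Equiv.swap 0 i0)) with h | h <;> rw [h] <;> simp
    · rw [← Matrix.cramer_apply, Matrix.cramer_one]
      exact hi0
  · simp

lemma det_col_zero {K : Type} [Field K] {n : ℕ} (M : Matrix (Fin (n + 1)) (Fin (n + 1)) K)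
    (h : ∀ i : Fin n, M i.succ 0 = 0) :
    M.det = M 0 0 * (M.submatrix Fin.succ Fin.succ).det := by
  rw [Matrix.det_succ_column_zero, Fin.sum_univ_succ, Finset.sum_eq_zero, add_zero]
  · simp
  · intro i _
    rw [h i]; simp

theorem dieudonne_manin {p : ℕ} [hp : Fact p.Prime] (n : ℕ) : ∀ (S : AnSetting p)
    (A : Matrix (Fin n) (Fin n) S.F), A.det ≠ 0 →
    ∃ (E : AnExt p S) (P : Matrix (Fin n) (Fin n) E.T.F) (c : Fin n → E.T.F),
      P.det ≠ 0 ∧ (∀ i, c i ≠ 0) ∧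
      A.map E.ι * P.map E.T.σF = P * Matrix.diagonal c := by
  induction n with
  | zero =>
    intro S A _
    exact ⟨AnExt.self S, 1, 0, by simp, fun i => i.elim0, by ext i; exact i.elim0⟩
  | succ n ih =>
    intro S A hA
    obtain ⟨E1, l, u, hl, hu, hAu⟩ := S.exists_eigen (Nat.succ_pos n) A hA
    obtain ⟨B, hB, hBu⟩ := exists_complete_col u hu
    have hBinv : B * B⁻¹ = 1 := Matrix.mul_nonsing_inv B (isUnit_iff_ne_zero.mpr hB)
    have hBinv' : B⁻¹ * B = 1 := Matrix.nonsing_inv_mul B (isUnit_iff_ne_zero.mpr hB)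
    obtain ⟨A1, hA1⟩ : ∃ A1, A1 = B⁻¹ * (A.map E1.ι * B.map E1.T.σF) := ⟨_, rfl⟩
    have hBA1 : A.map E1.ι * B.map E1.T.σF = B * A1 := by
      rw [hA1, ← Matrix.mul_assoc, hBinv, Matrix.one_mul]
    have hcol : ∀ i, A1 i 0 = if i = 0 then l else 0 := by
      intro i
      have h1 : ∀ i, (A.map E1.ι * B.map E1.T.σF) i 0 = l * u i := by
        intro i
        have h2 := congrFun hAu i
        rw [semi_apply, Pi.smul_apply, smul_eq_mul] at h2
        rw [← h2, Matrix.mul_apply]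
        refine Finset.sum_congr rfl fun k _ => ?_
        rw [Matrix.map_apply, Matrix.map_apply, hBu]; rfl
      have h3 := congrFun (congrFun hBinv' i) 0
      rw [hA1, Matrix.mul_apply]
      simp only [h1]
      rw [Matrix.mul_apply, Matrix.one_apply] at h3
      simp only [hBu] at h3
      have h4 : ∑ k, B⁻¹ i k * (l * u k) = l * ∑ k, B⁻¹ i k * u k := by
        rw [Finset.mul_sum]
        exact Finset.sum_congr rfl fun k _ => by ring
      rw [h4, h3]
      simp
    have hA1d : A1.det ≠ 0 := by
      intro h0
      have h1 := congrArg Matrix.det hBA1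
      rw [Matrix.det_mul, Matrix.det_mul, h0, mul_zero] at h1
      have e1 : (A.map E1.ι).det = E1.ι A.det := (RingHom.map_det E1.ι A).symm
      have e2 : (B.map E1.T.σF).det = E1.T.σF B.det :=
        (RingHom.map_det (E1.T.σF : E1.T.F →+* E1.T.F) B).symm
      rw [e1, e2] at h1
      rcases mul_eq_zero.mp h1 with h | h
      · exact hA ((map_eq_zero E1.ι).1 h)
      · exact hB ((map_eq_zero E1.T.σF).1 h)
    have hd2 : (A1.submatrix Fin.succ Fin.succ).det ≠ 0 := by
      intro h0
      apply hA1d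
      rw [det_col_zero A1 (fun i => by rw [hcol, if_neg (Fin.succ_ne_zero i)]), h0, mul_zero]
    obtain ⟨E2, P2, c2, hP2, hc2, hAP⟩ := ih E1.T (A1.submatrix Fin.succ Fin.succ) hd2
    have hy : ∀ j, ∃ y, c2 j * y = E2.ι l * E2.T.σF y +
        ∑ k : Fin n, E2.ι (A1 0 k.succ) * E2.T.σF (P2 k j) := by
      intro j
      obtain ⟨y, hy⟩ := E2.T.Lop_surj (n := 1)
        (β := fun k => if k = 0 then c2 j else -E2.ι l) ⟨0, Nat.zero_le _, by simpa using hc2 j⟩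
        (∑ k : Fin n, E2.ι (A1 0 k.succ) * E2.T.σF (P2 k j))
      refine ⟨y, ?_⟩
      rw [← hy, Lop, Finset.sum_range_succ, Finset.sum_range_one]
      simp
    choose y hy using hy
    obtain ⟨P1, hP1⟩ : ∃ P1 : Matrix (Fin (n + 1)) (Fin (n + 1)) E2.T.F,
      P1 = Matrix.of (Fin.cons (Fin.cons 1 y) (fun i => Fin.cons 0 (P2 i))) := ⟨_, rfl⟩
    have p00 : P1 0 0 = 1 := by rw [hP1]; rfl
    have p0s : ∀ j : Fin n, P1 0 j.succ = y j := by intro j; rw [hP1]; rfl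
    have ps0 : ∀ j : Fin n, P1 j.succ 0 = 0 := by intro j; rw [hP1]; rfl
    have pss : ∀ i j : Fin n, P1 i.succ j.succ = P2 i j := by intro i j; rw [hP1]; rfl
    have hP1d : P1.det ≠ 0 := by
      rw [det_col_zero P1 ps0, p00, one_mul]
      have : P1.submatrix Fin.succ Fin.succ = P2 := by ext i j; exact pss i j
      rwa [this]
    have hmain : A1.map E2.ι * P1.map E2.T.σF =
        P1 * Matrix.diagonal (Fin.cons (E2.ι l) c2 : Fin (n + 1) → E2.T.F) := by
      ext i j
      rw [Matrix.mul_diagonal, Matrix.mul_apply, Fin.sum_univ_succ]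
      simp only [Matrix.map_apply, hcol]
      refine Fin.cases ?_ (fun i => ?_) i <;> refine Fin.cases ?_ (fun j => ?_) j
      · simp [p00, ps0]
      · simp only [if_true, p0s, pss, Fin.cons_succ]
        rw [mul_comm (y j), hy j]
      · simp [p00, ps0]
      · have h1 := congrFun (congrFun hAP i) j
        rw [Matrix.mul_diagonal, Matrix.mul_apply] at h1
        simp only [Matrix.map_apply, Matrix.submatrix_apply] at h1
        simp only [pss, Fin.cons_succ, if_neg (Fin.succ_ne_zero i), map_zero, zero_mul, zero_add]
        exact h1
    refine ⟨E1.trans E2, B.map E2.ι * P1, Fin.cons (E2.ι l) c2, ?_, ?_, ?_⟩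
    · change (B.map E2.ι * P1).det ≠ 0
      rw [Matrix.det_mul]
      refine mul_ne_zero ?_ hP1d
      rw [show (B.map E2.ι).det = E2.ι B.det from (RingHom.map_det E2.ι B).symm]
      exact fun h => hB ((map_eq_zero E2.ι).1 h)
    · refine Fin.cases ?_ ?_
      · exact fun h => hl ((map_eq_zero E2.ι).1 h)
      · exact hc2
    · have e1 : A.map (E2.ι.comp E1.ι) = (A.map E1.ι).map E2.ι := by ext i j; rfl
      have e2 : (B.map E2.ι * P1).map E2.T.σF = (B.map E1.T.σF).map E2.ι * P1.map E2.T.σF := by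
        rw [Matrix.map_mul]
        congr 1
        ext i j
        simp only [Matrix.map_apply]
        rw [E2.σ_ι]
      have e3 : (A.map E1.ι).map E2.ι * (B.map E1.T.σF).map E2.ι = B.map E2.ι * A1.map E2.ι := by
        rw [← Matrix.map_mul, hBA1, Matrix.map_mul]
      change A.map (E2.ι.comp E1.ι) * (B.map E2.ι * P1).map E2.T.σF =
        B.map E2.ι * P1 * Matrix.diagonal (Fin.cons (E2.ι l) c2 : Fin (n + 1) → E2.T.F)
      rw [e1, e2, ← Matrix.mul_assoc, e3, Matrix.mul_assoc, hmain, ← Matrix.mul_assoc]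

end AnSetting


namespace AnSetting

section Dwork
variable {p : ℕ} [hp : Fact p.Prime] (S : AnSetting p) {r : ℕ}

/-- Matrices all of whose entries vanish below order `m`. -/
def MV (m : ℤ) (X : Matrix (Fin r) (Fin r) S.Γac) : Prop :=
  ∀ i j, ∀ n : ℤ, n < m → S.coeff (X i j) n = 0

/-- Matrices with a bound on coefficients of index at most `N`. -/
def MB (N : ℤ) (C : ℝ) (X : Matrix (Fin r) (Fin r) S.Γac) : Prop :=
  ∀ i j, ∀ n : ℤ, n ≤ N → S.abv (S.coeff (X i j) n) ≤ C

variable {S}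

lemma MV.add {m : ℤ} {X Y : Matrix (Fin r) (Fin r) S.Γac} (hX : S.MV m X) (hY : S.MV m Y) :
    S.MV m (X + Y) := fun i j n hn => by
  rw [Matrix.add_apply, S.coeff_add, hX i j n hn, hY i j n hn, add_zero]

lemma MV.sub {m : ℤ} {X Y : Matrix (Fin r) (Fin r) S.Γac} (hX : S.MV m X) (hY : S.MV m Y) :
    S.MV m (X - Y) := fun i j n hn => by
  rw [Matrix.sub_apply, S.coeff_sub, hX i j n hn, hY i j n hn, sub_zero]

lemma MV.mono {m m' : ℤ} (h : m' ≤ m) {X : Matrix (Fin r) (Fin r) S.Γac} (hX : S.MV m X) :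
    S.MV m' X := fun i j n hn => hX i j n (hn.trans_le h)

lemma MV.smul {m : ℤ} (a : S.F) {X : Matrix (Fin r) (Fin r) S.Γac} (hX : S.MV m X) :
    S.MV m (S.const a • X) := fun i j n hn => by
  rw [Matrix.smul_apply, smul_eq_mul, S.coeff_const_mul, hX i j n hn, mul_zero]

lemma MV.mul_left {m : ℤ} {X Y : Matrix (Fin r) (Fin r) S.Γac} (hX : S.MV 0 X) (hY : S.MV m Y) :
    S.MV m (X * Y) := fun i j n hn => by
  rw [Matrix.mul_apply, S.coeff_sum]
  refine Finset.sum_eq_zero fun k _ => ?_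
  rw [S.coeff_mul_eq ∅]
  · rfl
  · intro a _
    by_cases ha : a < 0
    · rw [hX i k a ha, zero_mul]
    · rw [hY k j (n - a) (by omega), mul_zero]

lemma MV.mul_right {m : ℤ} {X Y : Matrix (Fin r) (Fin r) S.Γac} (hX : S.MV m X) (hY : S.MV 0 Y) :
    S.MV m (X * Y) := fun i j n hn => by
  rw [Matrix.mul_apply, S.coeff_sum]
  refine Finset.sum_eq_zero fun k _ => ?_
  rw [S.coeff_mul_eq ∅]
  · rfl
  · intro a _
    by_cases ha : a < m
    · rw [hX i k a ha, zero_mul]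
    · rw [hY k j (n - a) (by omega), mul_zero]

lemma MV.frob {m : ℤ} {X : Matrix (Fin r) (Fin r) S.Γac} (hX : S.MV m X) :
    S.MV (p * m) (X.map S.frob) := fun i j n hn => by
  rw [Matrix.map_apply, S.coeff_frob]
  split_ifs with h
  · rw [hX, map_zero]
    have hp0 : (0 : ℤ) < p := by exact_mod_cast hp.out.pos
    exact Int.ediv_lt_of_lt_mul hp0 (by linarith [mul_comm (p : ℤ) m])
  · rfl

lemma MV.eq_zero {X : Matrix (Fin r) (Fin r) S.Γac} (h : ∀ k : ℕ, S.MV (p ^ k : ℕ) X) : X = 0 := by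
  ext i j
  refine S.ext fun n => ?_
  rw [Matrix.zero_apply, S.coeff_zero]
  refine h n.natAbs i j n ?_
  have h1 : n.natAbs < p ^ n.natAbs := Nat.lt_pow_self hp.out.one_lt
  omega

lemma MV_one : S.MV 0 (1 : Matrix (Fin r) (Fin r) S.Γac) := fun i j n hn => by
  rw [Matrix.one_apply]
  split_ifs
  · rw [S.coeff_one, if_neg (by omega)]
  · exact S.coeff_zero n

lemma MV_const (M : Matrix (Fin r) (Fin r) S.F) : S.MV 0 (M.map S.const) := fun i j n hn => by
  rw [Matrix.map_apply, S.coeff_const, if_neg (by omega)]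

lemma MB.mul_left {N : ℤ} {C : ℝ} (hC : 0 ≤ C) {X Y : Matrix (Fin r) (Fin r) S.Γac}
    (hX : S.MV 0 X) (hX1 : ∀ N, S.MB N 1 X) (hY : S.MB N C Y) : S.MB N C (X * Y) :=
  fun i j n hn => by
  rw [Matrix.mul_apply, S.coeff_sum]
  refine S.abv_sum_le _ _ hC fun k _ => S.coeff_mul_le hC fun a => ?_
  by_cases ha : a < 0
  · rw [hX i k a ha, S.abv_zero, zero_mul]; exact hC
  · calc _ ≤ 1 * C := mul_le_mul (hX1 a i k a le_rfl) (hY k j (n - a) (by omega))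
          (S.abv_nonneg _) zero_le_one
      _ = C := one_mul C

lemma MB.mul_right {N : ℤ} {C : ℝ} (hC : 0 ≤ C) {X Y : Matrix (Fin r) (Fin r) S.Γac}
    (hY : S.MV 0 Y) (hY1 : ∀ N, S.MB N 1 Y) (hX : S.MB N C X) : S.MB N C (X * Y) :=
  fun i j n hn => by
  rw [Matrix.mul_apply, S.coeff_sum]
  refine S.abv_sum_le _ _ hC fun k _ => S.coeff_mul_le hC fun a => ?_
  by_cases ha : n - a < 0
  · rw [hY k j _ ha, S.abv_zero, mul_zero]; exact hC
  · calc _ ≤ C * 1 := mul_le_mul (hX i k a (by omega)) (hY1 _ k j (n - a) le_rfl)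
          (S.abv_nonneg _) hC
      _ = C := mul_one C

lemma MB.frob {N : ℤ} {C : ℝ} (hC : 0 ≤ C) {X : Matrix (Fin r) (Fin r) S.Γac} (hX : S.MB N C X) {N' : ℤ}
    (hN : N' < p * (N + 1)) : S.MB N' C (X.map S.frob) := fun i j n hn => by
  rw [Matrix.map_apply, S.coeff_frob]
  split_ifs with h
  · rw [S.abv_σF]
    refine hX i j _ ?_
    have hp0 : (0 : ℤ) < p := by exact_mod_cast hp.out.pos
    have : n / p < N + 1 := Int.ediv_lt_of_lt_mul hp0 (by linarith [mul_comm (p : ℤ) (N + 1)])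
    omega
  · rw [S.abv_zero]; exact hC

variable (S)

/-- Uniqueness in Dwork's trick. -/
lemma dwork_unique (ℓ : ℕ) {P Q X : Matrix (Fin r) (Fin r) S.Γac} (hP : S.MV 0 P) (hQ : S.MV 0 Q)
    (hX : S.MV 1 X) (h : S.const ((p : S.F) ^ ℓ) • X = P * X.map S.frob * Q) : X = 0 := by
  have hpl : (p : S.F) ^ ℓ ≠ 0 := pow_ne_zero _ S.p_ne_zero
  have hX' : X = S.const ((p : S.F) ^ ℓ)⁻¹ • (P * X.map S.frob * Q) := by
    rw [← h, smul_smul, ← map_mul, inv_mul_cancel₀ hpl, map_one, one_smul]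
  refine MV.eq_zero fun k => ?_
  induction k with
  | zero => simpa using hX
  | succ k ih =>
    rw [hX']
    refine MV.smul _ (MV.mul_right (MV.mul_left hP ?_) hQ)
    have := ih.frob
    refine this.mono ?_
    push_cast
    rw [pow_succ, mul_comm]

lemma poly_growth (ℓ : ℕ) (ε : ℝ) (hε : 0 < ε) : ∃ N : ℤ, 0 ≤ N ∧ ∀ n : ℤ, N ≤ n →
    ((p : ℝ) ^ ℓ) ^ (Nat.log p n.toNat + 1) ≤ (1 + ε) ^ n := by
  have h1 : Filter.Tendsto (fun n : ℕ => (n : ℝ) ^ ℓ * (1 / (1 + ε)) ^ n) Filter.atTop (nhds 0) := by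
    refine tendsto_pow_const_mul_const_pow_of_abs_lt_one ℓ ?_
    rw [abs_of_pos (by positivity), div_lt_one (by linarith)]
    linarith
  have hc : (0 : ℝ) < ((p : ℝ) ^ ℓ)⁻¹ := inv_pos.mpr (pow_pos p_pos _)
  obtain ⟨N, hN⟩ := Filter.eventually_atTop.mp (h1.eventually (gt_mem_nhds hc))
  refine ⟨N + 1, by positivity, fun n hn => ?_⟩
  lift n to ℕ using by omega
  rw [Int.toNat_natCast, zpow_natCast]
  have hn' : N ≤ n := by omega
  have h2 := hN n hn'
  have h3 : (p : ℝ) ^ (Nat.log p n) ≤ n := by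
    exact_mod_cast Nat.pow_log_le_self p (by omega)
  have hpos : (0 : ℝ) < (1 + ε) ^ n := by positivity
  rw [one_div, inv_pow, ← div_eq_mul_inv, div_lt_iff₀ hpos] at h2
  have h4 : (n : ℝ) ^ ℓ * (p : ℝ) ^ ℓ ≤ (1 + ε) ^ n := by
    have := mul_le_mul_of_nonneg_right h2.le (pow_pos (p_pos (p := p)) ℓ).le
    rwa [mul_comm _ ((1 + ε) ^ n), mul_assoc, inv_mul_cancel₀ (pow_pos p_pos ℓ).ne', mul_one] at this
  refine le_trans ?_ h4
  rw [← pow_mul, mul_comm, pow_mul, ← mul_pow, pow_succ]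
  exact pow_le_pow_left₀ (by have := p_pos (p := p); positivity) (mul_le_mul_of_nonneg_right h3 p_pos.le) _

theorem dwork (ℓ : ℕ) {P Q : Matrix (Fin r) (Fin r) S.Γac} (hP : S.MV 0 P) (hQ : S.MV 0 Q)
    (hP1 : ∀ N, S.MB N 1 P) (hQ1 : ∀ N, S.MB N 1 Q)
    (hPQ : S.MV 1 (P * Q - S.const ((p : S.F) ^ ℓ) • 1)) :
    ∃ U : Matrix (Fin r) (Fin r) S.Γac, S.MV 0 U ∧ S.MV 1 (U - 1) ∧
      S.const ((p : S.F) ^ ℓ) • U = P * U.map S.frob * Q := by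
  have hpl : (p : S.F) ^ ℓ ≠ 0 := pow_ne_zero _ S.p_ne_zero
  have hpa : S.abv ((p : S.F) ^ ℓ)⁻¹ = (p : ℝ) ^ ℓ := by
    rw [S.abv_inv, S.abv_pow, S.abv_p, inv_pow, inv_inv]
  obtain ⟨Θ, hΘ⟩ : ∃ Θ : Matrix (Fin r) (Fin r) S.Γac → Matrix (Fin r) (Fin r) S.Γac, ∀ X, Θ X =
    S.const ((p : S.F) ^ ℓ)⁻¹ • (P * X.map S.frob * Q) := ⟨_, fun _ => rfl⟩
  have hΘsub : ∀ X Y, Θ X - Θ Y = Θ (X - Y) := by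
    intro X Y
    have : (X - Y).map S.frob = X.map S.frob - Y.map S.frob := by
      ext i j; simp
    rw [hΘ, hΘ, hΘ, ← smul_sub, this, Matrix.mul_sub, Matrix.sub_mul]
  have hΘV : ∀ m X, S.MV m X → S.MV (p * m) (Θ X) := by
    intro m X h
    rw [hΘ]
    exact MV.smul _ (MV.mul_right (MV.mul_left hP h.frob) hQ)
  obtain ⟨u, hu0, hu⟩ : ∃ u : ℕ → Matrix (Fin r) (Fin r) S.Γac, u 0 = 1 ∧ ∀ k, u (k + 1) = Θ (u k) :=
    ⟨fun k => Θ^[k] 1, rfl, fun k => Function.iterate_succ_apply' _ _ _⟩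
  have huV : ∀ k, S.MV 0 (u k) := by
    intro k
    induction k with
    | zero => rw [hu0]; exact MV_one
    | succ k ih =>
      rw [hu]
      have := hΘV 0 _ ih
      rwa [mul_zero] at this
  have hdiff : ∀ k, S.MV (p ^ k : ℕ) (u (k + 1) - u k) := by
    intro k
    induction k with
    | zero =>
      have h1 : u 1 - u 0 = S.const ((p : S.F) ^ ℓ)⁻¹ • (P * Q - S.const ((p : S.F) ^ ℓ) • 1) := by
        rw [hu, hu0, hΘ, smul_sub, smul_smul, ← map_mul, inv_mul_cancel₀ hpl, map_one, one_smul,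
          Matrix.map_one _ (map_zero _) (map_one _), Matrix.mul_one]
      rw [zero_add, h1]
      simpa using hPQ.smul _
    | succ k ih =>
      rw [hu (k + 1), hu k, hΘsub, ← hu k]
      refine (hΘV _ _ ih).mono ?_
      push_cast
      rw [pow_succ, mul_comm]
  have hdiff' : ∀ k d, S.MV (p ^ k : ℕ) (u (k + d) - u k) := by
    intro k d
    induction d with
    | zero =>
      rw [add_zero, sub_self]
      exact fun i j n _ => S.coeff_zero n
    | succ d ih =>
      have : u (k + (d + 1)) - u k = (u (k + d + 1) - u (k + d)) + (u (k + d) - u k) := by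
        rw [← add_assoc]; abel
      rw [this]
      refine MV.add ((hdiff (k + d)).mono ?_) ih
      exact_mod_cast Nat.pow_le_pow_right hp.out.pos (Nat.le_add_right k d)
  have hbd : ∀ k j : ℕ, S.MB ((p ^ j : ℕ) - 1) (((p : ℝ) ^ ℓ) ^ j) (u k) := by
    intro k
    have h1p : (1 : ℝ) ≤ (p : ℝ) ^ ℓ := one_le_pow₀ one_lt_p.le
    have hone : ∀ N, S.MB N 1 (1 : Matrix (Fin r) (Fin r) S.Γac) := by
      intro N a b n hn
      rw [Matrix.one_apply]
      split_ifs
      · rw [S.coeff_one]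
        split_ifs
        · rw [S.abv_one]
        · rw [S.abv_zero]; exact zero_le_one
      · rw [S.coeff_zero, S.abv_zero]; exact zero_le_one
    induction k with
    | zero =>
      intro j a b n hn
      rw [hu0]
      exact (hone n a b n le_rfl).trans (one_le_pow₀ h1p)
    | succ k ih =>
      intro j
      rcases j with _ | j
      · intro a b n hn
        have h1 := hdiff' 0 (k + 1) a b n (by simp at hn ⊢; omega)
        rw [zero_add, hu0, Matrix.sub_apply, S.coeff_sub, sub_eq_zero] at h1
        rw [h1, pow_zero]
        exact hone n a b n le_rfl
      · have hC : (0 : ℝ) ≤ ((p : ℝ) ^ ℓ) ^ j := by positivity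
        have h2 : S.MB ((p ^ (j + 1) : ℕ) - 1) (((p : ℝ) ^ ℓ) ^ j) (P * (u k).map S.frob * Q) := by
          refine MB.mul_right hC hQ hQ1 (MB.mul_left hC hP hP1 (MB.frob hC (ih j) ?_))
          push_cast
          rw [pow_succ, sub_add_cancel, mul_comm]
          exact sub_one_lt _
        intro a b n hn
        rw [hu, hΘ, Matrix.smul_apply, smul_eq_mul, S.coeff_const_mul, S.abv_mul, hpa, pow_succ,
          mul_comm]
        exact mul_le_mul_of_nonneg_right (h2 a b n hn) (by positivity)
  obtain ⟨f, hf⟩ : ∃ f : Fin r → Fin r → ℤ → S.F, ∀ i j n, f i j n =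
    S.coeff (u n.natAbs i j) n := ⟨_, fun _ _ _ => rfl⟩
  have hfn : ∀ (i j : Fin r) (n : ℤ) (k : ℕ), n < (p ^ k : ℕ) → f i j n = S.coeff (u k i j) n := by
    intro i j n k hn
    have hn2 : n < (p ^ n.natAbs : ℕ) := by
      have h1 : n.natAbs < p ^ n.natAbs := Nat.lt_pow_self hp.out.one_lt
      omega
    rw [hf]
    rcases le_total k n.natAbs with h | h
    · obtain ⟨d, hd⟩ := Nat.exists_eq_add_of_le h
      have := hdiff' k d i j n hn
      rw [Matrix.sub_apply, S.coeff_sub, sub_eq_zero, ← hd] at this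
      exact this
    · obtain ⟨d, hd⟩ := Nat.exists_eq_add_of_le h
      have := hdiff' n.natAbs d i j n hn2
      rw [Matrix.sub_apply, S.coeff_sub, sub_eq_zero, ← hd] at this
      exact this.symm
  have hex : ∀ i j, ∃ x, S.coeff x = f i j := by
    intro i j
    refine S.mk_of_decay _ (fun ε hε => ?_) ⟨1 / 2, 1, by norm_num, by norm_num, fun n hn => ?_⟩
    · obtain ⟨N, hN0, hN⟩ := poly_growth (p := p) ℓ ε hε
      refine ⟨N, hN0, fun n hn => ?_⟩
      refine le_trans ?_ (hN n hn)
      have h1 : n.toNat < p ^ (Nat.log p n.toNat + 1) := Nat.lt_pow_succ_log_self hp.out.one_lt _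
      have h2 : n < (p ^ (Nat.log p n.toNat + 1) : ℕ) := by omega
      rw [hfn i j n _ h2]
      exact hbd _ _ i j n (by omega)
    · rw [hf, huV _ i j n hn, S.abv_zero]
      positivity
  choose U' hU' using hex
  obtain ⟨U, hU⟩ : ∃ U : Matrix (Fin r) (Fin r) S.Γac, ∀ i j, U i j = U' i j :=
    ⟨Matrix.of U', fun _ _ => rfl⟩
  have hUk : ∀ k, S.MV (p ^ k : ℕ) (U - u k) := by
    intro k i j n hn
    rw [Matrix.sub_apply, S.coeff_sub, hU, hU', hfn i j n k hn, sub_self]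
  refine ⟨U, ?_, ?_, ?_⟩
  · have h1 := ((hUk 0).mono (m' := 0) (by positivity)).add (huV 0)
    rwa [sub_add_cancel] at h1
  · have := hUk 0
    rw [hu0] at this
    simpa using this
  · have h0 : U - Θ U = 0 := by
      refine MV.eq_zero fun k => ?_
      have : U - Θ U = (U - u (k + 1)) - Θ (U - u k) := by
        rw [← hΘsub, ← hu]; abel
      rw [this]
      refine MV.sub ((hUk (k + 1)).mono ?_) ((hΘV _ _ (hUk k)).mono ?_)
      · exact_mod_cast Nat.pow_le_pow_right hp.out.pos (Nat.le_succ k)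
      · have h1 : p ^ k ≤ p * p ^ k := Nat.le_mul_of_pos_left _ hp.out.pos
        exact_mod_cast h1
    have h1 := sub_eq_zero.mp h0
    conv_lhs => rw [h1, hΘ, smul_smul, ← map_mul, mul_inv_cancel₀ hpl, map_one, one_smul]

end Dwork
end AnSetting


namespace AnSetting

section Forward
variable {p : ℕ} [hp : Fact p.Prime] (S : AnSetting p) {r : ℕ}

lemma smul_const_cancel {a : S.F} (ha : a ≠ 0) {X Y : Matrix (Fin r) (Fin r) S.Γac}
    (h : S.const a • X = S.const a • Y) : X = Y := by
  have h1 := congrArg (fun Z => S.const a⁻¹ • Z) h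
  simpa only [smul_smul, ← map_mul, inv_mul_cancel₀ ha, map_one, one_smul] using h1

lemma MV_sub_const {X : Matrix (Fin r) (Fin r) S.Γac} (hX : S.MV 0 X) :
    S.MV 1 (X - (X.map fun x => S.coeff x 0).map S.const) := fun i j n hn => by
  rw [Matrix.sub_apply, S.coeff_sub, Matrix.map_apply, Matrix.map_apply, S.coeff_const]
  split_ifs with h
  · rw [h, sub_self]
  · rw [hX i j n (by omega), sub_zero]

lemma map_const_eq_zero {M : Matrix (Fin r) (Fin r) S.F} (h : S.MV 1 (M.map S.const)) : M = 0 := by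
  ext i j
  have := h i j 0 (by norm_num)
  rw [Matrix.map_apply, S.coeff_const, if_pos rfl] at this
  rw [this, Matrix.zero_apply]

lemma one_map_const (a : S.F) : S.const a • (1 : Matrix (Fin r) (Fin r) S.Γac) =
    (a • (1 : Matrix (Fin r) (Fin r) S.F)).map S.const := by
  ext i j
  by_cases h : i = j
  · subst h; simp
  · simp [h]

/-- Dwork's trick: a crystal over `Ω` becomes constant over the open disc. -/
theorem dwork_crystal (A₀ : Matrix (Fin r) (Fin r) S.Γac) (hA : S.IsCrystal S.omegaSet A₀) :
    ∃ (M : Matrix (Fin r) (Fin r) S.F) (U U' : Matrix (Fin r) (Fin r) S.Γac),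
      M.det ≠ 0 ∧ (∀ i j, S.abv (M i j) ≤ 1) ∧ U * U' = 1 ∧ U' * U = 1 ∧
      U * A₀ = M.map S.const * U.map S.frob ∧ U' * M.map S.const = A₀ * U'.map S.frob := by
  obtain ⟨hA1, B, ℓ, hB1, hAB, hBA⟩ := hA
  have hpl : (p : S.F) ^ ℓ ≠ 0 := pow_ne_zero _ S.p_ne_zero
  have hpc : (p : S.Γac) ^ ℓ = S.const ((p : S.F) ^ ℓ) := by
    rw [S.natCast_eq_const, map_pow]
  rw [hpc] at hAB hBA
  have hAV : S.MV 0 A₀ := fun i j n hn => (hA1 i j).2 n hn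
  have hBV : S.MV 0 B := fun i j n hn => (hB1 i j).2 n hn
  have hAb : ∀ N, S.MB N 1 A₀ := fun N i j n _ => (hA1 i j).1 n
  have hBb : ∀ N, S.MB N 1 B := fun N i j n _ => (hB1 i j).1 n
  obtain ⟨M, hM⟩ : ∃ M : Matrix (Fin r) (Fin r) S.F, M = A₀.map fun x => S.coeff x 0 := ⟨_, rfl⟩
  obtain ⟨N, hN⟩ : ∃ N : Matrix (Fin r) (Fin r) S.F, N = B.map fun x => S.coeff x 0 := ⟨_, rfl⟩
  have hM1 : ∀ i j, S.abv (M i j) ≤ 1 := fun i j => by rw [hM]; exact (hA1 i j).1 0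
  have hN1 : ∀ i j, S.abv (N i j) ≤ 1 := fun i j => by rw [hN]; exact (hB1 i j).1 0
  have hcb : ∀ (L : Matrix (Fin r) (Fin r) S.F), (∀ i j, S.abv (L i j) ≤ 1) →
      ∀ N, S.MB N 1 (L.map S.const) := by
    intro L hL N i j n _
    rw [Matrix.map_apply, S.coeff_const]
    split_ifs
    · exact hL i j
    · rw [S.abv_zero]; exact zero_le_one
  have hdA : S.MV 1 (A₀ - M.map S.const) := by rw [hM]; exact S.MV_sub_const hAV
  have hdB : S.MV 1 (B - N.map S.const) := by rw [hN]; exact S.MV_sub_const hBV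
  have hMB : S.MV 1 (M.map S.const * B - S.const ((p : S.F) ^ ℓ) • 1) := by
    have h : M.map S.const * B - S.const ((p : S.F) ^ ℓ) • 1 =
        0 - (A₀ - M.map S.const) * B := by
      rw [← hAB, Matrix.sub_mul]; abel
    rw [h]
    exact MV.sub (fun i j n _ => S.coeff_zero n) (hdA.mul_right hBV)
  have hAN : S.MV 1 (A₀ * N.map S.const - S.const ((p : S.F) ^ ℓ) • 1) := by
    have h : A₀ * N.map S.const - S.const ((p : S.F) ^ ℓ) • 1 =
        0 - A₀ * (B - N.map S.const) := by
      rw [← hAB, Matrix.mul_sub]; abel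
    rw [h]
    exact MV.sub (fun i j n _ => S.coeff_zero n) (MV.mul_left hAV hdB)
  have hMN : M * N = (p : S.F) ^ ℓ • 1 := by
    refine sub_eq_zero.mp (S.map_const_eq_zero ?_)
    have h : (M * N - (p : S.F) ^ ℓ • 1).map S.const =
        (M.map S.const * B - S.const ((p : S.F) ^ ℓ) • 1) -
          M.map S.const * (B - N.map S.const) := by
      rw [S.one_map_const, Matrix.mul_sub, ← Matrix.map_mul]
      ext i j
      simp only [Matrix.map_apply, Matrix.sub_apply, map_sub]
      abel
    rw [h]
    exact MV.sub hMB (MV.mul_left (MV_const M) hdB)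
  have hdet : M.det ≠ 0 := by
    intro h
    have h1 := congrArg Matrix.det hMN
    rw [Matrix.det_mul, h, zero_mul, Matrix.det_smul, Matrix.det_one, mul_one] at h1
    exact pow_ne_zero _ hpl h1.symm
  have hNM : N.map S.const * M.map S.const = S.const ((p : S.F) ^ ℓ) • 1 := by
    have h1 : M * (((p : S.F) ^ ℓ)⁻¹ • N) = 1 := by
      rw [Matrix.mul_smul, hMN, smul_smul, inv_mul_cancel₀ hpl, one_smul]
    have h2 := mul_eq_one_comm.mp h1
    have h3 : N * M = (p : S.F) ^ ℓ • 1 := by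
      rw [← h2, Matrix.smul_mul, smul_smul, mul_inv_cancel₀ hpl, one_smul]
    rw [S.one_map_const, ← h3, Matrix.map_mul]
  obtain ⟨U, hU0, hU1, hU⟩ := S.dwork ℓ (MV_const M) hBV (hcb M hM1) hBb hMB
  obtain ⟨V, hV0, hV1, hV⟩ := S.dwork ℓ hAV (MV_const N) hAb (hcb N hN1) hAN
  have e1 : U * A₀ = M.map S.const * U.map S.frob := by
    refine S.smul_const_cancel hpl ?_
    rw [← Matrix.smul_mul, hU, Matrix.mul_assoc, hBA, Matrix.mul_smul, Matrix.mul_one]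
  have e2 : V * M.map S.const = A₀ * V.map S.frob := by
    refine S.smul_const_cancel hpl ?_
    rw [← Matrix.smul_mul, hV, Matrix.mul_assoc, hNM, Matrix.mul_smul, Matrix.mul_one]
  have e3 : U * V = 1 := by
    refine sub_eq_zero.mp (S.dwork_unique ℓ (MV_const M) (MV_const N) ?_ ?_)
    · have h : U * V - 1 = (U - 1) * V + (V - 1) := by
        rw [Matrix.sub_mul, Matrix.one_mul]; abel
      rw [h]
      exact (hU1.mul_right hV0).add hV1
    · have h1 : (U * V - 1).map S.frob = U.map S.frob * V.map S.frob - 1 := by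
        rw [← Matrix.map_mul]
        ext i j
        simp only [Matrix.map_apply, Matrix.sub_apply, map_sub, Matrix.one_apply]
        split_ifs <;> simp
      have h2 : M.map S.const * N.map S.const = S.const ((p : S.F) ^ ℓ) • 1 := by
        rw [S.one_map_const, ← hMN, Matrix.map_mul]
      rw [h1, Matrix.mul_sub, Matrix.sub_mul, Matrix.mul_one, h2, smul_sub, ← Matrix.mul_smul, hV]
      congr 1
      rw [← Matrix.mul_assoc, ← Matrix.mul_assoc, e1, Matrix.mul_assoc (M.map S.const)]
  exact ⟨M, U, V, hdet, hM1, e3, mul_eq_one_comm.mp e3, e1, e2⟩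

lemma abv_eigen_le (M P : Matrix (Fin r) (Fin r) S.F) (c : Fin r → S.F)
    (hM : ∀ i j, S.abv (M i j) ≤ 1) (hP : P.det ≠ 0)
    (h : M * P.map S.σF = P * Matrix.diagonal c) (i : Fin r) : S.abv (c i) ≤ 1 := by
  obtain ⟨k, -, hk⟩ := Finset.exists_max_image (Finset.univ : Finset (Fin r))
    (fun k => S.abv (P k i)) ⟨i, Finset.mem_univ i⟩
  have hk0 : P k i ≠ 0 := by
    intro h0
    refine hP (Matrix.det_eq_zero_of_column_eq_zero i fun l => ?_)
    rw [← S.abv_eq_zero]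
    refine le_antisymm ?_ (S.abv_nonneg _)
    have := hk l (Finset.mem_univ l)
    simpa only [h0, S.abv_zero] using this
  have hpos : 0 < S.abv (P k i) :=
    lt_of_le_of_ne (S.abv_nonneg _) fun h0 => hk0 ((S.abv_eq_zero _).mp h0.symm)
  have h1 := congrFun (congrFun h k) i
  rw [Matrix.mul_diagonal, Matrix.mul_apply] at h1
  have h2 : S.abv (P k i * c i) ≤ S.abv (P k i) := by
    rw [← h1]
    refine S.abv_sum_le _ _ hpos.le fun l _ => ?_
    rw [S.abv_mul, Matrix.map_apply, S.abv_σF]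
    calc _ ≤ 1 * S.abv (P k i) := mul_le_mul (hM k l) (hk l (Finset.mem_univ l))
          (S.abv_nonneg _) zero_le_one
      _ = _ := one_mul _
  rw [S.abv_mul] at h2
  nlinarith

theorem constant_of_semistable (A A₀ : Matrix (Fin r) (Fin r) S.Γac)
    (hA₀ : S.IsCrystal S.omegaSet A₀) (hiso : S.Isogenous S.frob S.conSet A A₀) :
    ∃ (E : AnExt p S) (c : Fin r → E.T.F),
        (∀ i, c i ≠ 0 ∧ E.T.abv (c i) ≤ 1) ∧
        E.T.Isogenous E.T.frob Set.univ (A.map E.j)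
          (Matrix.diagonal fun i => E.T.const (c i)) := by
  obtain ⟨H, H', c0, hc0, hc1, -, hH, hH', hHH, hHH'⟩ := hiso
  obtain ⟨M, U, V, hM, hM1, hUV, hVU, hU, hV⟩ := S.dwork_crystal A₀ hA₀
  obtain ⟨E, P, c, hP, hc, hE⟩ := dieudonne_manin r S M hM
  refine ⟨E, c, fun i => ⟨hc i, E.T.abv_eigen_le (M.map E.ι) P c ?_ hP hE i⟩, ?_⟩
  · intro i j
    rw [Matrix.map_apply, E.abv_ι]
    exact hM1 i j
  have hjc : ∀ a, E.j (S.const a) = E.T.const (E.ι a) := by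
    intro a
    refine E.T.ext fun n => ?_
    rw [E.coeff_j, S.coeff_const, E.T.coeff_const]
    split_ifs
    · rfl
    · exact map_zero _
  have hjf : ∀ X : Matrix (Fin r) (Fin r) S.Γac, (X.map E.j).map E.T.frob = (X.map S.frob).map E.j := by
    intro X; ext a b; simp [E.frob_j]
  have hcf : ∀ X : Matrix (Fin r) (Fin r) E.T.F,
      (X.map E.T.const).map E.T.frob = (X.map E.T.σF).map E.T.const := by
    intro X; ext a b; simp [E.T.frob_const]
  have hMj : (M.map S.const).map E.j = (M.map E.ι).map E.T.const := by
    ext a b; simp [hjc]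
  have hD : (Matrix.diagonal fun i => E.T.const (c i)) = (Matrix.diagonal c).map E.T.const := by
    rw [Matrix.diagonal_map (map_zero _)]
  have hPu : IsUnit P.det := isUnit_iff_ne_zero.mpr hP
  obtain ⟨G, hGP, hPG⟩ : ∃ G, G * P = 1 ∧ P * G = 1 :=
    ⟨P⁻¹, Matrix.nonsing_inv_mul _ hPu, Matrix.mul_nonsing_inv _ hPu⟩
  have hPGσ : P.map E.T.σF * G.map E.T.σF = 1 := by
    rw [← Matrix.map_mul, hPG, Matrix.map_one _ (map_zero _) (map_one _)]
  have hG : G * M.map E.ι = Matrix.diagonal c * G.map E.T.σF := by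
    calc G * M.map E.ι = G * (M.map E.ι * P.map E.T.σF) * G.map E.T.σF := by
          rw [Matrix.mul_assoc, Matrix.mul_assoc, hPGσ, Matrix.mul_one]
      _ = _ := by rw [hE, ← Matrix.mul_assoc, hGP, Matrix.one_mul]
  have hGPc : G.map E.T.const * P.map E.T.const = 1 := by
    rw [← Matrix.map_mul, hGP, Matrix.map_one _ (map_zero _) (map_one _)]
  have hPGc : P.map E.T.const * G.map E.T.const = 1 := by
    rw [← Matrix.map_mul, hPG, Matrix.map_one _ (map_zero _) (map_one _)]
  have hGc : G.map E.T.const * (M.map S.const).map E.j =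
      (Matrix.diagonal c).map E.T.const * (G.map E.T.const).map E.T.frob := by
    rw [hMj, hcf, ← Matrix.map_mul, hG, Matrix.map_mul]
  have hPc : P.map E.T.const * (Matrix.diagonal c).map E.T.const =
      (M.map S.const).map E.j * (P.map E.T.const).map E.T.frob := by
    rw [hMj, hcf, ← Matrix.map_mul, ← hE, Matrix.map_mul]
  have hsm : ∀ a, (S.const a • (1 : Matrix (Fin r) (Fin r) S.Γac)).map E.j =
      E.T.const (E.ι a) • 1 := by
    intro a; ext x y
    by_cases h : x = y
    · subst h; simp [hjc]
    · simp [h]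
  have hUH : (U * H) * A = M.map S.const * (U * H).map S.frob := by
    rw [Matrix.mul_assoc, hH, ← Matrix.mul_assoc, hU, Matrix.mul_assoc, ← Matrix.map_mul]
  have hHV : (H' * V) * M.map S.const = A * (H' * V).map S.frob := by
    rw [Matrix.mul_assoc, hV, ← Matrix.mul_assoc, hH', Matrix.mul_assoc, ← Matrix.map_mul]
  have hprod1 : (H' * V) * (U * H) = S.const c0 • 1 := by
    rw [Matrix.mul_assoc, ← Matrix.mul_assoc V, hVU, Matrix.one_mul, hHH]
  have hprod2 : (U * H) * (H' * V) = S.const c0 • 1 := by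
    rw [Matrix.mul_assoc, ← Matrix.mul_assoc H, hHH', Matrix.smul_mul, Matrix.one_mul,
      Matrix.mul_smul, hUV]
  generalize U * H = X at *
  generalize H' * V = Y at *
  refine ⟨G.map E.T.const * X.map E.j, Y.map E.j * P.map E.T.const, E.ι c0, ?_, ?_,
    fun _ _ => ⟨Set.mem_univ _, Set.mem_univ _⟩, ?_, ?_, ?_, ?_⟩
  · exact (map_ne_zero _).mpr hc0
  · rw [E.abv_ι]; exact hc1
  · rw [hD, Matrix.mul_assoc, ← Matrix.map_mul, hUH, Matrix.map_mul, ← Matrix.mul_assoc, hGc,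
      Matrix.map_mul, hjf, Matrix.mul_assoc]
  · rw [hD, Matrix.mul_assoc, hPc, ← Matrix.mul_assoc, ← Matrix.map_mul, hHV, Matrix.map_mul,
      Matrix.map_mul, hjf, Matrix.mul_assoc]
  · rw [Matrix.mul_assoc, ← Matrix.mul_assoc (P.map _), hPGc, Matrix.one_mul, ← Matrix.map_mul,
      hprod1, hsm]
  · rw [Matrix.mul_assoc, ← Matrix.mul_assoc (X.map _), ← Matrix.map_mul, hprod2, hsm,
      Matrix.smul_mul, Matrix.one_mul, Matrix.mul_smul, hGPc]

end Forward
end AnSetting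

/-- Let `σ = σ_t` be the standard Frobenius and let `M` be an `F`-crystal
over `Γ_con` (presented by the matrix `A` of `F` on a basis).  Then `M` is semistable
(i.e. isogenous over `Γ_con` to `M₀ ⊗_Ω Γ_con` for some `F`-crystal `M₀` over `Ω`) if and
only if the `F`-crystal `M ⊗_{Γ_con} Γ_{an,con}` is constant (i.e., after a finite totally
ramified extension of `O` to which `σ` extends, it becomes isogenous over `Γ_{an,con}` to
a direct sum of trivial `F`-crystals). -/
theorem semistable_iff_constant {p : ℕ} [Fact p.Prime] (S : AnSetting p) {r : ℕ}
    (A : Matrix (Fin r) (Fin r) S.Γac) (hA : S.IsCrystal S.conSet A) :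
    (∃ A₀ : Matrix (Fin r) (Fin r) S.Γac,
        S.IsCrystal S.omegaSet A₀ ∧ S.Isogenous S.frob S.conSet A A₀) ↔
    (∃ (E : AnExt p S) (c : Fin r → E.T.F),
        (∀ i, c i ≠ 0 ∧ E.T.abv (c i) ≤ 1) ∧
        E.T.Isogenous E.T.frob Set.univ (A.map E.j)
          (Matrix.diagonal fun i => E.T.const (c i))) := by
  exact ⟨fun ⟨A₀, h1, h2⟩ => S.constant_of_semistable A A₀ h1 h2,
    fun ⟨E, c, hc, h⟩ => S.semistable_of_constant A hA E c hc h⟩
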